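/- arXiv:math/0306333 — 2 statements merged into one kernel-verified Lean document; each statement's English description precedes it below -/
import Mathlib

section
/- Let k be a field of characteristic zero, n ≥ 1, L = k(x_1,…,x_n), and G = PGL_{n+1}(k) acting on L by projective transformations. Let j : G → L^× be the Jacobian 1-cocycle (representing the class of Ω^n_{L/k}) and, for A ∈ GL_{n+1}(k), let d_A ∈ L^×/k^× be the class of A_{1,n+1}x_1 + ⋯ + A_{n,n+1}x_n + A_{n+1,n+1}. Then: (i) the image of the class of j in H^1(G, L^×/k^×) is the class of the 1-cocycle A ↦ d_A^{-(n+1)}; hence, since H^1(G, L^×/k^×) ≅ ℤ with generator the class of A ↦ d_A^{-1}, the class of Ω^n_{L/k} generates a subgroup of index n+1 in H^1(G, L^×/k^×); (ii) if k contains all (n+1)-st roots of unity and every element of k^× is an (n+1)-st power, then the class of Ω^n_{L/k} generates H^1(G, L^×): every 1-cocycle a : G → L^× is cohomologous to τ ↦ j(τ)^m for some integer m. -/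
theorem almost_inv_aux {k U X : Type*} [Field k] [CharZero k] [AddCommGroup U] [Module k U]
    (act : U → X → X) 
    (act_add : ∀ u u' P, act (u + u') P = act u (act u' P))
    (act_zero : ∀ P, act 0 P = P)
    (φ : U → X → ℤ) (hφ : ∀ u u' P, φ (u + u') P = φ u P + φ u' (act u P))
    (fin : ∀ u, {P | φ u P ≠ 0}.Finite) (e : U) :
    ∃ F : X → ℤ, {P | (∀ t : k, t ≠ 0 → act (t • e) P ≠ P) ∧ F P ≠ 0}.Finite ∧
      ∀ P, (∀ t : k, t ≠ 0 → act (t • e) P ≠ P) → ∀ u, φ u P = F (act u P) - F P := by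
  classical
  have act_comm : ∀ u u' P, act u (act u' P) = act u' (act u P) := by
    intro u u' P; rw [← act_add, ← act_add, add_comm]
  have inj : ∀ u P Q, act u P = act u Q → P = Q := by
    intro u P Q h
    have := congrArg (act (-u)) h
    simpa [← act_add, act_zero] using this
  have φ0 : ∀ P, φ 0 P = 0 := by
    intro P
    have := hφ 0 0 P
    rw [act_zero, add_zero] at this
    omega
  let XE : X → Prop := fun P => ∀ t : k, t ≠ 0 → act (t • e) P ≠ P
  have XEact : ∀ P, XE P → ∀ u, XE (act u P) := by
    intro P hP u t ht h
    rw [act_comm] at h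
    exact hP t ht (inj _ _ _ h)
  -- injectivity of the orbit map
  have orb : ∀ P, XE P → ∀ s t : k, act (s • e) P = act (t • e) P → s = t := by
    intro P hP s t h
    by_contra hne
    apply hP (s - t) (sub_ne_zero.mpr hne)
    apply inj (t • e)
    rw [← act_add, ← h, ← add_smul]; congr 2; ring
  -- for every u, φ u (act (N e) P) is eventually zero
  have ev0 : ∀ P, XE P → ∀ u, ∃ M : ℕ, ∀ N ≥ M, φ u (act ((N : k) • e) P) = 0 := by
    intro P hP u
    have hf : {N : ℕ | φ u (act ((N : k) • e) P) ≠ 0}.Finite := by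
      refine Set.Finite.preimage (f := fun N : ℕ => act ((N : k) • e) P) ?_ (fin u)
      intro a _ b _ hab
      exact_mod_cast orb P hP _ _ hab
    obtain ⟨M, hM⟩ := hf.bddAbove
    refine ⟨M + 1, fun N hN => ?_⟩
    by_contra h
    have := hM h
    omega
  have step : ∀ P (N : ℕ), φ (((N + 1 : ℕ) : k) • e) P
      = φ ((N : k) • e) P + φ e (act ((N : k) • e) P) := by
    intro P N
    rw [← hφ]; congr 1; push_cast; rw [add_smul, one_smul]
  have lim : ∀ P, XE P → ∃ c : ℤ, ∃ M : ℕ, ∀ N ≥ M, φ ((N : k) • e) P = c := by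
    intro P hP
    obtain ⟨M, hM⟩ := ev0 P hP e
    refine ⟨φ ((M : k) • e) P, M, fun N hN => ?_⟩
    induction N, hN using Nat.le_induction with
    | base => rfl
    | succ N hN ih => rw [step, ih, hM N hN, add_zero]
  let F : X → ℤ := fun P => if h : XE P then - (lim P h).choose else 0
  have Fspec : ∀ P, XE P → ∃ M : ℕ, ∀ N ≥ M, φ ((N : k) • e) P = - F P := by
    intro P hP
    have := (lim P hP).choose_spec
    simpa only [F, dif_pos hP, neg_neg] using this
  have Feq : ∀ P, XE P → ∀ u, φ u P = F (act u P) - F P := by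
    intro P hP u
    obtain ⟨M1, h1⟩ := Fspec P hP
    obtain ⟨M2, h2⟩ := Fspec _ (XEact P hP u)
    obtain ⟨M3, h3⟩ := ev0 P hP u
    let N := max M1 (max M2 M3)
    have e1 := hφ u ((N : k) • e) P
    have e2 := hφ ((N : k) • e) u P
    rw [add_comm u] at e1
    rw [h3 N (by omega), h1 N (by omega)] at e2
    rw [h2 N (by omega)] at e1
    omega
  have Fne : ∀ P, XE P → F P ≠ 0 → ∃ N : ℕ, φ e (act ((N : k) • e) P) ≠ 0 := by
    intro P hP hF
    by_contra! hcon
    have : ∀ N : ℕ, φ ((N : k) • e) P = 0 := by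
      intro N
      induction N with
      | zero => simp [φ0]
      | succ N ih => rw [step, ih, hcon, add_zero]
    obtain ⟨M, hM⟩ := Fspec P hP
    have := this M
    rw [hM M le_rfl] at this
    omega
  refine ⟨F, ?_, Feq⟩
  let S := (fin e).toFinset
  let r := S.card + 1
  have hr : (r : k) ≠ 0 := Nat.cast_ne_zero.mpr (Nat.succ_ne_zero _)
  refine Set.Finite.subset (Set.Finite.biUnion (Finset.range r).finite_toSet
    (fun i _ => fin ((((i : ℕ) : k) / r) • e))) ?_
  rintro P ⟨hP, hF⟩
  by_contra hcon
  simp only [Set.mem_iUnion, not_exists, Finset.coe_range, Set.mem_Iio, Set.mem_ofPred_eq, 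
    not_not] at hcon
  have h1 : ∀ i < r, ∃ N : ℕ, φ e (act ((N : k) • e) (act ((((i : ℕ) : k) / r) • e) P)) ≠ 0 := by
    intro i hi
    apply Fne _ (XEact P hP _)
    have := Feq P hP ((((i : ℕ) : k) / r) • e)
    rw [hcon i hi] at this
    omega
  choose! Nf hN using h1
  obtain ⟨i, hi, j, hj, hij, heq⟩ := Finset.exists_ne_map_eq_of_card_lt_of_maps_to
    (s := Finset.range r) (t := S)
    (f := fun i => act ((Nf i : k) • e) (act ((((i : ℕ) : k) / r) • e) P))
    (by simp [r]) (by
      intro i hi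
      simp only [S, Set.Finite.coe_toFinset]
      exact hN i (by simpa using hi))
  simp only [← act_add, ← add_smul] at heq
  have := orb P hP _ _ heq
  field_simp at this
  norm_cast at this
  simp only [Finset.mem_range] at hi hj
  apply hij
  have h3 := congrArg (· % r) this
  simpa [Nat.add_mod, Nat.mod_eq_of_lt hi, Nat.mod_eq_of_lt hj] using h3

theorem almost_inv {k U X ι : Type*} [Field k] [CharZero k] [AddCommGroup U] [Module k U]
    [Finite ι]
    (act : U → X → X) 
    (act_add : ∀ u u' P, act (u + u') P = act u (act u' P))
    (act_zero : ∀ P, act 0 P = P)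
    (φ : U → X → ℤ) (hφ : ∀ u u' P, φ (u + u') P = φ u P + φ u' (act u P))
    (fin : ∀ u, {P | φ u P ≠ 0}.Finite) (e : ι → U)
    (he : ∀ P, ∃ i, ∀ t : k, t ≠ 0 → act (t • e i) P ≠ P) :
    ∃ F : X → ℤ, {P | F P ≠ 0}.Finite ∧
      ∀ P, ∀ u, φ u P = F (act u P) - F P := by
  classical
  have act_comm : ∀ u u' P, act u (act u' P) = act u' (act u P) := by
    intro u u' P; rw [← act_add, ← act_add, add_comm]
  have inj : ∀ u P Q, act u P = act u Q → P = Q := by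
    intro u P Q h
    have := congrArg (act (-u)) h
    simpa [← act_add, act_zero] using this
  have h := fun i => almost_inv_aux (k := k) act act_add act_zero φ hφ fin (e i)
  choose Fi hfin hFi using h
  have hset : ∀ P u, (fun i => ∀ t : k, t ≠ 0 → act (t • e i) (act u P) ≠ act u P) =
      (fun i => ∀ t : k, t ≠ 0 → act (t • e i) P ≠ P) := by
    intro P u
    funext i
    apply propext
    refine forall_congr' fun t => forall_congr' fun _ => ?_
    rw [act_comm]
    exact not_congr ⟨fun h => inj _ _ _ h, fun h => by rw [h]⟩
  let G : (ι → Prop) → X → ℤ := fun Q P => if h : ∃ i, Q i then Fi h.choose P else 0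
  refine ⟨fun P => G (fun i => ∀ t : k, t ≠ 0 → act (t • e i) P ≠ P) P, ?_, ?_⟩
  · refine Set.Finite.subset (Set.finite_iUnion hfin) ?_
    intro P hP
    simp only [G, Set.mem_ofPred_eq, dif_pos (he P)] at hP
    exact Set.mem_iUnion.mpr ⟨_, (he P).choose_spec, hP⟩
  · intro P u
    simp only [hset]
    simp only [G, dif_pos (he P)]
    exact hFi _ P (he P).choose_spec u


section Val
variable (R : Type*) {L : Type*} [CommRing R] [IsDomain R] [UniqueFactorizationMonoid R] [Field L]
  [Algebra R L] [IsFractionRing R L]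

/-- the `p`-adic valuation on the fraction field of a factorial ring -/
noncomputable def vv (p : R) (y : L) : ℤ :=
  (multiplicity p (IsFractionRing.num R y) : ℤ) - multiplicity p (IsFractionRing.den R y : R)

variable {R}

theorem mult_mul' {p a b : R} (hp : Prime p) (ha : a ≠ 0) (hb : b ≠ 0) :
    multiplicity p (a * b) = multiplicity p a + multiplicity p b :=
  multiplicity_mul hp (FiniteMultiplicity.of_prime_left hp (mul_ne_zero ha hb))

theorem den_ne (y : L) : (IsFractionRing.den R y : R) ≠ 0 :=
  nonZeroDivisors.coe_ne_zero _

theorem num_ne {y : L} (hy : y ≠ 0) : IsFractionRing.num R y ≠ 0 := by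
  intro h
  apply hy
  rw [← IsFractionRing.mk'_num_den' R y, h, map_zero, zero_div]

theorem am_ne {a : R} (ha : a ≠ 0) : algebraMap R L a ≠ 0 := by
  simpa using ha

theorem vv_div {p a b : R} (hp : Prime p) (ha : a ≠ 0) (hb : b ≠ 0) :
    vv R p (algebraMap R L a / algebraMap R L b) = (multiplicity p a : ℤ) - multiplicity p b := by
  set y := algebraMap R L a / algebraMap R L b with hy
  have hy0 : y ≠ 0 := div_ne_zero (am_ne ha) (am_ne hb)
  have h := IsFractionRing.mk'_num_den' R y
  have h2 : IsFractionRing.num R y * b = a * IsFractionRing.den R y := by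
    apply IsFractionRing.injective R L
    rw [map_mul, map_mul]
    rw [hy] at h
    rw [div_eq_div_iff (am_ne (den_ne _)) (am_ne hb)] at h
    exact h
  have h3 := congrArg (multiplicity p) h2
  rw [mult_mul' hp (num_ne hy0) hb, mult_mul' hp ha (den_ne _)] at h3
  unfold vv
  omega

theorem exists_frac (y : L) (hy : y ≠ 0) : ∃ a b : R, a ≠ 0 ∧ b ≠ 0 ∧
    y = algebraMap R L a / algebraMap R L b :=
  ⟨_, _, num_ne hy, den_ne y, (IsFractionRing.mk'_num_den' R y).symm⟩

theorem vv_mul {p : R} (hp : Prime p) {y z : L} (hy : y ≠ 0) (hz : z ≠ 0) :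
    vv R p (y * z) = vv R p y + vv R p z := by
  obtain ⟨a, b, ha, hb, rfl⟩ := exists_frac (R := R) y hy
  obtain ⟨c, d, hc, hd, rfl⟩ := exists_frac (R := R) z hz
  rw [div_mul_div_comm, ← map_mul, ← map_mul, vv_div hp (mul_ne_zero ha hc) (mul_ne_zero hb hd),
    vv_div hp ha hb, vv_div hp hc hd, mult_mul' hp ha hc, mult_mul' hp hb hd]
  push_cast; ring

theorem vv_one {p : R} (hp : Prime p) : vv R p (1 : L) = 0 := by
  have := vv_mul hp (one_ne_zero (α := L)) (one_ne_zero (α := L))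
  rw [mul_one] at this
  omega

theorem vv_inv {p : R} (hp : Prime p) {y : L} (hy : y ≠ 0) :
    vv R p y⁻¹ = - vv R p y := by
  have := vv_mul hp hy (inv_ne_zero hy)
  rw [mul_inv_cancel₀ hy, vv_one hp] at this
  omega

theorem vv_zpow {p : R} (hp : Prime p) {y : L} (hy : y ≠ 0) (m : ℤ) :
    vv R p (y ^ m) = m * vv R p y := by
  induction m with
  | zero => simp [vv_one hp]
  | succ i ih => rw [zpow_add_one₀ hy, vv_mul hp (zpow_ne_zero _ hy) hy, ih]; ring
  | pred i ih => 
    rw [zpow_sub_one₀ hy, vv_mul hp (zpow_ne_zero _ hy) (inv_ne_zero hy), ih, vv_inv hp hy]; ring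

theorem vv_algebraMap {p a : R} (hp : Prime p) (ha : a ≠ 0) :
    vv R p (algebraMap R L a) = multiplicity p a := by
  have := vv_div (L := L) hp ha one_ne_zero
  rw [map_one, div_one] at this
  rw [this]
  have : multiplicity p (1 : R) = 0 := by
    rw [multiplicity_eq_zero]
    exact fun h => hp.not_isUnit (isUnit_of_dvd_one h)
  simp [this]

theorem vv_assoc {p q : R} (h : Associated p q) : (vv R p : L → ℤ) = vv R q := by
  funext y
  unfold vv
  rw [multiplicity_eq_of_associated_left h, multiplicity_eq_of_associated_left h]

theorem vv_self {p : R} (hp : Prime p) : vv R p (algebraMap R L p) = 1 := by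
  rw [vv_algebraMap hp hp.ne_zero, multiplicity_self]; rfl

theorem vv_prime {p q : R} (hp : Prime p) (hq : Prime q) (h : vv R p (algebraMap R L q) ≠ 0) :
    Associated p q := by
  rw [vv_algebraMap hp hq.ne_zero] at h
  have : p ∣ q := by
    by_contra hcon
    rw [← multiplicity_eq_zero] at hcon
    simp [hcon] at h
  exact hp.associated_of_dvd hq this

theorem vv_finite {y : L} (hy : y ≠ 0) :
    {v : L → ℤ | ∃ p : R, Prime p ∧ v = vv R p ∧ v y ≠ 0}.Finite := by
  classical
  set f := IsFractionRing.num R y * IsFractionRing.den R y with hf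
  have hf0 : f ≠ 0 := mul_ne_zero (num_ne hy) (den_ne y)
  refine Set.Finite.subset ((UniqueFactorizationMonoid.factors f).toFinset.finite_toSet.image
    (fun p => (vv R p : L → ℤ))) ?_
  rintro v ⟨p, hp, rfl, hv⟩
  have hpf : p ∣ f := by
    by_contra hcon
    have h1 : ¬ p ∣ IsFractionRing.num R y := fun h => hcon (h.mul_right _)
    have h2 : ¬ p ∣ (IsFractionRing.den R y : R) := fun h => hcon (h.mul_left _)
    rw [← multiplicity_eq_zero] at h1 h2
    apply hv
    simp [vv, h1, h2]
  obtain ⟨q, hq, hpq⟩ := UniqueFactorizationMonoid.exists_mem_factors_of_dvd hf0 hp.irreducible hpf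
  exact ⟨q, by simpa using hq, (vv_assoc hpq).symm⟩

theorem isUnit_of_vv {y : L} (hy : y ≠ 0) (h : ∀ p : R, Prime p → vv R p y = 0) :
    ∃ u : R, IsUnit u ∧ y = algebraMap R L u := by
  have key : IsUnit (IsFractionRing.num R y) ∧ IsUnit (IsFractionRing.den R y : R) := by
    have red := IsFractionRing.num_den_reduced R y
    have aux : ∀ p : R, Prime p → ¬ p ∣ IsFractionRing.num R y ∧ ¬ p ∣ (IsFractionRing.den R y : R) := by
      intro p hp
      have h0 := h p hp
      have h1 := multiplicity_eq_zero (a := p) (b := IsFractionRing.num R y)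
      have h2 := multiplicity_eq_zero (a := p) (b := (IsFractionRing.den R y : R))
      unfold vv at h0
      have h3 : ¬ (p ∣ IsFractionRing.num R y ∧ p ∣ (IsFractionRing.den R y : R)) := fun h =>
        hp.not_isUnit (red h.1 h.2)
      by_contra hcon
      have h4 : multiplicity p (IsFractionRing.num R y) = multiplicity p (IsFractionRing.den R y : R) := by omega
      rw [h4] at h1
      tauto
    constructor
    · by_contra hn
      obtain ⟨p, hp, hpd⟩ := WfDvdMonoid.exists_irreducible_factor hn (num_ne hy)
      exact (aux p hp.prime).1 hpd
    · by_contra hn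
      obtain ⟨p, hp, hpd⟩ := WfDvdMonoid.exists_irreducible_factor hn (den_ne y)
      exact (aux p hp.prime).2 hpd
  obtain ⟨h1, ⟨d, hd⟩⟩ := key
  refine ⟨IsFractionRing.num R y * (d⁻¹ : Rˣ), h1.mul (Units.isUnit _), ?_⟩
  conv_lhs => rw [← IsFractionRing.mk'_num_den' R y]
  rw [div_eq_iff (am_ne (den_ne y)), ← map_mul, ← hd, mul_assoc]
  simp

variable (R L) in
/-- the set of prime valuations -/
abbrev VX : Type _ := {v : L → ℤ // ∃ p : R, Prime p ∧ v = vv R p}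

theorem vv_realize (F : VX R L →₀ ℤ) : ∃ g : L, g ≠ 0 ∧ ∀ v : VX R L, v.1 g = F v := by
  classical
  induction F using Finsupp.induction_linear with
  | zero =>
    refine ⟨1, one_ne_zero, ?_⟩
    rintro ⟨v, p, hp, rfl⟩
    simp [vv_one hp]
  | add f g hf hg =>
    obtain ⟨a, ha, ha'⟩ := hf
    obtain ⟨b, hb, hb'⟩ := hg
    refine ⟨a * b, mul_ne_zero ha hb, ?_⟩
    intro v
    rw [Finsupp.add_apply, ← ha', ← hb']
    obtain ⟨v, p, hp, rfl⟩ := v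
    exact vv_mul hp ha hb
  | single w m =>
    obtain ⟨w, p, hp, rfl⟩ := w
    refine ⟨algebraMap R L p ^ m, zpow_ne_zero _ (am_ne hp.ne_zero), ?_⟩
    rintro ⟨v, q, hq, rfl⟩
    dsimp only
    rw [vv_zpow hq (am_ne hp.ne_zero), Finsupp.single_apply]
    split_ifs with h
    · have h' := congrArg Subtype.val h
      dsimp only at h'
      rw [← h', vv_self hp, mul_one]
    · have : vv R q (algebraMap R L p) = 0 := by
        by_contra hne
        apply h
        apply Subtype.ext
        exact (vv_assoc (vv_prime hq hp hne)).symm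
      rw [this, mul_zero]

theorem vv_comp {p : R} (hp : Prime p) (σ : L ≃+* L) (s : R ≃+* R)
    (hs : ∀ r, σ (algebraMap R L r) = algebraMap R L (s r)) :
    (fun y => vv R p (σ y)) = (vv R (s.symm p) : L → ℤ) := by
  funext y
  have hp' : Prime (s.symm p) := (MulEquiv.prime_iff s.symm).mpr hp
  by_cases hy : y = 0
  · subst hy
    rw [map_zero]
    have : ∀ r : R, Prime r → vv R r (0 : L) = 1 := by
      intro r hr
      unfold vv
      rw [IsFractionRing.num_zero]
      have h1 : multiplicity r ((IsFractionRing.den R (0 : L) : R)) = 0 := by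
        rw [multiplicity_eq_zero]
        intro h
        have := IsFractionRing.isUnit_den_zero (A := R) (K := L)
        exact hr.not_isUnit (isUnit_of_dvd_unit h this)
      have h2 : multiplicity r (0 : R) = 1 := by
        apply multiplicity_eq_one_of_not_finiteMultiplicity
        rintro ⟨N, hN⟩
        exact hN (dvd_zero _)
      rw [h1, h2]; rfl
    rw [this p hp, this _ hp']
  obtain ⟨a, b, ha, hb, rfl⟩ := exists_frac (R := R) y hy
  rw [map_div₀, hs, hs, vv_div hp (by simpa using ha) (by simpa using hb), vv_div hp' ha hb]
  congr 2
  · conv_rhs => rw [← multiplicity_map_eq s]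
    simp
  · conv_rhs => rw [← multiplicity_map_eq s]
    simp

theorem semi_inv {y : L} (σ : L ≃+* L) (s : R ≃+* R)
    (hs : ∀ r, σ (algebraMap R L r) = algebraMap R L (s r)) (u : R) (hu : IsUnit u)
    (h : σ y = algebraMap R L u * y) :
    Associated (IsFractionRing.num R y) (s (IsFractionRing.num R y)) ∧
    Associated (IsFractionRing.den R y : R) (s (IsFractionRing.den R y)) := by
  have red := IsFractionRing.num_den_reduced R y
  have red' : IsRelPrime (s (IsFractionRing.num R y)) (s (IsFractionRing.den R y)) := by
    intro d h1 h2
    have h1' := map_dvd s.symm h1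
    have h2' := map_dvd s.symm h2
    simp only [RingEquiv.symm_apply_apply] at h1' h2'
    have := (red h1' h2').map s
    simpa using this
  set a := IsFractionRing.num R y
  set b := (IsFractionRing.den R y : R)
  have hb0 : b ≠ 0 := den_ne y
  have hb : s b ≠ 0 := by simpa using hb0
  have e : s a * b = u * a * s b := by
    apply IsFractionRing.injective R L
    have h0 := IsFractionRing.mk'_num_den' R y
    rw [← h0, map_div₀, hs, hs, ← mul_div_assoc, 
      div_eq_div_iff (am_ne hb) (am_ne (den_ne y)), ← map_mul, ← map_mul, ← map_mul] at h
    exact h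
  constructor
  · apply associated_of_dvd_dvd
    · apply red.dvd_of_dvd_mul_right
      rw [e]; exact ⟨u * s b, by ring⟩
    · have : s a ∣ u * a := red'.dvd_of_dvd_mul_right ⟨b, e.symm⟩
      exact hu.dvd_mul_left.mp this
  · apply associated_of_dvd_dvd
    · have : b ∣ s b * u := by
        apply red.symm.dvd_of_dvd_mul_right
        exact ⟨s a, by rw [mul_comm b, e]; ring⟩
      exact hu.dvd_mul_right.mp this
    · apply red'.symm.dvd_of_dvd_mul_right
      rw [mul_comm, e]; exact ⟨u * a, by ring⟩

end Val


section Poly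
open MvPolynomial
variable {k : Type*} [Field k] {n : ℕ}

/-- translation on polynomials -/
noncomputable def trR (u : Fin n → k) : MvPolynomial (Fin n) k ≃ₐ[k] MvPolynomial (Fin n) k :=
  AlgEquiv.ofAlgHom (aeval fun i => X i + C (u i)) (aeval fun i => X i - C (u i))
    (by ext i; simp [algebraMap_eq]) (by ext i; simp [algebraMap_eq])

theorem trR_X (u : Fin n → k) (i) : trR u (X i) = X i + C (u i) := by
  simp [trR]

/-- diagonal scaling on polynomials -/
noncomputable def scR (t : Fin n → kˣ) : MvPolynomial (Fin n) k ≃ₐ[k] MvPolynomial (Fin n) k :=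
  AlgEquiv.ofAlgHom (aeval fun i => C (t i : k) * X i) (aeval fun i => C (↑(t i)⁻¹ : k) * X i)
    (by ext1 i; simp [algebraMap_eq, ← mul_assoc, ← C_mul])
    (by ext1 i; simp [algebraMap_eq, ← mul_assoc, ← C_mul])

theorem scR_X (t : Fin n → kˣ) (i) : scR t (X i) = C (t i : k) * X i := by
  simp [scR]

theorem eval_trR (u b : Fin n → k) (f : MvPolynomial (Fin n) k) :
    eval b (trR u f) = eval (b + u) f := by
  induction f using MvPolynomial.induction_on with
  | C a => rw [← algebraMap_eq, AlgEquiv.commutes]; simp [algebraMap_eq]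
  | add p q hp hq => simp [hp, hq]
  | mul_X p i hp => simp [hp, trR_X]

theorem coeff_scR (t : Fin n → kˣ) (d : Fin n →₀ ℕ) (f : MvPolynomial (Fin n) k) :
    coeff d (scR t f) = coeff d f * ∏ i, (t i : k) ^ (d i) := by
  classical
  induction f using MvPolynomial.induction_on' with
  | monomial e a =>
    have : scR t (monomial e a) = monomial e (a * ∏ i, (t i : k) ^ (e i)) := by
      change aeval (fun i => C (t i : k) * X i) (monomial e a) = _
      rw [aeval_monomial, monomial_eq, Finsupp.prod_fintype _ _ (by simp),
        Finsupp.prod_fintype _ _ (by simp)]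
      simp only [mul_pow, Finset.prod_mul_distrib, C_mul, map_prod, C_pow, algebraMap_eq]
      ring
    rw [this, coeff_monomial, coeff_monomial]
    split_ifs with h
    · rw [h]
    · simp
  | add p q hp hq => simp [hp, hq, add_mul]

theorem assoc_C {f g : MvPolynomial (Fin n) k} (h : Associated f g) : ∃ c : k, c ≠ 0 ∧ g = C c * f := by
  obtain ⟨u, rfl⟩ := h
  obtain ⟨c, hc, h⟩ := (isUnit_iff_eq_C_of_isReduced).mp u.isUnit
  exact ⟨c, hc.ne_zero, by rw [h, mul_comm]⟩

theorem poly_const [CharZero k] {g : Polynomial k} {q c : k} (hq : q ≠ 0)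
    (h : ∀ t, g.eval (t + q) = c * g.eval t) (t : k) : g.eval t = g.eval 0 := by
  by_cases hg : g = 0
  · simp [hg]
  have hc : c = 1 := by
    have h1 : g.comp (Polynomial.X + Polynomial.C q) = Polynomial.C c * g := by
      apply Polynomial.funext
      intro r
      simp [h]
    have h2 := congrArg Polynomial.leadingCoeff h1
    rw [Polynomial.leadingCoeff_comp (by simp), Polynomial.leadingCoeff_mul] at h2
    simp at h2
    have h3 : g.leadingCoeff ≠ 0 := by simpa using hg
    exact mul_right_cancel₀ h3 (by rw [← h2, one_mul])
  subst hc
  have h3 : ∀ N : ℕ, g.eval ((N : k) * q) = g.eval 0 := by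
    intro N
    induction N with
    | zero => simp
    | succ N ih => push_cast; rw [add_mul, one_mul, h, ih, one_mul]
  have h4 : g = Polynomial.C (g.eval 0) := by
    apply Polynomial.eq_of_infinite_eval_eq
    refine Set.Infinite.mono (s := Set.range fun N : ℕ => (N : k) * q) ?_ ?_
    · rintro _ ⟨N, rfl⟩
      simp [h3]
    · apply Set.infinite_range_of_injective
      intro a b hab
      simpa [hq] using hab
  rw [h4]; simp

theorem eval_line (b e : Fin n → k) (f : MvPolynomial (Fin n) k) (t : k) :
    (aeval (fun i => Polynomial.C (b i) + Polynomial.C (e i) * Polynomial.X) f : Polynomial k).eval t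
      = eval (b + t • e) f := by
  induction f using MvPolynomial.induction_on with
  | C a => simp
  | add p q hp hq => simp [hp, hq]
  | mul_X p i hp => simp [hp, mul_comm t]

theorem const_of_trR [CharZero k] {f : MvPolynomial (Fin n) k}
    (h : ∀ i, ∃ t : k, t ≠ 0 ∧ Associated f (trR (t • Pi.single i 1) f)) : ∃ c, f = C c := by
  classical
  have h1 : ∀ i b (s : k), eval (b + s • Pi.single i 1) f = eval b f := by
    intro i b s
    obtain ⟨t, ht, hA⟩ := h i
    obtain ⟨c, hc, hA⟩ := assoc_C hA
    have := poly_const (g := aeval (fun j => Polynomial.C (b j) + Polynomial.C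
      ((Pi.single i 1 : Fin n → k) j) * Polynomial.X) f) (q := t) (c := c) ht (by
        intro s
        rw [eval_line, eval_line, add_smul, ← add_assoc, ← eval_trR, hA]
        simp) s
    rw [eval_line, eval_line] at this
    simpa using this
  refine ⟨eval 0 f, MvPolynomial.funext fun b => ?_⟩
  rw [eval_C]
  have h2 : ∀ S : Finset (Fin n), eval (∑ i ∈ S, b i • (Pi.single i 1 : Fin n → k)) f = eval 0 f := by
    intro S
    induction S using Finset.induction_on with
    | empty => simp
    | insert i S hi ih => rw [Finset.sum_insert hi, add_comm, h1, ih]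
  have h3 := h2 Finset.univ
  rwa [← pi_eq_sum_univ' b] at h3

theorem mono_of_assoc [CharZero k] {f : MvPolynomial (Fin n) k} (hf : f ≠ 0) (i : Fin n)
    (h : ∀ j ≠ i, Associated f (trR (Pi.single j 1) f))
    (h2 : ∀ j, Associated f (scR (Pi.mulSingle j (Units.mk0 2 two_ne_zero)) f)) :
    ∃ (c : k) (m : ℕ), c ≠ 0 ∧ f = C c * X i ^ m := by
  classical
  have h3 : ∀ j, ∃ c : k, ∀ d, coeff d f ≠ 0 → 2 ^ d j = c := by
    intro j
    obtain ⟨c, hc, hA⟩ := assoc_C (h2 j)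
    refine ⟨c, fun d hd => ?_⟩
    have := congrArg (coeff d) hA
    rw [coeff_scR, coeff_C_mul, mul_comm c] at this
    have := mul_left_cancel₀ hd this
    rw [Finset.prod_eq_single j] at this
    · simpa using this
    · intro b _ hb
      simp [Pi.mulSingle_eq_of_ne hb]
    · simp
  obtain ⟨d, hd⟩ := MvPolynomial.ne_zero_iff.mp hf
  have h4 : ∀ d', coeff d' f ≠ 0 → d' = d := by
    intro d' hd'
    ext j
    obtain ⟨c, hc⟩ := h3 j
    have := (hc d' hd').trans (hc d hd).symm
    have h5 : (2 : ℕ) ^ d' j = 2 ^ d j := by exact_mod_cast this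
    exact Nat.pow_right_injective le_rfl h5
  have h5 : f = monomial d (coeff d f) := by
    ext d'
    rw [coeff_monomial]
    split_ifs with h
    · rw [h]
    · by_contra hne
      exact h (h4 d' hne).symm
  have h6 : ∀ b, eval b f = coeff d f * ∏ j, b j ^ d j := by
    intro b
    conv_lhs => rw [h5]
    rw [eval_monomial, Finsupp.prod_fintype _ _ (by simp)]
  have h7 : ∀ j ≠ i, d j = 0 := by
    intro j hj
    obtain ⟨c, hc, hA⟩ := assoc_C (h j hj)
    have h8 := congrArg (eval (fun l => if l = j then 0 else 1)) hA
    rw [eval_trR, map_mul, eval_C, h6, h6] at h8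
    by_contra hne
    rw [Finset.prod_eq_one, Finset.prod_eq_zero (Finset.mem_univ j)] at h8
    · simp [hd] at h8
    · simp [hne]
    · intro l _
      by_cases hl : l = j
      · subst hl; simp
      · simp [hl]
  refine ⟨coeff d f, d i, hd, ?_⟩
  conv_lhs => rw [h5]
  rw [monomial_eq, Finsupp.prod_fintype _ _ (by simp), Finset.prod_eq_single i]
  · intro b _ hb
    simp [h7 b hb]
  · simp

end Poly

section Coh
open MvPolynomial
variable {k : Type*} [Field k] {n : ℕ} {L : Type*} [Field L] [Algebra (MvPolynomial (Fin n) k) L]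
  [IsFractionRing (MvPolynomial (Fin n) k) L] [Algebra k L] [IsScalarTower k (MvPolynomial (Fin n) k) L]

theorem am_C (c : k) : algebraMap (MvPolynomial (Fin n) k) L (C c) = algebraMap k L c := by
  rw [IsScalarTower.algebraMap_apply k (MvPolynomial (Fin n) k) L]; rfl

theorem trans_trivial [CharZero k] (T : (Fin n → k) → L ≃+* L)
    (hT : ∀ u r, T u (algebraMap (MvPolynomial (Fin n) k) L r) = algebraMap _ L (trR u r))
    (hadd : ∀ u u' y, T (u + u') y = T u (T u' y))
    (b : (Fin n → k) → L) (hb0 : ∀ u, b u ≠ 0) (hb : ∀ u u', b (u + u') = b u * T u (b u')) :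
    ∃ g : L, g ≠ 0 ∧ ∀ u, ∃ c : k, c ≠ 0 ∧ b u * T u g = algebraMap k L c * g := by
  classical
  have comp : ∀ (v : VX (MvPolynomial (Fin n) k) L) u, ∃ p : MvPolynomial (Fin n) k, Prime p ∧
      (fun y => v.1 (T u y)) = vv _ p := by
    rintro ⟨v, p, hp, rfl⟩ u
    exact ⟨_, (MulEquiv.prime_iff (trR u : _ ≃ₐ[k] _).toRingEquiv.symm).mpr hp,
      vv_comp hp (T u) (trR u : _ ≃ₐ[k] _).toRingEquiv (hT u)⟩
  let act : (Fin n → k) → VX (MvPolynomial (Fin n) k) L → VX (MvPolynomial (Fin n) k) L :=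
    fun u v => ⟨fun y => v.1 (T u y), comp v u⟩
  have T0 : ∀ y, T 0 y = y := by
    intro y
    apply (T 0).injective
    rw [← hadd, add_zero]
  obtain ⟨F, hF, hF'⟩ := almost_inv (k := k) act (by
      intro u u' P
      apply Subtype.ext
      funext y
      simp only [act, add_comm u u', hadd])
    (by
      intro P
      apply Subtype.ext
      funext y
      simp only [act, T0])
    (fun u v => v.1 (b u))
    (by
      rintro u u' ⟨v, p, hp, rfl⟩
      simp only [act, hb]
      rw [vv_mul hp (hb0 _)]
      simpa using hb0 u')
    (by
      intro u
      refine Set.Finite.of_finite_image (f := Subtype.val) ?_ Subtype.val_injective.injOn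
      refine Set.Finite.subset (vv_finite (R := MvPolynomial (Fin n) k) (hb0 u)) ?_
      rintro _ ⟨⟨v, p, hp, rfl⟩, h, rfl⟩
      exact ⟨p, hp, rfl, h⟩)
    (fun i => Pi.single i 1)
    (by
      rintro ⟨v, p, hp, rfl⟩
      by_contra! hcon
      have hcon2 : ∀ i, ∃ t : k, t ≠ 0 ∧ Associated p (trR (t • Pi.single i 1) p) := by
        intro i
        obtain ⟨t, ht, h⟩ := hcon i
        refine ⟨t, ht, ?_⟩
        have h1 := congrArg Subtype.val h
        simp only [act] at h1
        have h2 := congrFun h1 (algebraMap _ L p)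
        rw [hT, vv_self hp] at h2
        refine vv_prime hp ?_ (by rw [h2]; exact one_ne_zero)
        exact (MulEquiv.prime_iff (trR (t • Pi.single i 1) : _ ≃ₐ[k] _).toRingEquiv).mpr hp
      obtain ⟨c, rfl⟩ := const_of_trR hcon2
      have hc : c ≠ 0 := by
        rintro rfl
        exact hp.ne_zero (by simp)
      exact hp.not_isUnit ((Ne.isUnit hc).map C))
  obtain ⟨g, hg, hgF⟩ := vv_realize (R := MvPolynomial (Fin n) k) (L := L)
    (-(Finsupp.ofSupportFinite F hF))
  refine ⟨g, hg, fun u => ?_⟩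
  have hTg : T u g ≠ 0 := by simpa using hg
  obtain ⟨r, hr, hr2⟩ := isUnit_of_vv (R := MvPolynomial (Fin n) k) (y := b u * T u g * g⁻¹)
    (mul_ne_zero (mul_ne_zero (hb0 u) hTg) (inv_ne_zero hg)) (by
      intro p hp
      rw [vv_mul hp (mul_ne_zero (hb0 u) hTg) (inv_ne_zero hg), vv_mul hp (hb0 u) hTg, vv_inv hp hg]
      let v : VX (MvPolynomial (Fin n) k) L := ⟨vv _ p, p, hp, rfl⟩
      have h1 := hF' v u
      have h2 := hgF v
      have h3 := hgF (act u v)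
      simp only [Finsupp.neg_apply] at h2 h3
      change _ = - F _ at h2
      change _ = - F _ at h3
      change vv _ p (b u) = _ at h1
      change vv _ p g = _ at h2
      change vv _ p (T u g) = _ at h3
      omega)
  obtain ⟨c, hc, rfl⟩ := isUnit_iff_eq_C_of_isReduced.mp hr
  refine ⟨c, hc.ne_zero, ?_⟩
  rw [am_C] at hr2
  rw [← hr2, inv_mul_cancel_right₀ hg]

theorem semi_inv' {y : L} (σ : L ≃+* L) (s : MvPolynomial (Fin n) k ≃ₐ[k] MvPolynomial (Fin n) k)
    (hs : ∀ r, σ (algebraMap (MvPolynomial (Fin n) k) L r) = algebraMap _ L (s r))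
    (h : ∃ c : k, c ≠ 0 ∧ σ y = algebraMap k L c * y) :
    Associated (IsFractionRing.num (MvPolynomial (Fin n) k) y)
      (s (IsFractionRing.num (MvPolynomial (Fin n) k) y)) ∧
    Associated (IsFractionRing.den (MvPolynomial (Fin n) k) y : MvPolynomial (Fin n) k)
      (s (IsFractionRing.den (MvPolynomial (Fin n) k) y)) := by
  obtain ⟨c, hc, hcy⟩ := h
  rw [← am_C (n := n)] at hcy
  exact semi_inv σ s.toRingEquiv hs _ ((Ne.isUnit hc).map C) hcy

theorem const_of_inv [CharZero k] (T : (Fin n → k) → L ≃+* L)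
    (hT : ∀ u r, T u (algebraMap (MvPolynomial (Fin n) k) L r) = algebraMap _ L (trR u r))
    (y : L) (hy : y ≠ 0) (h : ∀ u, ∃ c : k, c ≠ 0 ∧ T u y = algebraMap k L c * y) :
    ∃ c : k, c ≠ 0 ∧ y = algebraMap k L c := by
  have h1 := fun i => semi_inv' (T (Pi.single i 1)) (trR (Pi.single i 1)) (hT _) (h (Pi.single i 1))
  obtain ⟨c, hc⟩ := const_of_trR (f := IsFractionRing.num (MvPolynomial (Fin n) k) y) (fun i => ⟨1, one_ne_zero, by rw [one_smul]; exact (h1 i).1⟩)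
  obtain ⟨d, hd⟩ := const_of_trR
    (f := (IsFractionRing.den (MvPolynomial (Fin n) k) y : MvPolynomial (Fin n) k)) (fun i => ⟨1, one_ne_zero, by rw [one_smul]; exact (h1 i).2⟩)
  have h2 : y = algebraMap k L (c / d) := by
    rw [map_div₀, ← am_C (n := n), ← am_C (n := n), ← hc, ← hd, IsFractionRing.mk'_num_den']
  refine ⟨c / d, ?_, h2⟩
  intro h0
  rw [h0, map_zero] at h2
  exact hy h2

theorem mono_of_inv [CharZero k] (T : (Fin n → k) → L ≃+* L)
    (hT : ∀ u r, T u (algebraMap (MvPolynomial (Fin n) k) L r) = algebraMap _ L (trR u r))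
    (S : (Fin n → kˣ) → L ≃+* L)
    (hS : ∀ u r, S u (algebraMap (MvPolynomial (Fin n) k) L r) = algebraMap _ L (scR u r))
    (y : L) (hy : y ≠ 0) (i : Fin n) 
    (h : ∀ j ≠ i, ∃ c : k, c ≠ 0 ∧ T (Pi.single j 1) y = algebraMap k L c * y)
    (h' : ∀ t, ∃ c : k, c ≠ 0 ∧ S t y = algebraMap k L c * y) :
    ∃ (c : k) (m : ℤ), c ≠ 0 ∧ y = algebraMap k L c * (algebraMap (MvPolynomial (Fin n) k) L (X i)) ^ m := by
  have h1 := fun j hj => semi_inv' (T (Pi.single j 1)) (trR (Pi.single j 1)) (hT _) (h j hj)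
  have h2 := fun t => semi_inv' (S t) (scR t) (hS _) (h' t)
  obtain ⟨c, m, hc, hcm⟩ := mono_of_assoc (num_ne hy) i (fun j hj => (h1 j hj).1) (fun j => (h2 _).1)
  obtain ⟨d, l, hd, hdl⟩ := mono_of_assoc (den_ne y) i (fun j hj => (h1 j hj).2) (fun j => (h2 _).2)
  refine ⟨c / d, m - l, div_ne_zero hc hd, ?_⟩
  have hX : algebraMap (MvPolynomial (Fin n) k) L (X i) ≠ 0 := am_ne (X_ne_zero i)
  conv_lhs => rw [← IsFractionRing.mk'_num_den' (MvPolynomial (Fin n) k) y, hcm, hdl]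
  rw [map_div₀, map_mul, map_mul, am_C, am_C, map_pow, map_pow, zpow_sub₀ hX, zpow_natCast, zpow_natCast,
    mul_div_mul_comm]

end Coh


section Mat
open Matrix
variable {k : Type*} [Field k] {N : ℕ}

/-- diagonal matrices -/
noncomputable def dg : (Fin N → kˣ) →* (Matrix (Fin N) (Fin N) k)ˣ where
  toFun D := ⟨diagonal fun i => (D i : k), diagonal fun i => (↑(D i)⁻¹ : k),
    by simp [diagonal_mul_diagonal], by simp [diagonal_mul_diagonal]⟩
  map_one' := by ext1; simp
  map_mul' D E := by ext1; simp [diagonal_mul_diagonal]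

theorem dg_val (D : Fin N → kˣ) : (dg D).val = diagonal fun i => (D i : k) := rfl

/-- transvections -/
noncomputable def tv (i j : Fin N) (h : i ≠ j) (t : k) : (Matrix (Fin N) (Fin N) k)ˣ :=
  ⟨transvection i j t, transvection i j (-t),
    by rw [transvection_mul_transvection_same _ _ h]; simp,
    by rw [transvection_mul_transvection_same _ _ h]; simp⟩

theorem tv_val (i j : Fin N) (h : i ≠ j) (t : k) : (tv i j h t).val = transvection i j t := rfl

variable (k) in
/-- permutation matrices -/
noncomputable def pm (σ : Equiv.Perm (Fin N)) : (Matrix (Fin N) (Fin N) k)ˣ :=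
  ⟨σ.permMatrix k, σ⁻¹.permMatrix k, by rw [← permMatrix_mul]; simp, by rw [← permMatrix_mul]; simp⟩

theorem pm_val (σ : Equiv.Perm (Fin N)) : (pm k σ).val = σ.permMatrix k := rfl

theorem pm_mul (σ τ : Equiv.Perm (Fin N)) : pm k (σ * τ) = pm k τ * pm k σ := by
  ext1
  simp [pm_val, permMatrix_mul]

theorem pm_conj (σ : Equiv.Perm (Fin N)) (M : Matrix (Fin N) (Fin N) k) :
    (pm k σ).val * M = M.submatrix σ σ * (pm k σ).val := by
  rw [pm_val, Equiv.Perm.permMatrix, PEquiv.toMatrix_toPEquiv_mul, PEquiv.mul_toMatrix_toPEquiv]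
  ext i j
  simp

theorem pm_dg (σ : Equiv.Perm (Fin N)) (D : Fin N → kˣ) :
    pm k σ * dg D = dg (D ∘ σ) * pm k σ := by
  ext1
  rw [Units.val_mul, Units.val_mul, pm_conj, dg_val, dg_val]
  congr 1
  rw [submatrix_diagonal _ _ σ.injective]
  rfl

theorem pm_tv (σ : Equiv.Perm (Fin N)) (i j : Fin N) (h : i ≠ j) (t : k)
    (h' : σ.symm i ≠ σ.symm j) :
    pm k σ * tv i j h t = tv (σ.symm i) (σ.symm j) h' t * pm k σ := by
  ext1
  rw [Units.val_mul, Units.val_mul, pm_conj, tv_val, tv_val]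
  congr 1
  ext a b
  simp [transvection, single_apply, one_apply, Equiv.symm_apply_eq]

theorem dg_tv (i j : Fin N) (h : i ≠ j) (t : k) (s : kˣ) :
    dg (Pi.mulSingle i s) * tv i j h t = tv i j h (s * t) * dg (Pi.mulSingle i s) := by
  ext1
  rw [Units.val_mul, Units.val_mul, tv_val, tv_val, dg_val]
  ext a b
  rw [diagonal_mul, mul_diagonal]
  simp only [transvection, Matrix.add_apply, one_apply, single_apply, Pi.mulSingle_apply]
  have := h.symm
  grind [Units.val_one]

theorem hom_det [CharZero k] (j₀ : Fin N) (c : (Matrix (Fin N) (Fin N) k)ˣ →* kˣ) :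
    ∃ χ : kˣ →* kˣ, ∀ A, c A = χ (Matrix.GeneralLinearGroup.det A) := by
  have htv : ∀ i j h t, c (tv i j h t) = 1 := by
    intro i j h t
    have h1 := congrArg c (dg_tv i j h t (Units.mk0 2 two_ne_zero))
    have h2 : tv i j h ((Units.mk0 (2 : k) two_ne_zero : kˣ) * t) = tv i j h t * tv i j h t := by
      ext1
      rw [Units.val_mul, tv_val, tv_val, transvection_mul_transvection_same _ _ h]
      congr 1
      simp [two_mul]
    rw [h2, map_mul, map_mul, map_mul, mul_comm] at h1
    have := mul_right_cancel h1
    simpa using this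
  let χ : kˣ →* kˣ := (c.comp dg).comp (MonoidHom.mulSingle (fun _ : Fin N => kˣ) j₀)
  have hs : ∀ i (t : kˣ), c (dg (Pi.mulSingle i t)) = χ t := by
    intro i t
    have h1 := congrArg c (pm_dg (Equiv.swap i j₀) (Pi.mulSingle i t))
    rw [map_mul, map_mul, mul_comm] at h1
    have h2 := mul_right_cancel h1
    rw [h2]
    change _ = c (dg (Pi.mulSingle j₀ t))
    congr 2
    funext l
    simp only [Function.comp, Pi.mulSingle_apply, Equiv.swap_apply_def]
    grind
  have hdg : ∀ D, c (dg D) = χ (∏ i, D i) := by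
    intro D
    change (c.comp dg) D = _
    conv_lhs => rw [← Finset.univ_prod_mulSingle D]
    rw [map_prod, map_prod]
    exact Finset.prod_congr rfl fun i _ => hs i _
  refine ⟨χ, ?_⟩
  intro A
  have key := diagonal_transvection_induction_of_det_ne_zero
    (fun M => ∀ A : (Matrix (Fin N) (Fin N) k)ˣ, A.val = M →
      c A = χ (Matrix.GeneralLinearGroup.det A)) A.val
    (Matrix.GeneralLinearGroup.det A).ne_zero ?_ ?_ ?_
  · exact key A rfl
  · intro D hD B hB
    rw [det_diagonal, Finset.prod_ne_zero_iff] at hD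
    have hB' : B = dg (fun i => Units.mk0 (D i) (hD i (Finset.mem_univ i))) := by
      ext1
      rw [hB, dg_val]; rfl
    rw [hB', hdg]
    congr 1
    ext
    simp [dg_val, det_diagonal]
  · rintro ⟨i, j, h, t⟩ B hB
    have hB' : B = tv i j h t := by
      ext1
      rw [hB, tv_val]; rfl
    rw [hB', htv]
    have : Matrix.GeneralLinearGroup.det (tv i j h t) = 1 := by
      ext
      simp [tv_val, det_transvection_of_ne _ _ h]
    rw [this, map_one]
  · intro M M' hM hM' h h' B hB
    have hu : B = Matrix.nonsingInvUnit M (Ne.isUnit hM) * Matrix.nonsingInvUnit M' (Ne.isUnit hM') := by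
      ext1
      rw [hB]; rfl
    rw [hu, map_mul, map_mul, map_mul, h _ rfl, h' _ rfl]

end Mat

section Main
open MvPolynomial Matrix
variable {k : Type*} [Field k] {n : ℕ} {L : Type*} [Field L] [Algebra (MvPolynomial (Fin n) k) L]
  [IsFractionRing (MvPolynomial (Fin n) k) L] [Algebra k L] [IsScalarTower k (MvPolynomial (Fin n) k) L]

variable (n L) in
/-- homogeneous coordinates, the last one being `1` -/
noncomputable def hX : Fin (n + 1) → L :=
  Fin.snoc (fun i => algebraMap (MvPolynomial (Fin n) k) L (X i)) 1

variable (L) in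
/-- the linear form of the `j`-th column -/
noncomputable def lf (M : Matrix (Fin (n + 1)) (Fin (n + 1)) k) (j : Fin (n + 1)) : L :=
  ∑ i, algebraMap k L (M i j) * hX (k := k) n L i

theorem hX_last : hX (k := k) n L (Fin.last n) = 1 := by simp [hX]

theorem hX_cast (i : Fin n) :
    hX (k := k) n L i.castSucc = algebraMap (MvPolynomial (Fin n) k) L (X i) := by simp [hX]

theorem hX_indep (c : Fin (n + 1) → k) (h : ∑ i, algebraMap k L (c i) * hX (k := k) n L i = 0) :
    c = 0 := by
  classical
  have h1 : (∑ i : Fin n, C (c i.castSucc) * X i) + C (c (Fin.last n)) = (0 : MvPolynomial (Fin n) k) := by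
    apply IsFractionRing.injective (MvPolynomial (Fin n) k) L
    rw [map_zero, ← h, Fin.sum_univ_castSucc, map_add, map_sum, hX_last, am_C, mul_one]
    congr 1
    refine Finset.sum_congr rfl fun i _ => ?_
    rw [map_mul, am_C, hX_cast]
  have h2 : c (Fin.last n) = 0 := by
    have := congrArg (eval (0 : Fin n → k)) h1
    simpa using this
  funext i
  refine Fin.lastCases h2 (fun j => ?_) i
  have := congrArg (eval (Pi.single j 1 : Fin n → k)) h1
  simpa [h2, Pi.single_apply] using this

theorem lf_ne (A : (Matrix (Fin (n + 1)) (Fin (n + 1)) k)ˣ) (j) : lf L A.val j ≠ 0 := by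
  intro h
  have h1 := hX_indep _ h
  have : A.val.det = 0 := det_eq_zero_of_column_eq_zero j (fun i => congrFun h1 i)
  exact (Matrix.GeneralLinearGroup.det A).ne_zero this

theorem lf_H (M : Matrix (Fin (n + 1)) (Fin (n + 1)) k) (h : ∀ i, i ≠ Fin.last n → M i (Fin.last n) = 0) :
    lf L M (Fin.last n) = algebraMap k L (M (Fin.last n) (Fin.last n)) := by
  unfold lf
  rw [Finset.sum_eq_single (Fin.last n)]
  · rw [hX_last, mul_one]
  · intro b _ hb
    rw [h b hb]; simp
  · simp

/-- translations -/
def tmM (u : Fin n → k) : Matrix (Fin (n + 1)) (Fin (n + 1)) k :=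
  1 + vecMulVec (Pi.single (Fin.last n) 1) (Fin.snoc u 0)

theorem tmM_mul (u u' : Fin n → k) : tmM u * tmM u' = tmM (u + u') := by
  have : (Fin.snoc (u + u') 0 : Fin (n + 1) → k) = Fin.snoc u 0 + Fin.snoc u' 0 := by
    funext i
    refine Fin.lastCases ?_ (fun j => ?_) i <;> simp
  unfold tmM
  rw [this, add_mul, mul_add, mul_add, vecMulVec_mul_vecMulVec, vecMulVec_add]
  simp
  abel

theorem tmM_zero : tmM (0 : Fin n → k) = 1 := by
  have : (Fin.snoc (0 : Fin n → k) 0 : Fin (n + 1) → k) = 0 := by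
    funext i
    refine Fin.lastCases ?_ (fun j => ?_) i <;> simp
  simp [tmM, this]

/-- translations as units -/
def tm (u : Fin n → k) : (Matrix (Fin (n + 1)) (Fin (n + 1)) k)ˣ :=
  ⟨tmM u, tmM (-u), by rw [tmM_mul]; simp [tmM_zero], by rw [tmM_mul]; simp [tmM_zero]⟩

theorem tm_val (u : Fin n → k) : (tm u).val = tmM u := rfl

theorem tm_add (u u' : Fin n → k) : tm (u + u') = tm u * tm u' := by
  ext1
  rw [Units.val_mul, tm_val, tm_val, tm_val, tmM_mul]

theorem tmM_apply (u : Fin n → k) (i j) : tmM u i j = (if i = j then 1 else 0) +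
    (if i = Fin.last n then (Fin.snoc u 0 : Fin (n + 1) → k) j else 0) := by
  unfold tmM
  rw [Matrix.add_apply, one_apply, vecMulVec_apply, Pi.single_apply]
  split_ifs <;> simp

theorem lf_tm (u : Fin n → k) (j) : lf L (tmM u) j = hX (k := k) n L j
    + algebraMap k L ((Fin.snoc u 0 : Fin (n + 1) → k) j) := by
  unfold lf
  simp only [tmM_apply, map_add, add_mul, Finset.sum_add_distrib]
  congr 1
  · rw [Finset.sum_eq_single j] <;> simp +contextual
  · rw [Finset.sum_eq_single (Fin.last n)]
    · simp [hX_last]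
    · simp +contextual
    · simp

theorem tm_H (A : (Matrix (Fin (n + 1)) (Fin (n + 1)) k)ˣ)
    (h : ∀ i, i ≠ Fin.last n → A.val i (Fin.last n) = 0) (u' : Fin n → k) :
    ∃ u, A * tm u = tm u' * A := by
  have hl : A.val (Fin.last n) (Fin.last n) ≠ 0 := by
    intro h0
    have : A.val.det = 0 := det_eq_zero_of_column_eq_zero (Fin.last n) (fun i => by
      by_cases hi : i = Fin.last n
      · rw [hi, h0]
      · exact h i hi)
    exact (Matrix.GeneralLinearGroup.det A).ne_zero this
  refine ⟨fun j => (A.val (Fin.last n) (Fin.last n))⁻¹ *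
    ((Fin.snoc u' 0 : Fin (n + 1) → k) ᵥ* A.val) j.castSucc, ?_⟩
  ext1
  rw [Units.val_mul, Units.val_mul, tm_val, tm_val]
  unfold tmM
  rw [mul_add, add_mul, mul_vecMulVec, vecMulVec_mul, mul_one, one_mul]
  congr 1
  ext i j
  rw [vecMulVec_apply, vecMulVec_apply, mulVec_single_one]
  have h0 : ((Fin.snoc u' 0 : Fin (n + 1) → k) ᵥ* A.val) (Fin.last n) = 0 := by
    rw [vecMul, dotProduct, Fin.sum_univ_castSucc]
    simp [h _ (Fin.castSucc_ne_last _)]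
  rw [col_apply, Pi.single_apply]
  refine Fin.lastCases ?_ (fun j => ?_) j
  · rw [h0]; simp
  · by_cases hi : i = Fin.last n
    · subst hi
      simp [mul_inv_cancel_left₀ hl]
    · simp [h i hi, hi]

theorem ext_poly (σ : L ≃ₐ[k] L) (s : MvPolynomial (Fin n) k ≃ₐ[k] MvPolynomial (Fin n) k)
    (h : ∀ i, σ (algebraMap (MvPolynomial (Fin n) k) L (X i)) = algebraMap _ L (s (X i))) (r) :
    σ (algebraMap (MvPolynomial (Fin n) k) L r) = algebraMap _ L (s r) := by
  induction r using MvPolynomial.induction_on with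
  | C a =>
    rw [am_C, AlgEquiv.commutes, ← algebraMap_eq, AlgEquiv.commutes, algebraMap_eq, am_C]
  | add p q hp hq => simp [hp, hq]
  | mul_X p i hp => simp [hp, h]

theorem lf_mul (ρ : (Matrix (Fin (n + 1)) (Fin (n + 1)) k)ˣ → (L ≃ₐ[k] L))
    (hval : ∀ A j, ρ A (hX (k := k) n L j) * lf L A.val (Fin.last n) = lf L A.val j) (A)
    (M : Matrix (Fin (n + 1)) (Fin (n + 1)) k) (j) :
    ρ A (lf L M j) * lf L A.val (Fin.last n) = lf L (A.val * M) j := by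
  conv_lhs => rw [lf]
  rw [map_sum, Finset.sum_mul]
  simp only [map_mul, AlgEquiv.commutes, mul_assoc, hval]
  simp only [lf, mul_apply, map_sum, Finset.sum_mul, Finset.mul_sum, map_mul]
  rw [Finset.sum_comm]
  refine Finset.sum_congr rfl fun i _ => Finset.sum_congr rfl fun l _ => ?_
  ring

/-- nonzero constants -/
def Kon (k : Type*) [Field k] {L : Type*} [Field L] [Algebra k L] (y : L) : Prop :=
  ∃ c : k, c ≠ 0 ∧ y = algebraMap k L c

theorem Kon.mul {y z : L} (hy : Kon k y) (hz : Kon k z) : Kon k (y * z) := by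
  obtain ⟨c, hc, rfl⟩ := hy
  obtain ⟨d, hd, rfl⟩ := hz
  exact ⟨c * d, mul_ne_zero hc hd, by simp⟩

theorem Kon.inv {y : L} (hy : Kon k y) : Kon k y⁻¹ := by
  obtain ⟨c, hc, rfl⟩ := hy
  exact ⟨c⁻¹, inv_ne_zero hc, by simp⟩

theorem Kon.zpow {y : L} (hy : Kon k y) (m : ℤ) : Kon k (y ^ m) := by
  obtain ⟨c, hc, rfl⟩ := hy
  exact ⟨c ^ m, zpow_ne_zero _ hc, by simp⟩

theorem Kon.fix {y : L} (hy : Kon k y) (σ : L ≃ₐ[k] L) : σ y = y := by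
  obtain ⟨c, hc, rfl⟩ := hy
  simp

theorem Kon.ne {y : L} (hy : Kon k y) : y ≠ 0 := by
  obtain ⟨c, hc, rfl⟩ := hy
  simpa using hc

theorem lf_pm (σ : Equiv.Perm (Fin (n + 1))) (j) :
    lf L (pm k σ).val (σ j) = hX (k := k) n L j := by
  rw [lf, Finset.sum_eq_single j]
  · simp [pm_val, Equiv.Perm.permMatrix, PEquiv.toMatrix_apply]
  · intro b _ hb
    have : σ b ≠ σ j := fun h => hb (σ.injective h)
    simp [pm_val, Equiv.Perm.permMatrix, PEquiv.toMatrix_apply, hb]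
  · simp

theorem cocycle_class [CharZero k] (hn : 1 ≤ n)
    (ρ : (Matrix (Fin (n + 1)) (Fin (n + 1)) k)ˣ → (L ≃ₐ[k] L))
    (hmul : ∀ A B y, ρ (A * B) y = ρ A (ρ B y))
    (hval : ∀ A j, ρ A (hX (k := k) n L j) * lf L A.val (Fin.last n) = lf L A.val j)
    (a : (Matrix (Fin (n + 1)) (Fin (n + 1)) k)ˣ → L) (ha0 : ∀ A, a A ≠ 0)
    (ha : ∀ A B, a (A * B) = a A * ρ A (a B)) :
    ∃ (g : L) (m : ℤ) (c : (Matrix (Fin (n + 1)) (Fin (n + 1)) k)ˣ →* kˣ), g ≠ 0 ∧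
      ∀ A, a A * ρ A g = algebraMap k L (c A) * (lf L A.val (Fin.last n)) ^ m * g := by
  classical
  let T : (Fin n → k) → L ≃+* L := fun u => (ρ (tm u)).toRingEquiv
  have hT : ∀ u r, T u (algebraMap (MvPolynomial (Fin n) k) L r) = algebraMap _ L (trR u r) := by
    intro u r
    refine ext_poly (ρ (tm u)) (trR u) (fun i => ?_) r
    have := hval (tm u) i.castSucc
    rw [tm_val, lf_tm, lf_tm, hX_last, hX_cast] at this
    simpa [trR_X, am_C] using this
  -- step 1
  obtain ⟨g, hg, hgu⟩ := trans_trivial T hT (fun u u' y => by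
      change ρ _ y = ρ _ (ρ _ y)
      rw [tm_add, hmul]) (fun u => a (tm u)) (fun u => ha0 _) (fun u u' => by
      change a _ = a _ * ρ _ (a _)
      rw [tm_add, ha])
  have hρg : ∀ A, ρ A g ≠ 0 := fun A => by simpa using hg
  let b : (Matrix (Fin (n + 1)) (Fin (n + 1)) k)ˣ → L := fun A => a A * ρ A g / g
  have hb0 : ∀ A, b A ≠ 0 := fun A => div_ne_zero (mul_ne_zero (ha0 A) (hρg A)) hg
  have hb : ∀ A B, b (A * B) = b A * ρ A (b B) := by
    intro A B
    have := hρg A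
    simp only [b, ha, hmul, map_div₀, map_mul]
    field_simp
  have hbT : ∀ u, Kon k (b (tm u)) := by
    intro u
    obtain ⟨c, hc, h⟩ := hgu u
    refine ⟨c, hc, ?_⟩
    change a (tm u) * ρ (tm u) g / g = _
    change a (tm u) * ρ (tm u) g = _ at h
    rw [h, mul_div_cancel_right₀ _ hg]
  -- general commutation
  have comm : ∀ A B h, h * A = A * B → Kon k (b h) → Kon k (b B) →
      ∃ c : k, c ≠ 0 ∧ ρ h (b A) = algebraMap k L c * b A := by
    intro A B h e h1 h2
    have e1 := congrArg b e
    rw [hb, hb, h2.fix] at e1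
    obtain ⟨c, hc, hc2⟩ := h2.mul h1.inv
    refine ⟨c, hc, ?_⟩
    rw [← hc2]
    have := h1.ne
    field_simp
    linear_combination e1
  -- step 2
  have hH : ∀ A : (Matrix (Fin (n + 1)) (Fin (n + 1)) k)ˣ,
      (∀ i, i ≠ Fin.last n → A.val i (Fin.last n) = 0) → Kon k (b A) := by
    intro A hA
    refine const_of_inv T hT (b A) (hb0 A) (fun u => ?_)
    obtain ⟨u', hu'⟩ := tm_H A hA u
    exact comm A (tm u') (tm u) hu'.symm (hbT _) (hbT _)
  -- step 3
  let i0 : Fin n := ⟨0, hn⟩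
  let σ : Equiv.Perm (Fin (n + 1)) := Equiv.swap i0.castSucc (Fin.last n)
  let w := pm k σ
  have hσσ : ∀ i, σ (σ i) = i := fun i => Equiv.swap_apply_self _ _ _
  have hw : ∀ h : (Matrix (Fin (n + 1)) (Fin (n + 1)) k)ˣ, 
      (∀ i, i ≠ Fin.last n → h.val i (Fin.last n) = 0) →
      (∀ i, i ≠ i0.castSucc → h.val i i0.castSucc = 0) →
      ∃ c : k, c ≠ 0 ∧ ρ h (b w) = algebraMap k L c * b w := by
    intro h h1 h2
    have e : h * w = w * (w⁻¹ * h * w) := by group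
    refine comm w _ h e (hH h h1) (hH _ ?_)
    have e2 : (w⁻¹ * h * w).val = h.val.submatrix σ σ := by
      have e3 : w.val * (w⁻¹ * h * w).val = w.val * h.val.submatrix σ σ := by
        rw [← Units.val_mul, ← e, Units.val_mul]
        change h.val * (pm k σ).val = _
        rw [pm_conj σ (h.val.submatrix σ σ), submatrix_submatrix]
        congr 1
        ext i j
        simp [hσσ]
      exact w.isUnit.mul_left_cancel e3
    intro i hi
    rw [e2, submatrix_apply]
    have : σ (Fin.last n) = i0.castSucc := Equiv.swap_apply_right _ _
    rw [this]
    apply h2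
    intro h
    rw [← this] at h
    exact hi (σ.injective h)
  let S : (Fin n → kˣ) → L ≃+* L := fun t => (ρ (dg (Fin.snoc t 1))).toRingEquiv
  have hdgH : ∀ D i j, i ≠ j → (dg D : (Matrix (Fin (n + 1)) (Fin (n + 1)) k)ˣ).val i j = 0 := by
    intro D i j h
    rw [dg_val, diagonal_apply_ne _ h]
  have lf_dg : ∀ (D : Fin (n + 1) → kˣ) j, lf L (dg D).val j = algebraMap k L (D j : k) * hX (k := k) n L j := by
    intro D j
    rw [lf, Finset.sum_eq_single j]
    · simp [dg_val]
    · intro i _ hij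
      simp [hdgH D i j hij]
    · simp
  have hS : ∀ t r, S t (algebraMap (MvPolynomial (Fin n) k) L r) = algebraMap _ L (scR t r) := by
    intro t r
    refine ext_poly (ρ (dg (Fin.snoc t 1))) (scR t) (fun i => ?_) r
    have := hval (dg (Fin.snoc t 1)) i.castSucc
    rw [lf_dg, lf_dg, hX_last, hX_cast] at this
    simpa [scR_X, am_C] using this
  obtain ⟨c0, m, hc0, hm⟩ := mono_of_inv T hT S hS (b w) (hb0 w) i0 (fun j hj => by
      refine hw (tm (Pi.single j 1)) ?_ ?_
      · intro i hi
        rw [tm_val, tmM_apply]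
        simp [hi]
      · intro i hi
        rw [tm_val, tmM_apply]
        simp [hi, hj.symm]) (fun t => by
      exact hw (dg (Fin.snoc t 1)) (fun i hi => hdgH _ _ _ hi) (fun i hi => hdgH _ _ _ hi))
  -- step 4
  have lfmul : ∀ A B : (Matrix (Fin (n + 1)) (Fin (n + 1)) k)ˣ, lf L (A * B).val (Fin.last n) =
      lf L A.val (Fin.last n) * ρ A (lf L B.val (Fin.last n)) := by
    intro A B
    rw [Units.val_mul, ← lf_mul ρ hval, mul_comm]
  let d : (Matrix (Fin (n + 1)) (Fin (n + 1)) k)ˣ → L := fun A => b A * (lf L A.val (Fin.last n)) ^ (-m)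
  have hd0 : ∀ A, d A ≠ 0 := fun A => mul_ne_zero (hb0 A) (zpow_ne_zero _ (lf_ne A _))
  have hd : ∀ A B, d (A * B) = d A * ρ A (d B) := by
    intro A B
    simp only [d, hb, lfmul, map_mul, map_zpow₀, mul_zpow]
    ring
  have d1 : d 1 = 1 := by
    have h1 := hd 1 1
    rw [mul_one] at h1
    have h2 : ρ 1 (d 1) = 1 := by
      apply mul_left_cancel₀ (hd0 1)
      rw [← h1, mul_one]
    simpa using h2
  let KK : Subgroup (Matrix (Fin (n + 1)) (Fin (n + 1)) k)ˣ :=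
    { carrier := {A | Kon k (d A)}
      mul_mem' := by
        intro A B hA hB
        change Kon k (d (A * B))
        rw [hd, Kon.fix hB]
        exact Kon.mul hA hB
      one_mem' := ⟨1, one_ne_zero, by rw [d1, map_one]⟩
      inv_mem' := by
        intro A hA
        change Kon k (d A) at hA
        change Kon k (d A⁻¹)
        have h1 := hd A A⁻¹
        rw [mul_inv_cancel, d1] at h1
        have h2 : ρ A (d A⁻¹) = (d A)⁻¹ := (inv_eq_of_mul_eq_one_right h1.symm).symm
        have h3 : d A⁻¹ = (d A)⁻¹ := by
          apply (ρ A).injective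
          rw [h2, hA.inv.fix]
        rw [h3]; exact hA.inv }
  have hHK : ∀ A : (Matrix (Fin (n + 1)) (Fin (n + 1)) k)ˣ,
      (∀ i, i ≠ Fin.last n → A.val i (Fin.last n) = 0) → A ∈ KK := by
    intro A hA
    change Kon k (d A)
    refine (hH A hA).mul (Kon.zpow ?_ _)
    have h1 := lf_H (L := L) A.val hA
    refine ⟨_, ?_, h1⟩
    intro h0
    rw [h0, map_zero] at h1
    exact lf_ne A _ h1
  have hwK : w ∈ KK := by
    refine ⟨c0, hc0, ?_⟩
    have h1 : lf L w.val (Fin.last n) = hX (k := k) n L i0.castSucc := by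
      have := lf_pm (k := k) (L := L) σ i0.castSucc
      rwa [show σ i0.castSucc = Fin.last n from Equiv.swap_apply_left _ _] at this
    have h2 : hX (k := k) n L i0.castSucc ≠ 0 := h1 ▸ lf_ne w _
    simp only [d]
    rw [h1, hm, ← hX_cast, mul_assoc, ← zpow_add₀ h2]
    simp
  have hpm : ∀ i : Fin n, pm k (Equiv.swap i.castSucc (Fin.last n)) ∈ KK := by
    intro i
    by_cases hi : i = i0
    · rw [hi]; exact hwK
    have hs : pm k (Equiv.swap i.castSucc i0.castSucc) ∈ KK := by
      apply hHK
      intro l hl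
      have : (Fin.last n) = Equiv.swap i.castSucc i0.castSucc (Fin.last n) := by
        rw [Equiv.swap_apply_of_ne_of_ne] <;> exact (Fin.castSucc_ne_last _).symm
      have h2 : Equiv.swap i.castSucc i0.castSucc l ≠ Fin.last n := by
        intro h
        rw [this] at h
        exact hl ((Equiv.swap i.castSucc i0.castSucc).injective h)
      simp [pm_val, Equiv.Perm.permMatrix, PEquiv.toMatrix_apply, h2.symm, h2]
    have : Equiv.swap i.castSucc (Fin.last n) = Equiv.swap i.castSucc i0.castSucc * σ *
        Equiv.swap i.castSucc i0.castSucc := by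
      have h1 : i0.castSucc ≠ i.castSucc := fun h => hi (Fin.castSucc_injective _ h).symm
      have := Equiv.swap_mul_swap_mul_swap (x := Fin.last n) (y := i0.castSucc) (z := i.castSucc)
        (Fin.castSucc_ne_last _).symm (Fin.castSucc_ne_last _).symm
      rw [← this, Equiv.swap_comm i0.castSucc i.castSucc, Equiv.swap_comm (Fin.last n)]
    rw [this, pm_mul, pm_mul]
    exact mul_mem hs (mul_mem hwK hs)
  have hall : ∀ A, A ∈ KK := by
    intro A
    have key := diagonal_transvection_induction_of_det_ne_zero
      (fun M => ∀ A : (Matrix (Fin (n + 1)) (Fin (n + 1)) k)ˣ, A.val = M → A ∈ KK) A.val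
      (Matrix.GeneralLinearGroup.det A).ne_zero ?_ ?_ ?_
    · exact key A rfl
    · intro D _ B hB
      apply hHK
      intro i hi
      rw [hB, diagonal_apply_ne _ hi]
    · rintro ⟨i, j, h, t⟩ B hB
      have hB' : B = tv i j h t := by
        ext1
        rw [hB, tv_val]; rfl
      have tvH : ∀ i j h t, j ≠ Fin.last n → (tv i j h t : (Matrix (Fin (n + 1)) (Fin (n + 1)) k)ˣ) ∈ KK := by
        intro i j h t hj
        apply hHK
        intro l hl
        rw [tv_val, transvection, Matrix.add_apply, one_apply_ne hl, single_apply]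
        simp [hj]
      rw [hB']
      by_cases hj : j = Fin.last n
      · subst hj
        obtain ⟨i, rfl⟩ := Fin.exists_castSucc_eq.mpr h
        have e := pm_tv (Equiv.swap i.castSucc (Fin.last n)) (Fin.last n) i.castSucc h.symm t
          (by simpa using h)
        have e2 : tv ((Equiv.swap i.castSucc (Fin.last n)).symm (Fin.last n))
          ((Equiv.swap i.castSucc (Fin.last n)).symm i.castSucc) (by simpa using h) t
            = tv i.castSucc (Fin.last n) h t := by
          congr 1 <;> simp
        rw [e2] at e
        rw [← mul_inv_eq_iff_eq_mul.mpr e]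
        exact mul_mem (mul_mem (hpm i) (tvH _ _ _ _ h)) (inv_mem (hpm i))
      · exact tvH _ _ _ _ hj
    · intro M M' hM hM' h h' B hB
      have hu : B = Matrix.nonsingInvUnit M (Ne.isUnit hM) * Matrix.nonsingInvUnit M' (Ne.isUnit hM') := by
        ext1
        rw [hB]; rfl
      rw [hu]
      exact mul_mem (h _ rfl) (h' _ rfl)
  have hall' : ∀ A, ∃ c : kˣ, d A = algebraMap k L c := by
    intro A
    obtain ⟨c, hc, h⟩ := hall A
    exact ⟨Units.mk0 c hc, h⟩
  choose c hc using hall'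
  have inj : Function.Injective (algebraMap k L) := (algebraMap k L).injective
  refine ⟨g, m, MonoidHom.mk' c ?_, hg, ?_⟩
  · intro A B
    apply Units.ext
    apply inj
    rw [← hc, hd, hc, hc, AlgEquiv.commutes, Units.val_mul, map_mul]
  · intro A
    change _ = algebraMap k L (c A) * _ * _
    rw [← hc]
    simp only [d, b]
    have := lf_ne (L := L) A (Fin.last n)
    rw [_root_.zpow_neg]
    field_simp

end Main

section Jac
open MvPolynomial Matrix
variable {k : Type*} [Field k] {n : ℕ} {L : Type*} [Field L] [Algebra (MvPolynomial (Fin n) k) L]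
  [IsFractionRing (MvPolynomial (Fin n) k) L] [Algebra k L] [IsScalarTower k (MvPolynomial (Fin n) k) L]

theorem pd_lf (D : Fin n → Derivation k L L)
    (hD : ∀ i j, D j (algebraMap (MvPolynomial (Fin n) k) L (X i)) = if i = j then 1 else 0)
    (M : Matrix (Fin (n + 1)) (Fin (n + 1)) k) (i : Fin n) (j) :
    D i (lf L M j) = algebraMap k L (M i.castSucc j) := by
  rw [lf, Fin.sum_univ_castSucc, hX_last]
  simp [hX_cast, hD]

theorem jac_formula (D : Fin n → Derivation k L L)
    (hD : ∀ i j, D j (algebraMap (MvPolynomial (Fin n) k) L (X i)) = if i = j then 1 else 0)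
    (M : Matrix (Fin (n + 1)) (Fin (n + 1)) k) (y : Fin n → L)
    (hy : ∀ i, y i * lf L M (Fin.last n) = lf L M i.castSucc) :
    (Matrix.of fun i j : Fin n => D j (y i)).det * lf L M (Fin.last n) ^ (n + 1)
      = algebraMap k L M.det := by
  classical
  let M' : Matrix (Fin (n + 1)) (Fin (n + 1)) L := M.map (algebraMap k L)
  let P := M'.updateRow (Fin.last n) (∑ i, hX (k := k) n L i • M' i)
  let Q : Matrix (Fin (n + 1)) (Fin (n + 1)) L :=
    Matrix.of fun i j => P i j + (Fin.snoc (fun i => - y i) 0 : Fin (n + 1) → L) j * P i (Fin.last n)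
  have hP : P.det = algebraMap k L M.det := by
    change (M'.updateRow (Fin.last n) _).det = _
    rw [det_updateRow_sum, hX_last, one_smul, RingHom.map_det]
    rfl
  have hPl : ∀ j, P (Fin.last n) j = lf L M j := by
    intro j
    simp only [P, updateRow_self, lf, Finset.sum_apply, Pi.smul_apply, smul_eq_mul, M', map_apply]
    exact Finset.sum_congr rfl fun i _ => mul_comm _ _
  have hPc : ∀ (i : Fin n) j, P i.castSucc j = algebraMap k L (M i.castSucc j) := by
    intro i j
    simp only [P]
    rw [updateRow_ne (Fin.castSucc_ne_last i)]
    rfl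
  have hQ : Q.det = P.det := by
    rw [← det_transpose Q, ← det_transpose P]
    exact det_eq_of_forall_row_eq_smul_add_const
      (Fin.snoc (fun i => - y i) 0 : Fin (n + 1) → L) (Fin.last n) (by simp) (fun i j => rfl)
  have hQl : ∀ j : Fin n, Q (Fin.last n) j.castSucc = 0 := by
    intro j
    simp [Q, hPl, ← hy]
  have hQll : Q (Fin.last n) (Fin.last n) = lf L M (Fin.last n) := by
    simp [Q, hPl]
  have hQc : Q.submatrix Fin.castSucc Fin.castSucc =
      lf L M (Fin.last n) • (Matrix.of fun i j : Fin n => D j (y i))ᵀ := by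
    ext i j
    have h1 := congrArg (D i) (hy j)
    rw [Derivation.leibniz, pd_lf D hD, pd_lf D hD] at h1
    simp only [smul_eq_mul] at h1
    simp only [submatrix_apply, Q, of_apply, hPc, Matrix.smul_apply, transpose_apply, smul_eq_mul, Fin.snoc_castSucc]
    linear_combination -h1
  rw [← hP, ← hQ, det_succ_row Q (Fin.last n), Fin.sum_univ_castSucc]
  simp only [hQl, hQll, Fin.succAbove_last, hQc, det_smul, det_transpose]
  rw [← two_mul, Even.neg_one_pow ⟨_, two_mul _⟩]
  simp
  ring

theorem rho_scalar (σ : L ≃ₐ[k] L)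
    (h : ∀ i, σ (algebraMap (MvPolynomial (Fin n) k) L (X i)) = algebraMap (MvPolynomial (Fin n) k) L (X i)) (y : L) :
    σ y = y := by
  have h1 := ext_poly σ (AlgEquiv.refl) (by simpa using h)
  obtain ⟨p, q, hq, rfl⟩ := IsFractionRing.div_surjective (A := MvPolynomial (Fin n) k) y
  simp [map_div₀, h1]

theorem part_two [CharZero k] (hn : 1 ≤ n)
    (ρ : (Matrix (Fin (n + 1)) (Fin (n + 1)) k)ˣ → (L ≃ₐ[k] L))
    (hmul : ∀ A B y, ρ (A * B) y = ρ A (ρ B y))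
    (hval : ∀ A j, ρ A (hX (k := k) n L j) * lf L A.val (Fin.last n) = lf L A.val j)
    (jac : (Matrix (Fin (n + 1)) (Fin (n + 1)) k)ˣ → L)
    (hjac : ∀ A, jac A * lf L A.val (Fin.last n) ^ (n + 1) = algebraMap k L A.val.det)
    (ζ : k) (hζ : IsPrimitiveRoot ζ (n + 1)) (hpow : ∀ c : kˣ, ∃ b : kˣ, b ^ (n + 1) = c)
    (a : (Matrix (Fin (n + 1)) (Fin (n + 1)) k)ˣ → L) (ha0 : ∀ A, a A ≠ 0)
    (ha : ∀ A B, a (A * B) = a A * ρ A (a B))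
    (hsc : ∀ A B : (Matrix (Fin (n + 1)) (Fin (n + 1)) k)ˣ,
          (∃ lam : k, A.val = lam • B.val) → a A = a B) :
    ∃ (m : ℤ) (g : L), g ≠ 0 ∧ ∀ A, a A * ρ A g = g * jac A ^ m := by
  obtain ⟨g, m, c, hg, h⟩ := cocycle_class hn ρ hmul hval a ha0 ha
  obtain ⟨χ, hχ⟩ := hom_det (Fin.last n) c
  have inj : Function.Injective (algebraMap k L) := (algebraMap k L).injective
  have a1 : a 1 = 1 := by
    have h1 := ha 1 1
    rw [mul_one] at h1
    have h2 : ρ 1 (a 1) = 1 := by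
      apply mul_left_cancel₀ (ha0 1)
      rw [← h1, mul_one]
    simpa using h2
  have key : ∀ b : kˣ, χ (b ^ (n + 1)) * b ^ m = 1 := by
    intro b
    let B : (Matrix (Fin (n + 1)) (Fin (n + 1)) k)ˣ := dg (fun _ => b)
    have hB : B.val = (b : k) • (1 : Matrix (Fin (n + 1)) (Fin (n + 1)) k) := by
      change (dg (fun _ => b)).val = _
      rw [dg_val, smul_one_eq_diagonal]
    have hlf : ∀ j, lf L B.val j = algebraMap k L b * hX (k := k) n L j := by
      intro j
      rw [lf, hB, Finset.sum_eq_single j]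
      · simp
      · intro i _ hij
        simp [one_apply_ne hij]
      · simp
    have hb0 : algebraMap k L b ≠ 0 := by simp
    have hid : ∀ y, ρ B y = y := by
      refine rho_scalar (n := n) (ρ B) fun i => ?_
      have := hval B i.castSucc
      rw [hlf, hlf, hX_last, hX_cast, mul_one, mul_comm] at this
      exact mul_left_cancel₀ hb0 this
    have hd : Matrix.GeneralLinearGroup.det B = b ^ (n + 1) := by
      ext
      rw [Matrix.GeneralLinearGroup.val_det_apply, hB]
      simp [det_smul]
    have h1 := h B
    rw [hid, hsc B 1 ⟨b, hB⟩, a1, hlf, hX_last, mul_one, hχ, hd] at h1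
    have h2 := mul_right_cancel₀ hg h1
    apply Units.ext
    apply inj
    rw [Units.val_mul, Units.val_zpow_eq_zpow_val, Units.val_one, map_mul, map_zpow₀, map_one]
    exact h2.symm
  have hdvd : ((n + 1 : ℕ) : ℤ) ∣ m := by
    rw [← hζ.zpow_eq_one_iff_dvd]
    have hz : ζ ≠ 0 := hζ.ne_zero (by omega)
    have h1 := key (Units.mk0 ζ hz)
    have h2 : (Units.mk0 ζ hz) ^ (n + 1) = 1 := by
      ext
      simpa using hζ.pow_eq_one
    rw [h2, map_one, one_mul] at h1
    simpa using congrArg Units.val h1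
  obtain ⟨m', rfl⟩ := hdvd
  refine ⟨-m', g, hg, fun A => ?_⟩
  have hχ' : ∀ t, χ t = t ^ (-m') := by
    intro t
    obtain ⟨b, rfl⟩ := hpow t
    have h1 := key b
    rw [eq_inv_of_mul_eq_one_left h1, _root_.zpow_mul, zpow_natCast, _root_.zpow_neg]
  have hl := lf_ne (L := L) A (Fin.last n)
  have hj : jac A = algebraMap k L A.val.det * (lf L A.val (Fin.last n) ^ (n + 1))⁻¹ := by
    rw [← hjac, mul_inv_cancel_right₀ (pow_ne_zero _ hl)]
  have hc : algebraMap k L (c A) = algebraMap k L A.val.det ^ (-m') := by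
    rw [hχ, hχ', Units.val_zpow_eq_zpow_val, map_zpow₀]
    rfl
  rw [h, hj, hc, mul_zpow, _root_.inv_zpow', neg_neg, _root_.zpow_mul, zpow_natCast]
  ring

end Jac


/-- **The class of `Ω^n_{L/k}` in `H¹(PGL_{n+1}(k), L^×)`.**
Setting as in the computation of `H¹(PGL_{n+1}(k), L^×/k^×)`: `L = k(x₁,…,xₙ)` with the
`PGL`-action encoded by `ρ` on `GL_{n+1}(k)`, and `d_A` the denominator cocycle.
The Jacobian cocycle is `j(τ) = det(∂ⱼ(τ xᵢ))`, where `∂ⱼ` are the partial derivatives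
(the `k`-derivations of `L` with `∂ⱼ xᵢ = δᵢⱼ`).
(i) The class of `j` in `H¹(G, L^×/k^×)` equals the class of `A ↦ d_A^{-(n+1)}`.
(ii) If `k` contains a primitive `(n+1)`-st root of unity and every element of `kˣ` is an
`(n+1)`-st power, then every `1`-cocycle `a : G → L^×` (factoring through `PGL`) is
cohomologous to `τ ↦ j(τ)^m` for some integer `m`. -/
theorem jacobian_generates_pgl_cocycles
    (k : Type) [Field k] [CharZero k] (n : ℕ) (hn : 1 ≤ n)
    (x : Fin n → FractionRing (MvPolynomial (Fin n) k))
    (hx : ∀ j, x j = algebraMap (MvPolynomial (Fin n) k) (FractionRing (MvPolynomial (Fin n) k))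
      (MvPolynomial.X j))
    (den : (Matrix (Fin (n + 1)) (Fin (n + 1)) k)ˣ → FractionRing (MvPolynomial (Fin n) k))
    (hden : ∀ A, den A = (∑ i : Fin n,
        algebraMap k (FractionRing (MvPolynomial (Fin n) k)) (A.val i.castSucc (Fin.last n)) * x i)
      + algebraMap k (FractionRing (MvPolynomial (Fin n) k)) (A.val (Fin.last n) (Fin.last n)))
    (num : (Matrix (Fin (n + 1)) (Fin (n + 1)) k)ˣ → Fin n → FractionRing (MvPolynomial (Fin n) k))
    (hnum : ∀ A j, num A j = (∑ i : Fin n,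
        algebraMap k (FractionRing (MvPolynomial (Fin n) k)) (A.val i.castSucc j.castSucc) * x i)
      + algebraMap k (FractionRing (MvPolynomial (Fin n) k)) (A.val (Fin.last n) j.castSucc))
    (ρ : (Matrix (Fin (n + 1)) (Fin (n + 1)) k)ˣ →
      (FractionRing (MvPolynomial (Fin n) k) ≃ₐ[k] FractionRing (MvPolynomial (Fin n) k)))
    (hρmul : ∀ A B y, ρ (A * B) y = ρ A (ρ B y))
    (hρval : ∀ A j, ρ A (x j) * den A = num A j)
    -- the partial derivatives `∂ⱼ` and the Jacobian cocycle
    (pd : Fin n → Derivation k (FractionRing (MvPolynomial (Fin n) k))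
      (FractionRing (MvPolynomial (Fin n) k)))
    (hpd : ∀ i j, pd j (x i) = if i = j then 1 else 0)
    (jac : (Matrix (Fin (n + 1)) (Fin (n + 1)) k)ˣ → FractionRing (MvPolynomial (Fin n) k))
    (hjac : ∀ A, jac A = (Matrix.of fun i j : Fin n => pd j (ρ A (x i))).det) :
    (∃ g : FractionRing (MvPolynomial (Fin n) k), g ≠ 0 ∧
      ∀ A, ∃ μ : kˣ, jac A * den A ^ ((n : ℤ) + 1) * ρ A g
        = algebraMap k (FractionRing (MvPolynomial (Fin n) k)) μ * g) ∧
    ((∃ ζ : k, IsPrimitiveRoot ζ (n + 1)) → (∀ c : kˣ, ∃ b : kˣ, b ^ (n + 1) = c) →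
      ∀ a : (Matrix (Fin (n + 1)) (Fin (n + 1)) k)ˣ → FractionRing (MvPolynomial (Fin n) k),
        (∀ A, a A ≠ 0) →
        (∀ A B, a (A * B) = a A * ρ A (a B)) →
        (∀ A B : (Matrix (Fin (n + 1)) (Fin (n + 1)) k)ˣ,
          (∃ lam : k, A.val = lam • B.val) → a A = a B) →
        ∃ (m : ℤ) (g : FractionRing (MvPolynomial (Fin n) k)), g ≠ 0 ∧
          ∀ A, a A * ρ A g = g * jac A ^ m) := by
  have hlast : ∀ A, den A = lf (FractionRing (MvPolynomial (Fin n) k)) A.val (Fin.last n) := by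
    intro A
    rw [hden, lf, Fin.sum_univ_castSucc, hX_last, mul_one]
    simp only [hX_cast, hx]
  have hcast : ∀ A j, num A j = lf (FractionRing (MvPolynomial (Fin n) k)) A.val j.castSucc := by
    intro A j
    rw [hnum, lf, Fin.sum_univ_castSucc, hX_last, mul_one]
    simp only [hX_cast, hx]
  have hval : ∀ A j, ρ A (hX (k := k) n (FractionRing (MvPolynomial (Fin n) k)) j) *
      lf (FractionRing (MvPolynomial (Fin n) k)) A.val (Fin.last n) =
      lf (FractionRing (MvPolynomial (Fin n) k)) A.val j := by
    intro A j
    refine Fin.lastCases ?_ (fun j => ?_) j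
    · rw [hX_last, map_one, one_mul]
    · rw [hX_cast, ← hx, ← hlast, hρval, hcast]
  have hj : ∀ A, jac A * lf (FractionRing (MvPolynomial (Fin n) k)) A.val (Fin.last n) ^ (n + 1)
      = algebraMap k (FractionRing (MvPolynomial (Fin n) k)) A.val.det := by
    intro A
    rw [hjac]
    refine jac_formula pd (fun i j => ?_) A.val _ (fun i => ?_)
    · rw [← hx, hpd]
    · rw [← hlast, hρval, hcast]
  refine ⟨⟨1, one_ne_zero, fun A => ⟨Matrix.GeneralLinearGroup.det A, ?_⟩⟩, ?_⟩
  · rw [map_one, mul_one, mul_one, hlast]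
    exact_mod_cast hj A
  · rintro ⟨ζ, hζ⟩ hpow a ha0 ha hsc
    exact part_two hn ρ hρmul hval jac hj ζ hζ hpow a ha0 ha hsc
end

section
/- Let k be a field of characteristic zero and n ≥ 1, and suppose that either n is even or every element of k^× is a square. Let L = k(x_1,…,x_n) and let G be the subgroup of the group of k-algebra automorphisms of L (the Cremona group Cr_n(k)) generated by the projective transformations (the image of PGL_{n+1}(k)) together with the involution σ determined by σ(x_1) = x_1^{-1} and σ(x_j) = x_j for 2 ≤ j ≤ n. Then the isomorphism class of Ω^n_{L/k} generates H^1(G, L^×): every 1-cocycle a : G → L^× (a_{στ} = a_σ·σ(a_τ)) is cohomologous to the cocycle τ ↦ j(τ)^m for some integer m, where j(τ) ∈ L^× is the Jacobian of τ. -/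
theorem cr_orbit_finite {k V P : Type*} [Field k] [CharZero k] [AddCommGroup V] [Module k V]
    (act : V → P → P) (act0 : ∀ p, act 0 p = p) (actadd : ∀ u v p, act (u + v) p = act u (act v p))
    (hstab : ∀ (c : k) (u : V) (p : P), act u p = p → act (c • u) p = p)
    (e : V) (p : P) (hp : act e p ≠ p) (c c' : k) (h : act (c • e) p = act (c' • e) p) : c = c' := by
  by_contra hc
  have hc' : c - c' ≠ 0 := sub_ne_zero.mpr hc
  have h1 : act ((c - c') • e) p = p := by
    have : (c - c') • e = (-c') • e + c • e := by rw [← add_smul]; congr 1; ring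
    rw [this, actadd, h, ← actadd, ← add_smul]
    simp [act0]
  have h2 := hstab (c - c')⁻¹ _ _ h1
  rw [smul_smul, inv_mul_cancel₀ hc', one_smul] at h2
  exact hp h2

theorem cr_step {k V P : Type*} [Field k] [CharZero k] [AddCommGroup V] [Module k V]
    (act : V → P → P) (act0 : ∀ p, act 0 p = p) (actadd : ∀ u v p, act (u + v) p = act u (act v p))
    (hstab : ∀ (c : k) (u : V) (p : P), act u p = p → act (c • u) p = p)
    (D : V → P →₀ ℤ) (hD : ∀ u v p, D (u + v) p = D u p + D v (act (-u) p)) (e : V) :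
    ∃ E : P →₀ ℤ, (∀ p, D e p = E p - E (act (-e) p)) ∧
      (∀ p, E p ≠ 0 → ∃ m : ℕ, D ((m : k) • e) p ≠ 0) := by
  classical
  have D0 : ∀ p, D 0 p = 0 := by
    intro p
    have := hD 0 0 p
    simp only [add_zero, neg_zero, act0] at this
    omega
  have comm : ∀ X z p, D X p - D X (act (-z) p) = D z p - D z (act (-X) p) := by
    intro X z p
    have h1 := hD X z p
    have h2 := hD z X p
    rw [add_comm] at h2
    omega
  have inj := cr_orbit_finite act act0 actadd hstab e
  -- finite support along a free orbit
  have fin : ∀ p, act e p ≠ p → ∀ (F : P →₀ ℤ) (c : ℕ → k), Function.Injective c →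
      ∃ N : ℕ, ∀ m ≥ N, F (act (c m • e) p) = 0 := by
    intro p hp F c hc
    have hinj : Function.Injective (fun m : ℕ => act (c m • e) p) := by
      intro m m' h
      exact hc (inj p hp _ _ h)
    have hf : (Set.preimage (fun m : ℕ => act (c m • e) p) (F.support : Set P)).Finite :=
      Set.Finite.preimage hinj.injOn F.support.finite_toSet
    obtain ⟨N, hN⟩ := hf.bddAbove
    refine ⟨N + 1, fun m hm => ?_⟩
    by_contra h
    have : m ≤ N := hN (by simpa using h)
    omega
  have succ : ∀ (m : ℕ) p, D (((m + 1 : ℕ) : k) • e) p = D ((m : k) • e) p + D e (act ((-m : k) • e) p) := by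
    intro m p
    rw [neg_smul, ← hD]
    congr 2
    push_cast
    rw [add_smul, one_smul]
  have stable : ∀ p, act e p ≠ p → ∃ c : ℤ, ∃ N : ℕ, ∀ m ≥ N, D ((m : k) • e) p = c := by
    intro p hp
    obtain ⟨N, hN⟩ := fin p hp (D e) (fun m => -(m : k)) (fun a b h => by simpa using h)
    refine ⟨D ((N : k) • e) p, N, fun m hm => ?_⟩
    induction m, hm using Nat.le_induction with
    | base => rfl
    | succ m hm ih => rw [succ, ih, hN m hm, add_zero]
  -- fixed points
  have fixed : ∀ p, act e p = p → D e p = 0 := by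
    intro p hp
    have hdiv : ∀ N : ℕ, 0 < N → (N : ℤ) ∣ D e p := by
      intro N hN
      have hz : act (((N : k)⁻¹) • e) p = p := hstab _ _ _ hp
      have hnz : act (-(((N : k)⁻¹) • e)) p = p := by
        have := hstab (-1) _ _ hz
        simpa using this
      have hm : ∀ m : ℕ, D ((m : k) • ((N : k)⁻¹ • e)) p = m * D ((N : k)⁻¹ • e) p := by
        intro m
        induction m with
        | zero => simp [D0]
        | succ m ih =>
          have : ((m + 1 : ℕ) : k) • ((N : k)⁻¹ • e) = ((N : k)⁻¹ • e) + (m : k) • ((N : k)⁻¹ • e) := by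
            push_cast; rw [add_smul, one_smul, add_comm]
          rw [this, hD, hnz, ih]; push_cast; ring
      have := hm N
      rw [smul_smul, mul_inv_cancel₀ (by exact_mod_cast hN.ne'), one_smul] at this
      exact ⟨_, this⟩
    by_contra h
    have h1 := hdiv (2 * (D e p).natAbs) (by have := Int.natAbs_pos.mpr h; omega)
    have h2 := Int.le_of_dvd (abs_pos.mpr h) ((dvd_abs _ _).mpr h1)
    have := abs_pos.mpr h
    push_cast at h2
    omega
  -- total sum zero
  have total : ∀ p, act e p ≠ p → ∃ N : ℕ, ∀ A ≥ N, ∀ B ≥ N,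
      D (((A + B : ℕ) : k) • e) (act ((A : k) • e) p) = 0 := by
    intro p hp
    obtain ⟨n, hn⟩ : ∃ n : ℕ, ∀ j : ℤ, D e (act (((j : k) + ((n : k) + 2)⁻¹) • e) p) = 0 := by
      by_contra! hcon
      choose j hj using hcon
      have hinj : Function.Injective (fun n : ℕ => ((j n : k) + ((n : k) + 2)⁻¹)) := by
        intro a b hab
        simp only at hab
        have hq : ((j a : ℚ) + ((a : ℚ) + 2)⁻¹) = ((j b : ℚ) + ((b : ℚ) + 2)⁻¹) := by
          have : (((j a : ℚ) + ((a : ℚ) + 2)⁻¹ : ℚ) : k) = (((j b : ℚ) + ((b : ℚ) + 2)⁻¹ : ℚ) : k) := by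
            push_cast; exact hab
          exact_mod_cast this
        have ha : (0 : ℚ) < ((a : ℚ) + 2)⁻¹ := by positivity
        have hb : (0 : ℚ) < ((b : ℚ) + 2)⁻¹ := by positivity
        have ha' : ((a : ℚ) + 2)⁻¹ < 1 := by
          apply inv_lt_one_of_one_lt₀; have : (0 : ℚ) ≤ a := by positivity
          linarith
        have hb' : ((b : ℚ) + 2)⁻¹ < 1 := by
          apply inv_lt_one_of_one_lt₀; have : (0 : ℚ) ≤ b := by positivity
          linarith
        have h1 : ((j a - j b : ℤ) : ℚ) < 1 := by push_cast; linarith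
        have h2 : (-1 : ℚ) < ((j a - j b : ℤ) : ℚ) := by push_cast; linarith
        have h1' : j a - j b < 1 := by exact_mod_cast h1
        have h2' : -1 < j a - j b := by exact_mod_cast h2
        have h3 : j a = j b := by omega
        rw [h3] at hq
        have h4 := inv_injective (add_left_cancel hq)
        have h5 : (a : ℚ) = b := by linarith
        exact_mod_cast h5
      obtain ⟨N, hN⟩ := fin p hp (D e) _ hinj
      exact hj N (hN N le_rfl)
    set c : k := ((n : k) + 2)⁻¹ with hc
    have hz : ∀ (m : ℕ) (j : ℤ), D ((m : k) • e) (act (((j : k) + c) • e) p) = 0 := by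
      intro m j
      induction m with
      | zero => simp [D0]
      | succ m ih =>
        rw [succ, ih, ← actadd, ← add_smul]
        have := hn (-m + j)
        push_cast at this
        rw [← add_assoc, this, add_zero]
    obtain ⟨N1, hN1⟩ := fin p hp (D (c • e)) (fun m => (m : k) + c) (fun a b h => by simpa using h)
    obtain ⟨N2, hN2⟩ := fin p hp (D (c • e)) (fun m => -(m : k) + c) (fun a b h => by simpa using h)
    refine ⟨max N1 N2, fun A hA B hB => ?_⟩
    have h1 := comm (((A + B : ℕ) : k) • e) (c • e) (act (((A : k) + c) • e) p)
    rw [← neg_smul, ← neg_smul, ← actadd, ← actadd, ← add_smul, ← add_smul, hN1 A (le_trans (le_max_left _ _) hA)] at h1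
    have h2 := hN2 B (le_trans (le_max_right _ _) hB)
    have h3 : -(((A + B : ℕ)) : k) + (A + c) = -(B : k) + c := by push_cast; ring
    have h4 : -c + (A + c) = (A : k) := by ring
    have h5 := hz (A + B) (A : ℤ)
    rw [Int.cast_natCast] at h5
    rw [h3, h2, h4, h5] at h1
    omega
  -- definition of E
  have hE : ∀ p, ∃ c : ℤ, (act e p = p → c = 0) ∧
      (act e p ≠ p → ∃ N : ℕ, ∀ m ≥ N, D ((m : k) • e) p = c) := by
    intro p
    by_cases hp : act e p = p
    · exact ⟨0, fun _ => rfl, fun h => absurd hp h⟩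
    · obtain ⟨c, hc⟩ := stable p hp
      exact ⟨c, fun h => absurd h hp, fun _ => hc⟩
  choose E0 hE1 hE2 using hE
  have hfix_iff : ∀ (c : k) p, act e (act (c • e) p) = act (c • e) p ↔ act e p = p := by
    intro c p
    constructor
    · intro h
      have := congrArg (act ((-c) • e)) h
      have e1 : (-c) • e + e + c • e = e := by rw [neg_smul]; abel
      have e2 : (-c) • e + c • e = 0 := by rw [neg_smul]; abel
      rwa [← actadd, ← actadd, e1, ← actadd, e2, act0] at this
    · intro h
      rw [← actadd, add_comm, actadd, h]
  have hsupp : ∀ p, E0 p ≠ 0 → ∃ m : ℕ, D ((m : k) • e) p ≠ 0 := by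
    intro p hp
    have hne : act e p ≠ p := fun h => hp (hE1 p h)
    obtain ⟨N, hN⟩ := hE2 p hne
    exact ⟨N, by rw [hN N le_rfl]; exact hp⟩
  have hfin : {p | E0 p ≠ 0}.Finite := by
    choose! N hN using total
    apply Set.Finite.subset
      (s := ⋃ p' ∈ (D e).support, Set.image (fun j : ℕ => act ((j : k) • e) p') (Set.Iio (N p')))
    · exact Set.Finite.biUnion (D e).support.finite_toSet (fun p' _ => (Set.finite_Iio _).image _)
    · intro p hp
      have hne : act e p ≠ p := fun h => hp (hE1 p h)
      obtain ⟨m, hm⟩ := hsupp p hp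
      obtain ⟨j, hj⟩ : ∃ j : ℕ, D e (act ((-j : k) • e) p) ≠ 0 := by
        by_contra! hcon
        apply hm
        clear hm
        induction m with
        | zero => simp [D0]
        | succ m ih => rw [succ, ih, hcon, add_zero]
      have hback : act ((j : k) • e) (act ((-j : k) • e) p) = p := by
        rw [← actadd, ← add_smul]; simp [act0]
      simp only [Set.mem_iUnion]
      refine ⟨act ((-j : k) • e) p, by simpa using hj, j, ?_, hback⟩
      simp only [Set.mem_Iio]
      by_contra hlt
      push Not at hlt
      have hne' : act e (act ((-j : k) • e) p) ≠ act ((-j : k) • e) p := by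
        rw [Ne, hfix_iff]; exact hne
      have h1 := hN _ hne' j hlt
      rw [hback] at h1
      obtain ⟨M, hM⟩ := hE2 p hne
      apply hp
      rw [← hM (j + (M + N (act ((-j : k) • e) p))) (by omega)]
      exact h1 _ (by omega)
  refine ⟨Finsupp.onFinset hfin.toFinset E0 (fun p hp => by simpa using hp), ?_, ?_⟩
  · intro p
    simp only [Finsupp.onFinset_apply]
    have hiff := hfix_iff (-1) p
    rw [neg_smul, one_smul] at hiff
    by_cases hp : act e p = p
    · rw [hE1 p hp, hE1 _ (hiff.mpr hp), fixed p hp]; rfl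
    · obtain ⟨M, hM⟩ := hE2 p hp
      obtain ⟨M', hM'⟩ := hE2 (act (-e) p) (by rw [Ne, hiff]; exact hp)
      have h1 := hM (max M M' + 1) (by omega)
      have h2 := hM' (max M M') (by omega)
      have : ((max M M' + 1 : ℕ) : k) • e = e + ((max M M' : ℕ) : k) • e := by
        rw [Nat.cast_add, Nat.cast_one, add_smul, one_smul, add_comm]
      rw [this, hD] at h1
      omega
  · intro p hp
    exact hsupp p hp

theorem cr_inv_zero {k V P : Type*} [Field k] [CharZero k] [AddCommGroup V] [Module k V]
    (act : V → P → P) (act0 : ∀ p, act 0 p = p) (actadd : ∀ u v p, act (u + v) p = act u (act v p))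
    (hstab : ∀ (c : k) (u : V) (p : P), act u p = p → act (c • u) p = p)
    (F : P →₀ ℤ) (e : V) (p : P) (h0 : ∀ p, F (act (-e) p) = F p) (hp : act e p ≠ p) : F p = 0 := by
  have h1 : ∀ m : ℕ, F (act ((-(m : k)) • e) p) = F p := by
    intro m
    induction m with
    | zero => simp [act0]
    | succ m ih =>
      have : (-((m + 1 : ℕ) : k)) • e = -e + (-(m : k)) • e := by
        push_cast; rw [neg_add, add_smul, add_comm]; simp
      rw [this, actadd, h0, ih]
  by_contra hne
  have hinj : Function.Injective (fun m : ℕ => act ((-(m : k)) • e) p) := by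
    intro a b hab
    have := cr_orbit_finite act act0 actadd hstab e p hp _ _ hab
    simpa using this
  have hf : (Set.range (fun m : ℕ => act ((-(m : k)) • e) p)).Finite := by
    apply Set.Finite.subset F.support.finite_toSet
    rintro _ ⟨m, rfl⟩
    simp only [Finset.mem_coe, Finsupp.mem_support_iff]
    rw [h1]; exact hne
  exact Set.infinite_range_of_injective hinj hf

theorem cr_coboundary {k V P : Type*} [Field k] [CharZero k] [AddCommGroup V] [Module k V]
    (act : V → P → P) (act0 : ∀ p, act 0 p = p) (actadd : ∀ u v p, act (u + v) p = act u (act v p))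
    (hstab : ∀ (c : k) (u : V) (p : P), act u p = p → act (c • u) p = p)
    (D : V → P →₀ ℤ) (hD : ∀ u v p, D (u + v) p = D u p + D v (act (-u) p))
    (n : ℕ) (e : Fin n → V) (hfree : ∀ p, ∃ i, act (e i) p ≠ p) :
    ∃ E : P →₀ ℤ, ∀ u p, D u p = E p - E (act (-u) p) := by
  classical
  -- if `D e = 0` then `D u` lives on the fixed points of `e`
  have key : ∀ (D : V → P →₀ ℤ), (∀ u v p, D (u + v) p = D u p + D v (act (-u) p)) →
      ∀ e u p, D e = 0 → act e p ≠ p → D u p = 0 := by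
    intro D hD e u p he hp
    have h0 : ∀ p, D u (act (-e) p) = D u p := by
      intro p
      have h1 := hD e u p
      have h2 := hD u e p
      rw [add_comm] at h2
      simp only [he, Finsupp.coe_zero, Pi.zero_apply] at h1 h2
      omega
    exact cr_inv_zero act act0 actadd hstab (D u) e p h0 hp
  have ind : ∀ m ≤ n, ∃ E : P →₀ ℤ, ∀ i : Fin n, (i : ℕ) < m → ∀ p, D (e i) p = E p - E (act (-(e i)) p) := by
    intro m
    induction m with
    | zero => intro _; exact ⟨0, fun i hi => absurd hi (by omega)⟩
    | succ m ih =>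
      intro hm
      obtain ⟨E, hE⟩ := ih (by omega)
      let σ : V → P ≃ P := fun u => ⟨act u, act (-u), fun p => by rw [← actadd]; simp [act0],
        fun p => by rw [← actadd]; simp [act0]⟩
      let D' : V → P →₀ ℤ := fun u => D u - (E - Finsupp.equivMapDomain (σ u) E)
      have hD'v : ∀ u p, D' u p = D u p - (E p - E (act (-u) p)) := by
        intro u p
        simp only [D', Finsupp.sub_apply, Finsupp.equivMapDomain_apply]
        rfl
      have hD' : ∀ u v p, D' (u + v) p = D' u p + D' v (act (-u) p) := by
        intro u v p
        simp only [hD'v, hD u v p]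
        have : act (-(u + v)) p = act (-v) (act (-u) p) := by
          rw [← actadd]; congr 1; abel
        rw [this]; ring
      obtain ⟨E', hE', hs⟩ := cr_step act act0 actadd hstab D' hD' (e ⟨m, by omega⟩)
      refine ⟨E + E', fun i hi p => ?_⟩
      rcases Nat.lt_succ_iff_lt_or_eq.mp hi with hi | hi
      · have hz : D' (e i) = 0 := by
          ext p; rw [hD'v, hE i hi p]; simp
        have hinv : E' (act (-(e i)) p) = E' p := by
          by_cases hp : act (e i) p = p
          · have : act (-(e i)) p = p := by
              have := hstab (-1) _ _ hp
              simpa using this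
            rw [this]
          · have hp' : act (e i) (act (-(e i)) p) ≠ act (-(e i)) p := by
              intro h
              apply hp
              rw [← actadd] at h
              simp only [add_neg_cancel, act0] at h
              have := congrArg (act (e i)) h
              rw [← actadd] at this
              simpa [act0] using this
            have z : ∀ q, act (e i) q ≠ q → E' q = 0 := by
              intro q hq
              by_contra h
              obtain ⟨M, hM⟩ := hs q h
              exact hM (key D' hD' _ _ q hz hq)
            rw [z _ hp, z _ hp']
        simp only [Finsupp.add_apply]
        rw [hE i hi p, hinv]; ring
      · have : i = ⟨m, by omega⟩ := Fin.ext hi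
        have h2 := hE' p
        rw [← this, hD'v] at h2
        simp only [Finsupp.add_apply]
        linarith
  obtain ⟨E, hE⟩ := ind n le_rfl
  refine ⟨E, fun u p => ?_⟩
  let σ : V → P ≃ P := fun u => ⟨act u, act (-u), fun p => by rw [← actadd]; simp [act0],
        fun p => by rw [← actadd]; simp [act0]⟩
  let D' : V → P →₀ ℤ := fun u => D u - (E - Finsupp.equivMapDomain (σ u) E)
  have hD'v : ∀ u p, D' u p = D u p - (E p - E (act (-u) p)) := by
    intro u p
    simp only [D', Finsupp.sub_apply, Finsupp.equivMapDomain_apply]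
    rfl
  have hD' : ∀ u v p, D' (u + v) p = D' u p + D' v (act (-u) p) := by
    intro u v p
    simp only [hD'v, hD u v p]
    have : act (-(u + v)) p = act (-v) (act (-u) p) := by
      rw [← actadd]; congr 1; abel
    rw [this]; ring
  obtain ⟨i, hi⟩ := hfree p
  have := key D' hD' (e i) u p (by ext p; rw [hD'v, hE i i.2 p]; simp) hi
  rw [hD'v] at this
  omega

theorem cr_divisor (R K : Type*) [CommRing R] [IsDomain R] [UniqueFactorizationMonoid R] [Field K]
    [Algebra R K] [IsFractionRing R K] :
    ∃ dv : K → ({p : Associates R // Irreducible p} →₀ ℤ),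
      (∀ x y, x ≠ 0 → y ≠ 0 → dv (x * y) = dv x + dv y) ∧
      (∀ (r : R) (hr : Irreducible r), dv (algebraMap R K r) =
        Finsupp.single ⟨Associates.mk r, Associates.irreducible_mk.2 hr⟩ 1) ∧
      (∀ E, ∃ g, g ≠ 0 ∧ dv g = E) ∧
      (∀ g, g ≠ 0 → dv g = 0 → ∃ u : Rˣ, g = algebraMap R K u) ∧
      (∀ u : Rˣ, dv (algebraMap R K u) = 0) := by
  classical
  let P := {p : Associates R // Irreducible p}
  let dR : R → (P →₀ ℤ) := fun r =>
    (Multiset.toFinsupp (Associates.factors' r)).mapRange (Nat.cast : ℕ → ℤ) (by simp)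
  have dRv : ∀ r p, dR r p = ((Associates.factors' r).count p : ℤ) := by
    intro r p; simp [dR]
  have fmul : ∀ a b : R, a ≠ 0 → b ≠ 0 →
      Associates.factors' (a * b) = Associates.factors' a + Associates.factors' b := by
    intro a b ha hb
    have := Associates.factors_mul (Associates.mk a) (Associates.mk b)
    rw [Associates.mk_mul_mk, Associates.factors_mk _ (mul_ne_zero ha hb), Associates.factors_mk _ ha,
      Associates.factors_mk _ hb] at this
    exact_mod_cast this
  have dRmul : ∀ a b : R, a ≠ 0 → b ≠ 0 → dR (a * b) = dR a + dR b := by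
    intro a b ha hb
    ext p
    simp [dRv, fmul a b ha hb]
  have dRinj : ∀ a b : R, a ≠ 0 → b ≠ 0 → dR a = dR b → Associated a b := by
    intro a b ha hb h
    have : Associates.factors' a = Associates.factors' b := by
      ext p
      have := DFunLike.congr_fun h p
      rw [dRv, dRv] at this
      exact_mod_cast this
    rw [← Associates.mk_eq_mk_iff_associated, ← Associates.factors_prod (Associates.mk a),
      ← Associates.factors_prod (Associates.mk b), Associates.factors_mk _ ha, Associates.factors_mk _ hb, this]
  have dRirr : ∀ (r : R) (hr : Irreducible r), dR r = 
        Finsupp.single ⟨Associates.mk r, Associates.irreducible_mk.2 hr⟩ 1 := by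
    intro r hr
    have h := Associates.factors_self (Associates.irreducible_mk.2 hr)
    rw [Associates.factors_mk _ hr.ne_zero] at h
    have h' : Associates.factors' r = {⟨Associates.mk r, Associates.irreducible_mk.2 hr⟩} :=
      WithTop.coe_injective h
    ext p
    rw [dRv, h', Multiset.count_singleton, Finsupp.single_apply]
    simp only [eq_comm]
    split_ifs <;> simp
  have dRunit : ∀ u : Rˣ, dR u = 0 := by
    intro u
    have := dRmul (u : R) 1 u.ne_zero one_ne_zero
    have h1 := dRmul (1 : R) 1 one_ne_zero one_ne_zero
    have h2 : dR 1 = 0 := by simpa using h1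
    rw [← h2]
    have : Associates.factors' (u : R) = Associates.factors' 1 :=
      Associates.factors'_cong (associated_one_iff_isUnit.mpr u.isUnit)
    simp only [dR, this]
  let dv : K → (P →₀ ℤ) := fun x => dR (IsFractionRing.num R x) - dR (IsFractionRing.den R x : R)
  have dvdiv : ∀ r s : R, r ≠ 0 → s ≠ 0 → dv (algebraMap R K r / algebraMap R K s) = dR r - dR s := by
    intro r s hr hs
    set x := algebraMap R K r / algebraMap R K s with hx
    have hs' : algebraMap R K s ≠ 0 := by simpa using hs
    have hr' : algebraMap R K r ≠ 0 := by simpa using hr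
    have hd : (IsFractionRing.den R x : R) ≠ 0 := nonZeroDivisors.coe_ne_zero _
    have hd' : algebraMap R K (IsFractionRing.den R x) ≠ 0 := by simp
    have h1 : algebraMap R K (IsFractionRing.num R x) / algebraMap R K (IsFractionRing.den R x) = x := by
      have := IsFractionRing.mk'_num_den R x
      rwa [IsFractionRing.mk'_eq_div] at this
    have hn : IsFractionRing.num R x ≠ 0 := by
      intro h
      rw [h] at h1
      simp at h1
      have : x ≠ 0 := div_ne_zero hr' hs'
      exact this h1.symm
    rw [hx, div_eq_div_iff hd' hs', ← hx, ← map_mul, ← map_mul] at h1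
    have h2 := IsFractionRing.injective R K h1
    have h3 := dRmul _ _ hn hs
    rw [h2, dRmul _ _ hr hd] at h3
    simp only [dv]
    rw [sub_eq_sub_iff_add_eq_add, ← h3]
  have rep : ∀ x : K, x ≠ 0 → ∃ r s : R, r ≠ 0 ∧ s ≠ 0 ∧ x = algebraMap R K r / algebraMap R K s := by
    intro x hx
    obtain ⟨r, s, hs, rfl⟩ := IsFractionRing.div_surjective (A := R) x
    refine ⟨r, s, ?_, nonZeroDivisors.ne_zero hs, rfl⟩
    rintro rfl
    simp at hx
  have d1 : dR 1 = 0 := by simpa using dRunit 1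
  have dvR : ∀ r : R, r ≠ 0 → dv (algebraMap R K r) = dR r := by
    intro r hr
    have := dvdiv r 1 hr one_ne_zero
    simpa [d1] using this
  have dvmul : ∀ x y, x ≠ 0 → y ≠ 0 → dv (x * y) = dv x + dv y := by
    intro x y hx hy
    obtain ⟨r, s, hr, hs, rfl⟩ := rep x hx
    obtain ⟨r', s', hr', hs', rfl⟩ := rep y hy
    rw [div_mul_div_comm, ← map_mul, ← map_mul, dvdiv _ _ (mul_ne_zero hr hr') (mul_ne_zero hs hs'),
      dvdiv _ _ hr hs, dvdiv _ _ hr' hs', dRmul _ _ hr hr', dRmul _ _ hs hs']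
    abel
  have dv1 : dv 1 = 0 := by simpa using dvmul 1 1 one_ne_zero one_ne_zero
  have dvirr : ∀ (r : R) (hr : Irreducible r), dv (algebraMap R K r) =
        Finsupp.single ⟨Associates.mk r, Associates.irreducible_mk.2 hr⟩ 1 := by
    intro r hr
    rw [dvR r hr.ne_zero, dRirr r hr]
  refine ⟨dv, dvmul, dvirr, ?_, ?_, ?_⟩
  · let S : AddSubgroup (P →₀ ℤ) :=
      { carrier := {E | ∃ g, g ≠ 0 ∧ dv g = E}
        zero_mem' := ⟨1, one_ne_zero, dv1⟩
        add_mem' := by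
          rintro _ _ ⟨g, hg, rfl⟩ ⟨h, hh, rfl⟩
          exact ⟨g * h, mul_ne_zero hg hh, dvmul g h hg hh⟩
        neg_mem' := by
          rintro _ ⟨g, hg, rfl⟩
          refine ⟨g⁻¹, inv_ne_zero hg, ?_⟩
          have := dvmul g g⁻¹ hg (inv_ne_zero hg)
          rw [mul_inv_cancel₀ hg, dv1] at this
          exact (neg_eq_of_add_eq_zero_right this.symm).symm }
    intro E
    change E ∈ S
    induction E using Finsupp.induction_linear with
    | zero => exact S.zero_mem
    | add f g hf hg => exact S.add_mem hf hg
    | single p m =>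
      have : Finsupp.single p m = m • Finsupp.single p (1 : ℤ) := by simp
      rw [this]
      apply S.zsmul_mem
      obtain ⟨p, hp⟩ := p
      obtain ⟨r, rfl⟩ := Associates.mk_surjective p
      have hr := Associates.irreducible_mk.1 hp
      exact ⟨algebraMap R K r, by simpa using hr.ne_zero, dvirr r hr⟩
  · intro g hg h
    obtain ⟨r, s, hr, hs, rfl⟩ := rep g hg
    rw [dvdiv r s hr hs, sub_eq_zero] at h
    obtain ⟨u, hu⟩ := (dRinj s r hs hr h.symm)
    refine ⟨u, ?_⟩
    have hs' : algebraMap R K s ≠ 0 := by simpa using hs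
    rw [← hu, map_mul]
    field_simp
  · intro u
    rw [dvR _ u.ne_zero, dRunit]

/-- equivariance -/
theorem cr_divisor_equiv (R K : Type*) [CommRing R] [IsDomain R] [UniqueFactorizationMonoid R] [Field K]
    [Algebra R K] [IsFractionRing R K] (dv : K → ({p : Associates R // Irreducible p} →₀ ℤ))
      (dvmul : ∀ x y, x ≠ 0 → y ≠ 0 → dv (x * y) = dv x + dv y)
      (dvirr : ∀ (r : R) (hr : Irreducible r), dv (algebraMap R K r) =
        Finsupp.single ⟨Associates.mk r, Associates.irreducible_mk.2 hr⟩ 1)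
      (dvu : ∀ u : Rˣ, dv (algebraMap R K u) = 0) 
      (φ : R ≃+* R) (τ : K ≃+* K) (hφ : ∀ r, τ (algebraMap R K r) = algebraMap R K (φ r))
      (e : {p : Associates R // Irreducible p} ≃ {p : Associates R // Irreducible p})
      (he : ∀ (r : R) (hr : Irreducible r) (hr' : Irreducible (φ r)),
        e ⟨Associates.mk r, Associates.irreducible_mk.2 hr⟩ =
          ⟨Associates.mk (φ r), Associates.irreducible_mk.2 hr'⟩) (x : K) (hx : x ≠ 0) :
      dv (τ x) = Finsupp.equivMapDomain e (dv x) := by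
  have hR : ∀ r : R, r ≠ 0 → dv (τ (algebraMap R K r)) = Finsupp.equivMapDomain e (dv (algebraMap R K r)) := by
    intro r
    induction r using UniqueFactorizationMonoid.induction_on_prime with
    | h₁ => intro h; exact absurd rfl h
    | h₂ u hu =>
      intro _
      obtain ⟨u, rfl⟩ := hu
      rw [dvu, hφ]
      have := dvu (Units.map (φ : R →* R) u)
      simp only [Units.coe_map] at this
      simpa using this
    | h₃ r p hr hp ih =>
      intro _
      have hp0 : algebraMap R K p ≠ 0 := by simpa using hp.ne_zero
      have hr0 : algebraMap R K r ≠ 0 := by simpa using hr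
      have hpi : Irreducible (φ p) := (MulEquiv.irreducible_iff φ).mpr hp.irreducible
      rw [map_mul, map_mul, dvmul _ _ (by simpa using hp.ne_zero) (by simpa using hr), ih hr,
        dvmul _ _ hp0 hr0, hφ, dvirr _ hpi, dvirr _ hp.irreducible]
      rw [← he p hp.irreducible hpi, ← Finsupp.equivMapDomain_single]
      ext q
      simp only [Finsupp.add_apply, Finsupp.equivMapDomain_apply]
  obtain ⟨r, s, hs, rfl⟩ := IsFractionRing.div_surjective (A := R) x
  have hs0 : s ≠ 0 := nonZeroDivisors.ne_zero hs
  have hs' : algebraMap R K s ≠ 0 := by simpa using hs0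
  have hr0 : r ≠ 0 := by rintro rfl; simp at hx
  have h1 := dvmul _ _ hx hs'
  have h2 := dvmul (τ (algebraMap R K r / algebraMap R K s)) (τ (algebraMap R K s)) (by simpa using hx) (by simpa using hs')
  rw [← map_mul, div_mul_cancel₀ _ hs', hR r hr0, hR s hs0] at h2
  rw [div_mul_cancel₀ _ hs'] at h1
  rw [h1] at h2
  ext q
  have := DFunLike.congr_fun h2 q
  simp only [Finsupp.add_apply, Finsupp.equivMapDomain_apply] at this ⊢
  omega

open MvPolynomial in
/-- translation of the variables -/
noncomputable def crTrans (k : Type) [Field k] (n : ℕ) (u : Fin n → k) :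
    MvPolynomial (Fin n) k →ₐ[k] MvPolynomial (Fin n) k := aeval (fun i => X i + C (u i))

open MvPolynomial in
theorem cr_eval_trans (k : Type) [Field k] (n : ℕ) (u y : Fin n → k) (p : MvPolynomial (Fin n) k) :
    eval y (crTrans k n u p) = eval (y + u) p := by
  induction p using MvPolynomial.induction_on with
  | C a => simp [crTrans]
  | add p q hp hq => simp [hp, hq]
  | mul_X p i hp => rw [map_mul, map_mul, map_mul, hp]; simp [crTrans]

open MvPolynomial in
theorem cr_trans_add (k : Type) [Field k] (n : ℕ) (u v : Fin n → k) (p : MvPolynomial (Fin n) k) :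
    crTrans k n (u + v) p = crTrans k n u (crTrans k n v p) := by
  induction p using MvPolynomial.induction_on with
  | C a => simp [crTrans]
  | add p q hp hq => simp [hp, hq]
  | mul_X p i hp =>
    simp only [map_mul, hp]
    congr 1
    simp [crTrans, add_assoc]

open MvPolynomial in
theorem cr_trans_zero (k : Type) [Field k] (n : ℕ) (p : MvPolynomial (Fin n) k) :
    crTrans k n 0 p = p := by
  simp [crTrans]

/-- translation as an equivalence -/
noncomputable def crTransEquiv (k : Type) [Field k] (n : ℕ) (u : Fin n → k) :
    MvPolynomial (Fin n) k ≃ₐ[k] MvPolynomial (Fin n) k :=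
  AlgEquiv.ofAlgHom (crTrans k n u) (crTrans k n (-u))
    (by ext1 i; simp only [AlgHom.comp_apply]; rw [← cr_trans_add]; simp [cr_trans_zero])
    (by ext1 i; simp only [AlgHom.comp_apply]; rw [← cr_trans_add]; simp [cr_trans_zero])

theorem cr_transEquiv_apply (k : Type) [Field k] (n : ℕ) (u : Fin n → k) (p : MvPolynomial (Fin n) k) :
    crTransEquiv k n u p = crTrans k n u p := rfl

open MvPolynomial in
theorem cr_trans_stab (k : Type) [Field k] [CharZero k] (n : ℕ) (u : Fin n → k)
    (p : MvPolynomial (Fin n) k) (hp : p ≠ 0) (l : k) (h : crTrans k n u p = C l * p) (c : k) :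
    crTrans k n (c • u) p = p := by
  -- restriction to lines
  let H : (Fin n → k) → Polynomial k := fun y =>
    aeval (fun i => Polynomial.C (y i) + Polynomial.C (u i) * Polynomial.X) p
  have Hv : ∀ y s, (H y).eval s = eval (y + s • u) p := by
    intro y s
    change (H y).eval s = _
    simp only [H]
    rw [← Polynomial.coe_evalRingHom, MvPolynomial.aeval_def, MvPolynomial.hom_eval₂]
    rw [MvPolynomial.eval, MvPolynomial.coe_eval₂Hom]
    congr 1
    · ext a; simp
    · ext i; simp; ring
  have Hs : ∀ y s, (H y).eval (s + 1) = l * (H y).eval s := by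
    intro y s
    rw [Hv, Hv, add_smul, one_smul, ← add_assoc, ← cr_eval_trans, h, map_mul, eval_C]
  have Hc : ∀ y, (H y).comp (Polynomial.X + 1) = Polynomial.C l * H y := by
    intro y
    apply Polynomial.funext
    intro s
    simp [Hs]
  have hl : l = 1 := by
    obtain ⟨y, hy⟩ : ∃ y, eval y p ≠ 0 := by
      by_contra! hcon
      exact hp (MvPolynomial.funext (by simpa using hcon))
    have h0 : H y ≠ 0 := by
      intro h0
      have := Hv y 0
      rw [h0] at this
      simp at this
      exact hy this.symm
    have h1 := congrArg Polynomial.leadingCoeff (Hc y)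
    rw [Polynomial.leadingCoeff_comp (by rw [← Polynomial.C_1, Polynomial.natDegree_X_add_C]; exact one_ne_zero)] at h1
    rw [← Polynomial.C_1, Polynomial.leadingCoeff_X_add_C, one_pow, mul_one, Polynomial.leadingCoeff_mul,
      Polynomial.leadingCoeff_C] at h1
    have h2 : (H y).leadingCoeff ≠ 0 := by simpa using h0
    exact (mul_right_cancel₀ h2 (by rw [one_mul]; exact h1)).symm
  subst hl
  have Hn : ∀ y (m : ℕ), (H y).eval (m : k) = (H y).eval 0 := by
    intro y m
    induction m with
    | zero => simp
    | succ m ih => push_cast; rw [Hs, one_mul, ih]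
  have Hconst : ∀ y, H y = Polynomial.C ((H y).eval 0) := by
    intro y
    apply Polynomial.eq_of_infinite_eval_eq
    apply Set.Infinite.mono (s := Set.range (fun m : ℕ => (m : k)))
    · rintro _ ⟨m, rfl⟩
      simp [Hn]
    · exact Set.infinite_range_of_injective Nat.cast_injective
  apply MvPolynomial.funext
  intro y
  rw [cr_eval_trans, ← Hv, Hconst, Polynomial.eval_C, Hv]
  simp

open MvPolynomial in
theorem cr_pkg (k : Type) [Field k] [CharZero k] (n : ℕ)
    {K : Type} [Field K] [Algebra k K] [Algebra (MvPolynomial (Fin n) k) K]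
    [IsScalarTower k (MvPolynomial (Fin n) k) K] [IsFractionRing (MvPolynomial (Fin n) k) K]
    (x : Fin n → K)
    (hx : ∀ j, x j = algebraMap (MvPolynomial (Fin n) k) K (MvPolynomial.X j))
    (T : (Fin n → k) → (K ≃ₐ[k] K))
    (hT : ∀ u j, T u (x j) = x j + algebraMap k _ (u j)) :
    ∃ (P : Type) (act : (Fin n → k) → P → P) (dv : K → (P →₀ ℤ)),
      (∀ p, act 0 p = p) ∧ (∀ u v p, act (u + v) p = act u (act v p)) ∧
      (∀ (c : k) (u : Fin n → k) (p : P), act u p = p → act (c • u) p = p) ∧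
      (∀ p, ∃ i, act (Pi.single i 1) p ≠ p) ∧
      (∀ f g, f ≠ 0 → g ≠ 0 → dv (f * g) = dv f + dv g) ∧
      (∀ E, ∃ g, g ≠ 0 ∧ dv g = E) ∧
      (∀ g, g ≠ 0 → dv g = 0 → ∃ c : k, g = algebraMap k _ c) ∧
      (∀ c : k, c ≠ 0 → dv (algebraMap k _ c) = 0) ∧
      (∀ u f p, f ≠ 0 → dv (T u f) p = dv f (act (-u) p)) := by
  classical
  obtain ⟨dv, dvmul, dvirr, dvsurj, dvker, dvu⟩ := cr_divisor (MvPolynomial (Fin n) k) K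
  have hTR : ∀ u (r : (MvPolynomial (Fin n) k)), T u (algebraMap (MvPolynomial (Fin n) k) K r) = algebraMap (MvPolynomial (Fin n) k) K (crTrans k n u r) := by
    intro u r
    have : ((T u : K →ₐ[k] K).comp (IsScalarTower.toAlgHom k (MvPolynomial (Fin n) k) K)) =
        (IsScalarTower.toAlgHom k (MvPolynomial (Fin n) k) K).comp (crTrans k n u) := by
      apply MvPolynomial.algHom_ext
      intro i
      change T u (algebraMap (MvPolynomial (Fin n) k) K (X i)) =
        algebraMap (MvPolynomial (Fin n) k) K (crTrans k n u (X i))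
      rw [← hx, hT, crTrans, aeval_X, map_add, ← hx, IsScalarTower.algebraMap_apply k (MvPolynomial (Fin n) k) K]
      rfl
    exact DFunLike.congr_fun this r
  let P := {p : Associates (MvPolynomial (Fin n) k) // Irreducible p}
  have hrep : ∀ p : P, ∃ r : (MvPolynomial (Fin n) k), ∃ hr : Irreducible r, p = ⟨Associates.mk r, Associates.irreducible_mk.2 hr⟩ := by
    rintro ⟨p, hp⟩
    obtain ⟨r, rfl⟩ := Associates.mk_surjective p
    exact ⟨r, Associates.irreducible_mk.1 hp, rfl⟩
  have hirr : ∀ u (r : (MvPolynomial (Fin n) k)), Irreducible r → Irreducible (crTrans k n u r) := fun u r hr =>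
    (MulEquiv.irreducible_iff (crTransEquiv k n u)).mpr hr
  choose rep hrepi hrepe using hrep
  let act : (Fin n → k) → P → P := fun u p =>
    ⟨Associates.mk (crTrans k n u (rep p)), Associates.irreducible_mk.2 (hirr u _ (hrepi p))⟩
  have hact : ∀ u (r : (MvPolynomial (Fin n) k)) (hr : Irreducible r), act u ⟨Associates.mk r, Associates.irreducible_mk.2 hr⟩ =
      ⟨Associates.mk (crTrans k n u r), Associates.irreducible_mk.2 (hirr u _ hr)⟩ := by
    intro u r hr
    apply Subtype.ext
    simp only [act]
    rw [Associates.mk_eq_mk_iff_associated]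
    have := hrepe ⟨Associates.mk r, Associates.irreducible_mk.2 hr⟩
    have h2 := congrArg Subtype.val this
    simp only at h2
    rw [Associates.mk_eq_mk_iff_associated] at h2
    exact (h2.map (crTrans k n u)).symm
  have act0 : ∀ p, act 0 p = p := by
    intro p
    apply Subtype.ext
    change Associates.mk (crTrans k n 0 (rep p)) = p.1
    rw [cr_trans_zero]
    exact (congrArg Subtype.val (hrepe p)).symm
  have actadd : ∀ u v p, act (u + v) p = act u (act v p) := by
    intro u v p
    rw [show act u (act v p) = _ from hact u (crTrans k n v (rep p)) (hirr v _ (hrepi p))]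
    apply Subtype.ext
    simp only [act, cr_trans_add]
  have hassoc : ∀ u (r : (MvPolynomial (Fin n) k)), r ≠ 0 → Associated (crTrans k n u r) r → ∃ l : k, crTrans k n u r = C l * r := by
    intro u r hr h
    obtain ⟨v, hv⟩ := h.symm
    obtain ⟨l, hl, hl'⟩ := MvPolynomial.isUnit_iff_eq_C_of_isReduced.mp v.isUnit
    exact ⟨l, by rw [← hv, hl', mul_comm]⟩
  have hfix : ∀ u p (c : k), act u p = p → crTrans k n (c • u) (rep p) = rep p := by
    intro u p c h
    have h2 : Associates.mk (crTrans k n u (rep p)) = Associates.mk (rep p) :=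
      (congrArg Subtype.val h).trans (congrArg Subtype.val (hrepe p))
    rw [Associates.mk_eq_mk_iff_associated] at h2
    obtain ⟨l, hl⟩ := hassoc u _ (hrepi p).ne_zero h2
    exact cr_trans_stab k n u _ (hrepi p).ne_zero l hl c
  refine ⟨P, act, dv, act0, actadd, ?_, ?_, dvmul, dvsurj, ?_, ?_, ?_⟩
  · intro c u p h
    have := hfix u p c h
    apply Subtype.ext
    simp only [act]
    rw [this]
    exact (congrArg Subtype.val (hrepe p)).symm
  · intro p
    by_contra! hcon
    have h1 : ∀ i (c : k), crTrans k n (Pi.single i c) (rep p) = rep p := by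
      intro i c
      have := hfix _ p c (hcon i)
      rwa [← Pi.single_smul, smul_eq_mul, mul_one] at this
    have h2 : ∀ y : Fin n → k, crTrans k n y (rep p) = rep p := by
      intro y
      rw [← Finset.univ_sum_single y]
      generalize (Finset.univ : Finset (Fin n)) = s
      induction s using Finset.induction_on with
      | empty => simp [cr_trans_zero]
      | insert a s ha ih => rw [Finset.sum_insert ha, cr_trans_add, ih, h1]
    have h3 : rep p = C (eval 0 (rep p)) := by
      apply MvPolynomial.funext
      intro y
      have := cr_eval_trans k n y 0 (rep p)
      rw [h2, zero_add] at this
      rw [this]; simp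
    have h4 : eval 0 (rep p) ≠ 0 := by
      intro h
      rw [h] at h3
      exact (hrepi p).ne_zero (by simpa using h3)
    apply (hrepi p).not_isUnit
    rw [h3]
    exact (IsUnit.mk0 _ h4).map C
  · intro g hg h
    obtain ⟨v, rfl⟩ := dvker g hg h
    obtain ⟨l, hl, hl'⟩ := MvPolynomial.isUnit_iff_eq_C_of_isReduced.mp v.isUnit
    exact ⟨l, by
      rw [hl', IsScalarTower.algebraMap_apply k (MvPolynomial (Fin n) k) K]; rfl⟩
  · intro c hc
    have := dvu ((Units.mk0 c hc).map (C : k →+* (MvPolynomial (Fin n) k)).toMonoidHom)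
    rw [IsScalarTower.algebraMap_apply k (MvPolynomial (Fin n) k) K]
    exact this
  · intro u f p hf
    have key := cr_divisor_equiv (MvPolynomial (Fin n) k) K dv dvmul dvirr dvu (crTransEquiv k n u).toRingEquiv (T u).toRingEquiv
      (fun r => hTR u r) ⟨act u, act (-u), fun p => by rw [← actadd]; simp [act0],
        fun p => by rw [← actadd]; simp [act0]⟩ (fun r hr hr' => hact u r hr) f hf
    have := DFunLike.congr_fun key p
    exact this

theorem cr_trans_trivial (k : Type) [Field k] [CharZero k] (n : ℕ)
    {K : Type} [Field K] [Algebra k K] [Algebra (MvPolynomial (Fin n) k) K]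
    [IsScalarTower k (MvPolynomial (Fin n) k) K] [IsFractionRing (MvPolynomial (Fin n) k) K]
    (x : Fin n → K)
    (hx : ∀ j, x j = algebraMap (MvPolynomial (Fin n) k) K (MvPolynomial.X j))
    (T : (Fin n → k) → (K ≃ₐ[k] K))
    (hT : ∀ u j, T u (x j) = x j + algebraMap k _ (u j))
    (b : (Fin n → k) → K) (hb0 : ∀ u, b u ≠ 0)
    (hb : ∀ u v, b (u + v) = b u * T u (b v)) :
    ∃ g, g ≠ 0 ∧ ∀ u, ∃ c : k, b u * T u g = algebraMap k _ c * g := by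
  obtain ⟨P, act, dv, act0, actadd, hstab, hfree, dvmul, dvsurj, dvker, dvc, dveq⟩ := cr_pkg k n x hx T hT
  obtain ⟨E, hE⟩ := cr_coboundary act act0 actadd hstab (fun u => dv (b u)) (fun u v p => by
    rw [hb, dvmul _ _ (hb0 u) (by simpa using hb0 v), Finsupp.add_apply, dveq _ _ _ (hb0 v)]) n
    (fun i => Pi.single i 1) hfree
  obtain ⟨g, hg, hgE⟩ := dvsurj E
  have hTg : ∀ u, T u g ≠ 0 := fun u => by simpa using hg
  refine ⟨g, hg, fun u => ?_⟩
  have h0 : b u * T u g / g ≠ 0 := div_ne_zero (mul_ne_zero (hb0 u) (hTg u)) hg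
  obtain ⟨c, hc⟩ := dvker (b u * T u g / g) h0 (by
    have h1 := dvmul _ _ h0 hg
    rw [div_mul_cancel₀ _ hg, dvmul _ _ (hb0 u) (hTg u)] at h1
    ext p
    have h2 := DFunLike.congr_fun h1 p
    have h3 := hE u p
    simp only [Finsupp.add_apply, dveq _ _ _ hg, hgE] at h2
    simp only [Finsupp.coe_zero, Pi.zero_apply]
    omega)
  exact ⟨c, by rw [← hc, div_mul_cancel₀ _ hg]⟩

theorem cr_trans_eigen (k : Type) [Field k] [CharZero k] (n : ℕ)
    {K : Type} [Field K] [Algebra k K] [Algebra (MvPolynomial (Fin n) k) K]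
    [IsScalarTower k (MvPolynomial (Fin n) k) K] [IsFractionRing (MvPolynomial (Fin n) k) K]
    (x : Fin n → K)
    (hx : ∀ j, x j = algebraMap (MvPolynomial (Fin n) k) K (MvPolynomial.X j))
    (T : (Fin n → k) → (K ≃ₐ[k] K))
    (hT : ∀ u j, T u (x j) = x j + algebraMap k _ (u j))
    (f : K) (hf : f ≠ 0)
    (h : ∀ u, ∃ c : k, T u f = algebraMap k _ c * f) : ∃ c : k, f = algebraMap k _ c := by
  obtain ⟨P, act, dv, act0, actadd, hstab, hfree, dvmul, dvsurj, dvker, dvc, dveq⟩ := cr_pkg k n x hx T hT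
  apply dvker f hf
  have hinv : ∀ u p, dv f (act (-u) p) = dv f p := by
    intro u p
    rw [← dveq _ _ _ hf]
    obtain ⟨c, hc⟩ := h u
    have hc0 : c ≠ 0 := by
      rintro rfl
      simp at hc
      exact hf hc
    rw [hc, dvmul _ _ (by simpa using hc0) hf, dvc c hc0, zero_add]
  ext p
  obtain ⟨i, hi⟩ := hfree p
  exact cr_inv_zero act act0 actadd hstab (dv f) _ p (hinv _) hi

theorem cr_algEquiv_ext (k : Type) [Field k] (n : ℕ)
    {K : Type} [Field K] [Algebra k K] [Algebra (MvPolynomial (Fin n) k) K]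
    [IsScalarTower k (MvPolynomial (Fin n) k) K] [IsFractionRing (MvPolynomial (Fin n) k) K]
    (x : Fin n → K) (hx : ∀ j, x j = algebraMap (MvPolynomial (Fin n) k) K (MvPolynomial.X j))
    (σ τ : K ≃ₐ[k] K) (h : ∀ j, σ (x j) = τ (x j)) : σ = τ := by
  have hR : ((σ : K →ₐ[k] K).comp (IsScalarTower.toAlgHom k (MvPolynomial (Fin n) k) K)) =
        (τ : K →ₐ[k] K).comp (IsScalarTower.toAlgHom k (MvPolynomial (Fin n) k) K) := by
    apply MvPolynomial.algHom_ext
    intro i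
    change σ (algebraMap (MvPolynomial (Fin n) k) K (MvPolynomial.X i)) =
      τ (algebraMap (MvPolynomial (Fin n) k) K (MvPolynomial.X i))
    rw [← hx, h]
  have hR' : ∀ r, σ (algebraMap (MvPolynomial (Fin n) k) K r) = τ (algebraMap (MvPolynomial (Fin n) k) K r) :=
    fun r => DFunLike.congr_fun hR r
  ext y
  obtain ⟨r, s, hs, rfl⟩ := IsFractionRing.div_surjective (A := MvPolynomial (Fin n) k) y
  rw [map_div₀, map_div₀, hR', hR']

theorem cr_der_ext (k : Type) [Field k] (n : ℕ)
    {K : Type} [Field K] [Algebra k K] [Algebra (MvPolynomial (Fin n) k) K]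
    [IsScalarTower k (MvPolynomial (Fin n) k) K] [IsFractionRing (MvPolynomial (Fin n) k) K]
    (x : Fin n → K) (hx : ∀ j, x j = algebraMap (MvPolynomial (Fin n) k) K (MvPolynomial.X j))
    (D1 D2 : Derivation k K K) (h : ∀ j, D1 (x j) = D2 (x j)) (y : K) : D1 y = D2 y := by
  have hR : ∀ r, D1 (algebraMap (MvPolynomial (Fin n) k) K r) = D2 (algebraMap (MvPolynomial (Fin n) k) K r) := by
    intro r
    induction r using MvPolynomial.induction_on with
    | C a =>
      have : algebraMap (MvPolynomial (Fin n) k) K (MvPolynomial.C a) = algebraMap k K a := by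
        rw [IsScalarTower.algebraMap_apply k (MvPolynomial (Fin n) k) K]; rfl
      rw [this, Derivation.map_algebraMap, Derivation.map_algebraMap]
    | add p q hp hq => rw [map_add, map_add, map_add, hp, hq]
    | mul_X p i hp => rw [map_mul, Derivation.leibniz, Derivation.leibniz, hp, ← hx, h]
  obtain ⟨r, s, hs, rfl⟩ := IsFractionRing.div_surjective (A := MvPolynomial (Fin n) k) y
  rw [Derivation.leibniz_div, Derivation.leibniz_div, hR, hR]

theorem cr_chain (k : Type) [Field k] (n : ℕ)
    {K : Type} [Field K] [Algebra k K] [Algebra (MvPolynomial (Fin n) k) K]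
    [IsScalarTower k (MvPolynomial (Fin n) k) K] [IsFractionRing (MvPolynomial (Fin n) k) K]
    (x : Fin n → K) (hx : ∀ j, x j = algebraMap (MvPolynomial (Fin n) k) K (MvPolynomial.X j))
    (pd : Fin n → Derivation k K K) (hpd : ∀ i j, pd j (x i) = if i = j then 1 else 0)
    (τ : K ≃ₐ[k] K) (j : Fin n) (y : K) :
    pd j (τ y) = ∑ l, τ (pd l y) * pd j (τ (x l)) := by
  let D1 : Derivation k K K := Derivation.mk'
    (τ.symm.toLinearMap ∘ₗ (pd j : K →ₗ[k] K) ∘ₗ τ.toLinearMap) (by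
      intro a b
      simp only [LinearMap.comp_apply, AlgEquiv.toLinearMap_apply, Derivation.coeFn_coe, map_mul,
        Derivation.leibniz, map_add, smul_eq_mul, AlgEquiv.symm_apply_apply])
  let D2 : Derivation k K K := ∑ l, τ.symm (pd j (τ (x l))) • pd l
  have h2 : ∀ y, D2 y = ∑ l, τ.symm (pd j (τ (x l))) * pd l y := by
    intro y
    simp only [D2]
    rw [← Derivation.coeFnAddMonoidHom_apply, map_sum, Finset.sum_apply]
    rfl
  have h := cr_der_ext k n x hx D1 D2 (by
    intro i
    rw [h2]
    simp only [hpd]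
    simp
    rfl) y
  rw [h2] at h
  have h1 : D1 y = τ.symm (pd j (τ y)) := rfl
  rw [h1] at h
  have := congrArg τ h
  rw [AlgEquiv.apply_symm_apply, map_sum] at this
  rw [this]
  apply Finset.sum_congr rfl
  intro l _
  rw [map_mul, AlgEquiv.apply_symm_apply, mul_comm]

theorem cr_jac_mul (k : Type) [Field k] (n : ℕ)
    {K : Type} [Field K] [Algebra k K] [Algebra (MvPolynomial (Fin n) k) K]
    [IsScalarTower k (MvPolynomial (Fin n) k) K] [IsFractionRing (MvPolynomial (Fin n) k) K]
    (x : Fin n → K) (hx : ∀ j, x j = algebraMap (MvPolynomial (Fin n) k) K (MvPolynomial.X j))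
    (pd : Fin n → Derivation k K K) (hpd : ∀ i j, pd j (x i) = if i = j then 1 else 0)
    (jac : (K ≃ₐ[k] K) → K)
    (hjac : ∀ τ, jac τ = (Matrix.of fun i j : Fin n => pd j (τ (x i))).det)
    (τ υ : K ≃ₐ[k] K) : jac (τ * υ) = jac τ * τ (jac υ) := by
  rw [hjac, hjac, hjac]
  have : τ ((Matrix.of fun i j : Fin n => pd j (υ (x i))).det) =
      ((Matrix.of fun i j : Fin n => pd j (υ (x i))).map τ).det := by
    have := RingHom.map_det (τ : K →+* K) (Matrix.of fun i j : Fin n => pd j (υ (x i)))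
    exact this
  rw [this, mul_comm, ← Matrix.det_mul]
  congr 1
  ext i j
  simp only [Matrix.of_apply, Matrix.mul_apply, Matrix.map_apply, AlgEquiv.mul_apply]
  exact cr_chain k n x hx pd hpd τ j (υ (x i))

open MvPolynomial in
theorem cr_scale_coeff (k : Type) [Field k] (n : ℕ) (d : Fin n → k) (p : MvPolynomial (Fin n) k)
    (m : Fin n →₀ ℕ) :
    coeff m (aeval (fun j => C (d j) * X j) p : MvPolynomial (Fin n) k) = (∏ j, d j ^ m j) * coeff m p := by
  classical
  induction p using MvPolynomial.induction_on' with
  | monomial u a =>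
    have : (aeval (fun j => C (d j) * X j) (monomial u a) : MvPolynomial (Fin n) k) =
        monomial u ((∏ j, d j ^ u j) * a) := by
      rw [aeval_monomial, monomial_eq, Finsupp.prod_fintype _ _ (by simp), Finsupp.prod_fintype _ _ (by simp)]
      simp only [mul_pow, Finset.prod_mul_distrib, map_mul, map_prod, map_pow, algebraMap_eq]
      ring
    rw [this, coeff_monomial, coeff_monomial]
    split_ifs with h
    · rw [h]
    · simp
  | add p q hp hq => rw [map_add, coeff_add, coeff_add, hp, hq]; ring

open MvPolynomial in
theorem cr_scale_dvd (k : Type) [Field k] [CharZero k] (n : ℕ) (p : MvPolynomial (Fin n) k) (hp : p ≠ 0)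
    (h : ∀ i : Fin n, p ∣ aeval (fun j => C ((if j = i then 2 else 1 : k)) * X j) p) :
    ∃ (m : Fin n →₀ ℕ) (a : k), p = monomial m a := by
  classical
  have key : ∀ (i : Fin n) (m : Fin n →₀ ℕ), coeff m (aeval (fun j => C ((if j = i then 2 else 1 : k)) * X j) p : MvPolynomial (Fin n) k) = 2 ^ m i * coeff m p := by
    intro i m
    rw [cr_scale_coeff]
    congr 1
    rw [Finset.prod_eq_single i]
    · simp
    · intro j _ hj; simp [hj]
    · simp
  have h2 : ∀ i, ∃ r : k, ∀ m, 2 ^ m i * coeff m p = r * coeff m p := by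
    intro i
    obtain ⟨q, hq⟩ := h i
    have hne : (aeval (fun j => C ((if j = i then 2 else 1 : k)) * X j) p : MvPolynomial (Fin n) k) ≠ 0 := by
      intro h0
      apply hp
      ext m
      have := key i m
      rw [h0] at this
      simpa using this.symm
    have hq0 : q ≠ 0 := by rintro rfl; simp at hq; exact hne hq
    have hdeg : totalDegree (aeval (fun j => C ((if j = i then 2 else 1 : k)) * X j) p : MvPolynomial (Fin n) k) = totalDegree p := by
      have : (aeval (fun j => C ((if j = i then 2 else 1 : k)) * X j) p : MvPolynomial (Fin n) k).support = p.support := by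
        ext m
        rw [mem_support_iff, mem_support_iff, key i m]; simp
      rw [totalDegree, totalDegree, this]
    rw [hq, totalDegree_mul_of_isDomain hp hq0] at hdeg
    have hq1 : q.totalDegree = 0 := by omega
    rw [totalDegree_eq_zero_iff_eq_C] at hq1
    refine ⟨coeff 0 q, fun m => ?_⟩
    rw [← key i m, hq, hq1, mul_comm, coeff_C_mul]
    simp
  obtain ⟨m, hm⟩ := MvPolynomial.ne_zero_iff.mp hp
  refine ⟨m, coeff m p, ?_⟩
  ext m'
  rw [coeff_monomial]
  split_ifs with hmm
  · rw [hmm]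
  · by_contra hc
    apply hmm
    ext i
    obtain ⟨r, hr⟩ := h2 i
    have e1 := mul_right_cancel₀ hm (hr m)
    have e2 := mul_right_cancel₀ hc (hr m')
    rw [← e2] at e1
    have : ((2 ^ m i : ℕ) : k) = ((2 ^ m' i : ℕ) : k) := by push_cast; exact e1
    exact Nat.pow_right_injective le_rfl (Nat.cast_injective this)

open MvPolynomial in
theorem cr_torus_eigen (k : Type) [Field k] [CharZero k] (n : ℕ)
    {K : Type} [Field K] [Algebra k K] [Algebra (MvPolynomial (Fin n) k) K]
    [IsScalarTower k (MvPolynomial (Fin n) k) K] [IsFractionRing (MvPolynomial (Fin n) k) K]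
    (x : Fin n → K) (hx : ∀ j, x j = algebraMap (MvPolynomial (Fin n) k) K (MvPolynomial.X j))
    (M : Fin n → (K ≃ₐ[k] K)) 
    (hM : ∀ i j, M i (x j) = algebraMap k K (if j = i then 2 else 1) * x j)
    (f : K) (hf : f ≠ 0) (h : ∀ i, ∃ c : k, M i f = algebraMap k K c * f) :
    ∃ (c : k) (e : Fin n → ℤ), f = algebraMap k K c * ∏ i, x i ^ e i := by
  have hTR : ∀ i (r : MvPolynomial (Fin n) k), M i (algebraMap (MvPolynomial (Fin n) k) K r) =
      algebraMap (MvPolynomial (Fin n) k) K (aeval (fun j => C ((if j = i then 2 else 1 : k)) * X j) r) := by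
    intro i r
    have : ((M i : K →ₐ[k] K).comp (IsScalarTower.toAlgHom k (MvPolynomial (Fin n) k) K)) =
        (IsScalarTower.toAlgHom k (MvPolynomial (Fin n) k) K).comp
          (aeval (fun j => C ((if j = i then 2 else 1 : k)) * X j)) := by
      apply MvPolynomial.algHom_ext
      intro j
      change M i (algebraMap (MvPolynomial (Fin n) k) K (X j)) =
        algebraMap (MvPolynomial (Fin n) k) K (aeval (fun j => C ((if j = i then 2 else 1 : k)) * X j) (X j))
      rw [← hx, hM, aeval_X, map_mul, ← hx, IsScalarTower.algebraMap_apply k (MvPolynomial (Fin n) k) K]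
      rfl
    exact DFunLike.congr_fun this r
  set P := IsFractionRing.num (MvPolynomial (Fin n) k) f with hP
  set Q := (IsFractionRing.den (MvPolynomial (Fin n) k) f : MvPolynomial (Fin n) k) with hQ
  have hrel : IsRelPrime P Q := IsFractionRing.num_den_reduced (MvPolynomial (Fin n) k) f
  have hfe : f = algebraMap (MvPolynomial (Fin n) k) K P / algebraMap (MvPolynomial (Fin n) k) K Q := by
    have := IsFractionRing.mk'_num_den (MvPolynomial (Fin n) k) f
    rw [IsFractionRing.mk'_eq_div] at this
    exact this.symm
  have hQ0 : Q ≠ 0 := nonZeroDivisors.coe_ne_zero _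
  have hP0 : P ≠ 0 := by
    intro h0
    rw [h0] at hfe
    simp at hfe
    exact hf hfe
  have hinj := IsFractionRing.injective (MvPolynomial (Fin n) k) K
  have hQK : algebraMap (MvPolynomial (Fin n) k) K Q ≠ 0 := by
    rw [Ne, map_eq_zero_iff _ hinj]; exact hQ0
  have hPK : algebraMap (MvPolynomial (Fin n) k) K P ≠ 0 := by
    rw [Ne, map_eq_zero_iff _ hinj]; exact hP0
  have heq : ∀ i, ∃ c : k, c ≠ 0 ∧ (aeval (fun j => C ((if j = i then 2 else 1 : k)) * X j) P) * Q =
      C c * (P * (aeval (fun j => C ((if j = i then 2 else 1 : k)) * X j) Q)) := by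
    intro i
    obtain ⟨c, hc⟩ := h i
    have hMQ : M i (algebraMap (MvPolynomial (Fin n) k) K Q) ≠ 0 := by
      rw [Ne, map_eq_zero_iff _ (M i).injective]; exact hQK
    refine ⟨c, ?_, ?_⟩
    · rintro rfl
      rw [map_zero, zero_mul, map_eq_zero_iff _ (M i).injective] at hc
      exact hf hc
    · apply hinj
      rw [hfe, map_div₀] at hc
      rw [map_mul, map_mul, map_mul, ← hTR, ← hTR]
      have hcc : algebraMap (MvPolynomial (Fin n) k) K (C c) = algebraMap k K c := by
        rw [IsScalarTower.algebraMap_apply k (MvPolynomial (Fin n) k) K]; rfl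
      rw [hcc]
      field_simp at hc
      rw [hc]; ring
  obtain ⟨m, a, hPm⟩ := cr_scale_dvd k n P hP0 (by
    intro i
    obtain ⟨c, hc0, hc⟩ := heq i
    apply hrel.dvd_of_dvd_mul_right
    rw [hc]
    exact (dvd_mul_right _ _).mul_left _)
  obtain ⟨m', a', hQm⟩ := cr_scale_dvd k n Q hQ0 (by
    intro i
    obtain ⟨c, hc0, hc⟩ := heq i
    apply hrel.symm.dvd_of_dvd_mul_left
    have h1 : Q ∣ C c * (P * (aeval (fun j => C ((if j = i then 2 else 1 : k)) * X j) Q)) := by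
      rw [← hc]; exact dvd_mul_left _ _
    have hu : IsUnit (C c : MvPolynomial (Fin n) k) := (IsUnit.mk0 c hc0).map C
    exact hu.dvd_mul_left.mp h1)
  have hmono : ∀ (m : Fin n →₀ ℕ) (a : k), algebraMap (MvPolynomial (Fin n) k) K (monomial m a) =
      algebraMap k K a * ∏ i, x i ^ m i := by
    intro m a
    rw [monomial_eq, Finsupp.prod_fintype _ _ (by simp), map_mul, map_prod]
    simp only [map_pow, ← hx]
    congr 1
    rw [IsScalarTower.algebraMap_apply k (MvPolynomial (Fin n) k) K]; rfl
  have hx0 : ∀ i, x i ≠ 0 := by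
    intro i
    rw [hx, Ne, map_eq_zero_iff _ hinj]
    exact X_ne_zero i
  refine ⟨a / a', fun i => (m i : ℤ) - m' i, ?_⟩
  rw [hfe, hPm, hQm, hmono, hmono, map_div₀]
  simp only [zpow_sub₀ (hx0 _), zpow_natCast, Finset.prod_div_distrib]
  rw [mul_div_mul_comm]

theorem cr_x_ne (k : Type) [Field k] (n : ℕ)
    {K : Type} [Field K] [Algebra k K] [Algebra (MvPolynomial (Fin n) k) K]
    [IsScalarTower k (MvPolynomial (Fin n) k) K] [IsFractionRing (MvPolynomial (Fin n) k) K]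
    (x : Fin n → K) (hx : ∀ j, x j = algebraMap (MvPolynomial (Fin n) k) K (MvPolynomial.X j))
    (j : Fin n) : x j ≠ 0 := by
  rw [hx, Ne, map_eq_zero_iff _ (IsFractionRing.injective (MvPolynomial (Fin n) k) K)]
  exact MvPolynomial.X_ne_zero j

theorem cr_torus_form (k : Type) [Field k] [CharZero k] (n : ℕ)
    {K : Type} [Field K] [Algebra k K] [Algebra (MvPolynomial (Fin n) k) K]
    [IsScalarTower k (MvPolynomial (Fin n) k) K] [IsFractionRing (MvPolynomial (Fin n) k) K]
    (x : Fin n → K) (hx : ∀ j, x j = algebraMap (MvPolynomial (Fin n) k) K (MvPolynomial.X j))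
    (t : (Fin n → kˣ) → (K ≃ₐ[k] K))
    (ht : ∀ d j, t d (x j) = algebraMap k K (d j : k) * x j)
    (f : K) (hf : f ≠ 0) (q : (Fin n → kˣ) → k) (h : ∀ d, t d f = algebraMap k K (q d) * f) :
    ∃ (c : k) (e : Fin n → ℤ), f = algebraMap k K c * ∏ i, x i ^ e i ∧
      ∀ d, q d = ∏ i, ((d i : k)) ^ e i := by
  have h2 : (2 : k) ≠ 0 := two_ne_zero
  obtain ⟨c, e, he⟩ := cr_torus_eigen k n x hx (fun i => t (fun j => if j = i then Units.mk0 2 h2 else 1))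
    (by
      intro i j
      rw [ht]
      split_ifs <;> simp) f hf (fun i => ⟨_, h _⟩)
  refine ⟨c, e, he, fun d => ?_⟩
  have h1 := h d
  have h3 : t d f = algebraMap k K (∏ i, ((d i : k)) ^ e i) * f := by
    conv_lhs => rw [he]
    rw [map_mul, AlgEquiv.commutes, map_prod, he]
    simp only [map_zpow₀, ht, mul_zpow, Finset.prod_mul_distrib, map_prod]
    ring
  rw [h3] at h1
  exact ((algebraMap k K).injective (mul_right_cancel₀ hf h1)).symm

theorem cr_norm_const (k : Type) [Field k] [CharZero k] (n : ℕ)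
    {K : Type} [Field K] [Algebra k K] [Algebra (MvPolynomial (Fin n) k) K]
    [IsScalarTower k (MvPolynomial (Fin n) k) K] [IsFractionRing (MvPolynomial (Fin n) k) K]
    (x : Fin n → K) (hx : ∀ j, x j = algebraMap (MvPolynomial (Fin n) k) K (MvPolynomial.X j))
    (G : Subgroup (K ≃ₐ[k] K))
    (T : (Fin n → k) → (K ≃ₐ[k] K))
    (hT : ∀ u j, T u (x j) = x j + algebraMap k K (u j)) (hTG : ∀ u, T u ∈ G)
    (a : (K ≃ₐ[k] K) → K) (ha0 : ∀ τ ∈ G, a τ ≠ 0)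
    (hacoc : ∀ τ ∈ G, ∀ υ ∈ G, a (τ * υ) = a τ * τ (a υ))
    (haT : ∀ u, ∃ c : k, a (T u) = algebraMap k K c)
    (τ : K ≃ₐ[k] K) (hτ : τ ∈ G) (hn : ∀ u', ∃ u, τ * T u = T u' * τ) :
    ∃ c : k, a τ = algebraMap k K c := by
  apply cr_trans_eigen k n x hx T hT (a τ) (ha0 τ hτ)
  intro u'
  obtain ⟨u, hu⟩ := hn u'
  have h1 := hacoc τ hτ _ (hTG u)
  rw [hu, hacoc _ (hTG u') τ hτ] at h1
  obtain ⟨c, hc⟩ := haT u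
  obtain ⟨c', hc'⟩ := haT u'
  have h0 := ha0 _ (hTG u')
  rw [hc, AlgEquiv.commutes, hc'] at h1
  rw [hc'] at h0
  refine ⟨c / c', ?_⟩
  rw [map_div₀]
  field_simp
  rw [mul_comm, h1, mul_comm]

theorem cr_normalize (k : Type) [Field k] [CharZero k] (n : ℕ) (hn : 1 ≤ n)
    {K : Type} [Field K] [Algebra k K] [Algebra (MvPolynomial (Fin n) k) K]
    [IsScalarTower k (MvPolynomial (Fin n) k) K] [IsFractionRing (MvPolynomial (Fin n) k) K]
    (x : Fin n → K) (hx : ∀ j, x j = algebraMap (MvPolynomial (Fin n) k) K (MvPolynomial.X j))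
    (G : Subgroup (K ≃ₐ[k] K))
    (T : (Fin n → k) → (K ≃ₐ[k] K))
    (hT : ∀ u j, T u (x j) = x j + algebraMap k K (u j)) (hTG : ∀ u, T u ∈ G)
    (t : (Fin n → kˣ) → (K ≃ₐ[k] K))
    (ht : ∀ d j, t d (x j) = algebraMap k K (d j : k) * x j) (htG : ∀ d, t d ∈ G)
    (S : Fin n → Fin n → (K ≃ₐ[k] K))
    (hS : ∀ i j l, S i j (x l) = x (Equiv.swap i j l)) (hSG : ∀ i j, S i j ∈ G)
    (a : (K ≃ₐ[k] K) → K) (ha0 : ∀ τ ∈ G, a τ ≠ 0)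
    (hacoc : ∀ τ ∈ G, ∀ υ ∈ G, a (τ * υ) = a τ * τ (a υ))
    (haT : ∀ u, ∃ c : k, a (T u) = algebraMap k K c) :
    (∀ u, a (T u) = 1) ∧ ∃ φ : kˣ →* kˣ, ∀ d, a (t d) = algebraMap k K ((∏ j, φ (d j) : kˣ) : k) := by
  have hext := cr_algEquiv_ext k n x hx
  have hTt : ∀ d u, t d * T u = T (fun j => u j * ((d j)⁻¹ : kˣ)) * t d := by
    intro d u
    apply hext
    intro j
    rw [AlgEquiv.mul_apply, AlgEquiv.mul_apply, hT, map_add, AlgEquiv.commutes, ht, map_mul,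
      AlgEquiv.commutes, hT, mul_add, ← map_mul]
    congr 2
    rw [mul_comm, mul_assoc, Units.inv_mul, mul_one]
  have htmul : ∀ d d', t (d * d') = t d * t d' := by
    intro d d'
    apply hext
    intro j
    rw [AlgEquiv.mul_apply, ht, ht, map_mul, AlgEquiv.commutes, ht, Pi.mul_apply, Units.val_mul, map_mul]
    ring
  have hTadd : ∀ u v, T (u + v) = T u * T v := by
    intro u v
    apply hext
    intro j
    rw [AlgEquiv.mul_apply, hT, hT, map_add, AlgEquiv.commutes, hT, Pi.add_apply, map_add]
    ring
  have hconst := cr_norm_const k n x hx G T hT hTG a ha0 hacoc haT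
  have hct : ∀ d, ∃ c : k, a (t d) = algebraMap k K c := by
    intro d
    apply hconst _ (htG d)
    intro u'
    refine ⟨fun j => u' j * d j, ?_⟩
    rw [hTt]
    congr 2
    ext j
    rw [mul_assoc, Units.mul_inv, mul_one]
  have hcS : ∀ i j, ∃ c : k, a (S i j) = algebraMap k K c := by
    intro i j
    apply hconst _ (hSG i j)
    intro u'
    refine ⟨fun l => u' (Equiv.swap i j l), ?_⟩
    apply hext
    intro l
    rw [AlgEquiv.mul_apply, AlgEquiv.mul_apply, hT, hS, map_add, AlgEquiv.commutes, hS, hT]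
  have h2 : (2 : k) ≠ 0 := two_ne_zero
  have hT1 : ∀ u, a (T u) = 1 := by
    intro u
    obtain ⟨γ, hγ⟩ := hct (fun _ => Units.mk0 2 h2)
    have h1 := hTt (fun _ => Units.mk0 2 h2) u
    have e1 := hacoc _ (htG (fun _ => Units.mk0 2 h2)) _ (hTG u)
    rw [h1, hacoc _ (hTG _) _ (htG _)] at e1
    have hγ0 := ha0 _ (htG (fun _ => Units.mk0 2 h2))
    rw [hγ, AlgEquiv.commutes] at e1
    rw [hγ] at hγ0
    obtain ⟨c, hc⟩ := haT u
    rw [hc, AlgEquiv.commutes, mul_comm] at e1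
    have e2 := mul_left_cancel₀ hγ0 e1
    have e3 := hTadd (fun j => u j * ((Units.mk0 2 h2)⁻¹ : kˣ)) (fun j => u j * ((Units.mk0 2 h2)⁻¹ : kˣ))
    have e4 : (fun j => u j * (((Units.mk0 2 h2)⁻¹ : kˣ) : k)) + (fun j => u j * ((Units.mk0 2 h2)⁻¹ : kˣ)) = u := by
      ext j
      simp only [Pi.add_apply, Units.val_inv_eq_inv_val, Units.val_mk0]
      field_simp
      norm_num
    rw [e4] at e3
    have e5 := ha0 _ (hTG u)
    have e6 := congrArg a e3
    rw [hacoc _ (hTG _) _ (hTG _), e2, AlgEquiv.commutes, hc] at e6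
    rw [hc] at e5 ⊢
    exact (mul_eq_left₀ e5).mp e6.symm
  refine ⟨hT1, ?_⟩
  choose ψ0 hψ0 using hct
  have hψne : ∀ d, ψ0 d ≠ 0 := by
    intro d h0
    apply ha0 _ (htG d)
    rw [hψ0, h0, map_zero]
  have hψmul : ∀ d d', ψ0 (d * d') = ψ0 d * ψ0 d' := by
    intro d d'
    apply (algebraMap k K).injective
    rw [← hψ0, htmul, hacoc _ (htG _) _ (htG _), hψ0, hψ0, AlgEquiv.commutes, map_mul]
  let ψ : (Fin n → kˣ) →* kˣ := MonoidHom.mk' (fun d => Units.mk0 (ψ0 d) (hψne d)) (by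
    intro d d'; ext; simp [hψmul])
  have hψ : ∀ d, (ψ d : k) = ψ0 d := fun d => rfl
  let i0 : Fin n := ⟨0, hn⟩
  let φ : kˣ →* kˣ := ψ.comp (MonoidHom.mulSingle (fun _ : Fin n => kˣ) i0)
  have hφ : ∀ i c, ψ (Pi.mulSingle i c) = φ c := by
    intro i c
    change ψ (Pi.mulSingle i c) = ψ (Pi.mulSingle i0 c)
    have e1 : S i i0 * t (Pi.mulSingle i c) = t (Pi.mulSingle i0 c) * S i i0 := by
      apply hext
      intro l
      rw [AlgEquiv.mul_apply, AlgEquiv.mul_apply, ht, hS, map_mul, AlgEquiv.commutes, hS, ht]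
      congr 3
      by_cases hl : l = i
      · subst hl; simp
      · rw [Pi.mulSingle_eq_of_ne hl, Pi.mulSingle_eq_of_ne]
        intro h
        apply hl
        have := congrArg (Equiv.swap i i0) h
        simpa using this
    have e2 := congrArg a e1
    rw [hacoc _ (hSG _ _) _ (htG _), hacoc _ (htG _) _ (hSG _ _)] at e2
    obtain ⟨γ, hγ⟩ := hcS i i0
    have h0 := ha0 _ (hSG i i0)
    rw [hγ] at h0
    rw [hψ0, hψ0, AlgEquiv.commutes, hγ, AlgEquiv.commutes, mul_comm] at e2
    ext
    rw [hψ, hψ]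
    exact (algebraMap k K).injective (mul_right_cancel₀ h0 e2)
  refine ⟨φ, fun d => ?_⟩
  rw [hψ0, ← hψ]
  congr 2
  conv_lhs => rw [← Finset.univ_prod_mulSingle d]
  rw [map_prod]
  exact Finset.prod_congr rfl fun i _ => hφ i _

theorem cr_two_zpow (k : Type) [Field k] [CharZero k] (z : ℤ) (h : (2 : k) ^ z = 1) : z = 0 := by
  have h1 : (((2 : ℚ) ^ z : ℚ) : k) = ((1 : ℚ) : k) := by
    rw [Rat.cast_zpow]; simpa using h
  have h2 : (2 : ℚ) ^ z = 1 := Rat.cast_injective h1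
  rw [← zpow_zero (2 : ℚ)] at h2
  exact zpow_right_injective₀ (by norm_num) (by norm_num) h2

theorem cr_phi_arith (k : Type) [Field k] [CharZero k] (n : ℕ)
    (hdiv : Even n ∨ ∀ c : kˣ, ∃ b : kˣ, b ^ 2 = c) (φ : kˣ →* kˣ) (e e' : ℤ)
    (h1 : ∀ c, φ c ^ (n + 1) * c ^ e = 1) (h2 : ∀ c, φ c ^ 2 * c ^ e' = 1) :
    ∃ m : ℤ, ∀ c, φ c = c ^ m := by
  have two : kˣ := Units.mk0 2 two_ne_zero
  have hz : ∀ z : ℤ, (Units.mk0 (2 : k) two_ne_zero) ^ z = 1 → z = 0 := by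
    intro z hz
    apply cr_two_zpow k z
    have := congrArg Units.val hz
    simpa using this
  rcases hdiv with ⟨r, hr⟩ | hdiv
  · have hee : 2 * e - (n + 1) * e' = 0 := by
      apply hz
      have a1 := h1 (Units.mk0 (2 : k) two_ne_zero)
      have a2 := h2 (Units.mk0 (2 : k) two_ne_zero)
      generalize (Units.mk0 (2 : k) two_ne_zero) = c at *
      have b1 : c ^ e = (φ c ^ (n + 1))⁻¹ := eq_inv_of_mul_eq_one_right a1
      have b2 : c ^ e' = (φ c ^ 2)⁻¹ := eq_inv_of_mul_eq_one_right a2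
      rw [zpow_sub, mul_comm 2 e, zpow_mul, b1, mul_comm _ e', zpow_mul, b2]
      have : ((n : ℤ) + 1) = ((n + 1 : ℕ) : ℤ) := by push_cast; rfl
      rw [this, zpow_natCast]
      have h22 : (2 : ℤ) = ((2 : ℕ) : ℤ) := rfl
      rw [h22, zpow_natCast, inv_pow, inv_pow, ← pow_mul, ← pow_mul, mul_comm 2]
      simp
    have he' : e' = 2 * (e - r * e') := by
      rw [hr] at hee; push_cast at hee; linarith
    generalize e - r * e' = f at he'
    have he : e = (n + 1) * f := by rw [he'] at hee; linarith
    refine ⟨-f, fun c => ?_⟩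
    have a1 := h1 c
    have a2 := h2 c
    have c1 : (φ c * c ^ f) ^ (n + 1) = 1 := by
      rw [mul_pow, ← zpow_natCast (c ^ f), ← zpow_mul]
      rw [he] at a1
      rw [← a1]; congr 2; push_cast; ring
    have c2 : (φ c * c ^ f) ^ 2 = 1 := by
      rw [mul_pow, ← zpow_natCast (c ^ f), ← zpow_mul]
      rw [he'] at a2
      rw [← a2]; congr 2; push_cast; ring
    have c3 : φ c * c ^ f = 1 := by
      rw [hr, pow_succ, ← two_mul, pow_mul, c2, one_pow, one_mul] at c1
      exact c1
    rw [zpow_neg]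
    exact eq_inv_of_mul_eq_one_left c3
  · have hsq : ∀ b, φ (b ^ 2) * b ^ e' = 1 := by
      intro b; rw [map_pow]; exact h2 b
    have heven : Even e' := by
      rcases Int.even_or_odd e' with h | h
      · exact h
      · exfalso
        have a1 := hsq (-1)
        rw [neg_one_sq, map_one, one_mul, h.neg_one_zpow] at a1
        have := congrArg Units.val a1
        simp at this
        have h3 : (2 : k) = 0 := by linear_combination -this
        exact two_ne_zero h3
    obtain ⟨f, hf⟩ := heven
    refine ⟨-f, fun c => ?_⟩
    obtain ⟨b, rfl⟩ := hdiv c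
    have a1 := hsq b
    rw [zpow_neg]
    apply eq_inv_of_mul_eq_one_left
    rw [← a1, ← zpow_natCast b 2, ← zpow_mul, hf]
    congr 2
    push_cast; ring

theorem cr_invol_form (k : Type) [Field k] [CharZero k] (n : ℕ)
    {K : Type} [Field K] [Algebra k K] [Algebra (MvPolynomial (Fin n) k) K]
    [IsScalarTower k (MvPolynomial (Fin n) k) K] [IsFractionRing (MvPolynomial (Fin n) k) K]
    (x : Fin n → K) (hx : ∀ j, x j = algebraMap (MvPolynomial (Fin n) k) K (MvPolynomial.X j))
    (G : Subgroup (K ≃ₐ[k] K))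
    (t : (Fin n → kˣ) → (K ≃ₐ[k] K))
    (ht : ∀ d j, t d (x j) = algebraMap k K (d j : k) * x j) (htG : ∀ d, t d ∈ G)
    (a : (K ≃ₐ[k] K) → K) (ha0 : ∀ τ ∈ G, a τ ≠ 0)
    (hacoc : ∀ τ ∈ G, ∀ υ ∈ G, a (τ * υ) = a τ * τ (a υ))
    (Ψ : (Fin n → kˣ) → kˣ) (hΨ : ∀ d, a (t d) = algebraMap k K (Ψ d : k))
    (τ : K ≃ₐ[k] K) (hτ : τ ∈ G) (θ : (Fin n → kˣ) → (Fin n → kˣ)) (hθ : ∀ d, θ (θ d) = d)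
    (h : ∀ d, τ * t d = t (θ d) * τ) :
    ∃ (c : k) (e : Fin n → ℤ), a τ = algebraMap k K c * ∏ i, x i ^ e i ∧
      ∀ d, Ψ (θ d) = Ψ d * ∏ i, (d i) ^ e i := by
  obtain ⟨c, e, h1, h2⟩ := cr_torus_form k n x hx t ht (a τ) (ha0 τ hτ)
    (fun d => (Ψ (θ d) : k) / Ψ d) (by
      intro d
      have e1 := congrArg a (h (θ d))
      rw [hθ, hacoc _ hτ _ (htG _), hacoc _ (htG _) _ hτ, hΨ, hΨ, AlgEquiv.commutes] at e1
      have h0 : algebraMap k K (Ψ d : k) ≠ 0 := by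
        rw [Ne, map_eq_zero_iff _ (algebraMap k K).injective]; exact (Ψ d).ne_zero
      rw [map_div₀]
      field_simp
      rw [mul_comm, ← e1, mul_comm])
  refine ⟨c, e, h1, fun d => ?_⟩
  ext
  have h3 := h2 d
  have h0 := (Ψ d).ne_zero
  rw [div_eq_iff h0] at h3
  rw [h3, mul_comm]
  push_cast
  rfl

/-- the effect of conjugation by the reflection `w` on diagonal maps -/
def crThW {k : Type} [Field k] {n : ℕ} (i : Fin n) (d : Fin n → kˣ) : Fin n → kˣ :=
  fun j => if j = i then (d i)⁻¹ else d j * (d i)⁻¹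

/-- the effect of conjugation by the involution on diagonal maps -/
def crThS {k : Type} [Field k] {n : ℕ} (i : Fin n) (d : Fin n → kˣ) : Fin n → kˣ :=
  fun j => if j = i then (d i)⁻¹ else d j

theorem cr_thW_invol {k : Type} [Field k] {n : ℕ} (i : Fin n) (d : Fin n → kˣ) :
    crThW i (crThW i d) = d := by
  funext j
  by_cases h : j = i <;> simp [crThW, h]

theorem cr_thS_invol {k : Type} [Field k] {n : ℕ} (i : Fin n) (d : Fin n → kˣ) :
    crThS i (crThS i d) = d := by
  funext j
  by_cases h : j = i <;> simp [crThS, h]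

theorem cr_w_conj (k : Type) [Field k] (n : ℕ)
    {K : Type} [Field K] [Algebra k K] [Algebra (MvPolynomial (Fin n) k) K]
    [IsScalarTower k (MvPolynomial (Fin n) k) K] [IsFractionRing (MvPolynomial (Fin n) k) K]
    (x : Fin n → K) (hx : ∀ j, x j = algebraMap (MvPolynomial (Fin n) k) K (MvPolynomial.X j))
    (t : (Fin n → kˣ) → (K ≃ₐ[k] K))
    (ht : ∀ d j, t d (x j) = algebraMap k K (d j : k) * x j)
    (i : Fin n) (w : K ≃ₐ[k] K) (hw : ∀ j, w (x j) = (if j = i then 1 else x j) / x i)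
    (d : Fin n → kˣ) : w * t d = t (crThW i d) * w := by
  apply cr_algEquiv_ext k n x hx
  intro j
  have h0 : algebraMap k K (d i : k) ≠ 0 := by
    rw [Ne, map_eq_zero_iff _ (algebraMap k K).injective]; exact (d i).ne_zero
  rw [AlgEquiv.mul_apply, AlgEquiv.mul_apply, ht, map_mul, AlgEquiv.commutes, hw, map_div₀, ht]
  by_cases h : j = i
  · simp [crThW, h]
    field_simp
  · simp [crThW, h, ht]
    field_simp

theorem cr_s_conj (k : Type) [Field k] (n : ℕ)
    {K : Type} [Field K] [Algebra k K] [Algebra (MvPolynomial (Fin n) k) K]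
    [IsScalarTower k (MvPolynomial (Fin n) k) K] [IsFractionRing (MvPolynomial (Fin n) k) K]
    (x : Fin n → K) (hx : ∀ j, x j = algebraMap (MvPolynomial (Fin n) k) K (MvPolynomial.X j))
    (t : (Fin n → kˣ) → (K ≃ₐ[k] K))
    (ht : ∀ d j, t d (x j) = algebraMap k K (d j : k) * x j)
    (i : Fin n) (s : K ≃ₐ[k] K) (hs1 : s (x i) = (x i)⁻¹) (hs2 : ∀ j, j ≠ i → s (x j) = x j)
    (d : Fin n → kˣ) : s * t d = t (crThS i d) * s := by
  apply cr_algEquiv_ext k n x hx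
  intro j
  have h0 : algebraMap k K (d i : k) ≠ 0 := by
    rw [Ne, map_eq_zero_iff _ (algebraMap k K).injective]; exact (d i).ne_zero
  rw [AlgEquiv.mul_apply, AlgEquiv.mul_apply, ht, map_mul, AlgEquiv.commutes]
  by_cases h : j = i
  · subst h
    rw [hs1, map_inv₀, ht]
    simp [crThS]
    field_simp
  · rw [hs2 j h, ht]
    simp [crThS, h]

theorem cr_phi (k : Type) [Field k] [CharZero k] (n : ℕ)
    (hdiv : Even n ∨ ∀ c : kˣ, ∃ b : kˣ, b ^ 2 = c)
    {K : Type} [Field K] [Algebra k K] [Algebra (MvPolynomial (Fin n) k) K]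
    [IsScalarTower k (MvPolynomial (Fin n) k) K] [IsFractionRing (MvPolynomial (Fin n) k) K]
    (x : Fin n → K) (hx : ∀ j, x j = algebraMap (MvPolynomial (Fin n) k) K (MvPolynomial.X j))
    (G : Subgroup (K ≃ₐ[k] K))
    (t : (Fin n → kˣ) → (K ≃ₐ[k] K))
    (ht : ∀ d j, t d (x j) = algebraMap k K (d j : k) * x j) (htG : ∀ d, t d ∈ G)
    (i : Fin n) (w : K ≃ₐ[k] K) (hw : ∀ j, w (x j) = (if j = i then 1 else x j) / x i) (hwG : w ∈ G)
    (s : K ≃ₐ[k] K) (hs1 : s (x i) = (x i)⁻¹) (hs2 : ∀ j, j ≠ i → s (x j) = x j) (hsG : s ∈ G)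
    (a : (K ≃ₐ[k] K) → K) (ha0 : ∀ τ ∈ G, a τ ≠ 0)
    (hacoc : ∀ τ ∈ G, ∀ υ ∈ G, a (τ * υ) = a τ * τ (a υ))
    (φ : kˣ →* kˣ) (hφ : ∀ d, a (t d) = algebraMap k K ((∏ j, φ (d j) : kˣ) : k)) :
    ∃ m : ℤ, ∀ c, φ c = c ^ m := by
  obtain ⟨-, e, -, h1⟩ := cr_invol_form k n x hx G t ht htG a ha0 hacoc _ hφ w hwG
    (crThW i) (cr_thW_invol i) (cr_w_conj k n x hx t ht i w hw)
  obtain ⟨-, e', -, h2⟩ := cr_invol_form k n x hx G t ht htG a ha0 hacoc _ hφ s hsG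
    (crThS i) (cr_thS_invol i) (cr_s_conj k n x hx t ht i s hs1 hs2)
  have hP : ∀ (ψ : Fin n → kˣ → kˣ) (hψ : ∀ j, ψ j 1 = 1) (c : kˣ),
      ∏ j, ψ j ((Pi.mulSingle i c : Fin n → kˣ) j) = ψ i c := by
    intro ψ hψ c
    rw [Finset.prod_eq_single i]
    · simp
    · intro j _ hj; rw [Pi.mulSingle_eq_of_ne hj, hψ]
    · simp
  apply cr_phi_arith k n hdiv φ (e i) (e' i)
  · intro c
    have := h1 (Pi.mulSingle i c)
    have e1 : crThW i (Pi.mulSingle i c) = fun _ => c⁻¹ := by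
      funext j
      by_cases h : j = i <;> simp [crThW, h]
    rw [e1, hP (fun j => φ) (by simp), hP (fun j y => y ^ e j) (by simp)] at this
    simp at this
    rw [pow_succ, mul_assoc, ← this]
    simp
  · intro c
    have := h2 (Pi.mulSingle i c)
    have e1 : crThS i (Pi.mulSingle i c) = Pi.mulSingle i c⁻¹ := by
      funext j
      by_cases h : j = i
      · subst h; simp [crThS]
      · simp [crThS, h]
    rw [e1, hP (fun j => φ) (by simp), hP (fun j => φ) (by simp), hP (fun j y => y ^ e' j) (by simp)] at this
    rw [sq, mul_assoc, ← this]
    simp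

/-- if the cocycle is trivial on the torus, it is constant on torus-normalizing elements -/
theorem cr_const_of_conj (k : Type) [Field k] [CharZero k] (n : ℕ)
    {K : Type} [Field K] [Algebra k K] [Algebra (MvPolynomial (Fin n) k) K]
    [IsScalarTower k (MvPolynomial (Fin n) k) K] [IsFractionRing (MvPolynomial (Fin n) k) K]
    (x : Fin n → K) (hx : ∀ j, x j = algebraMap (MvPolynomial (Fin n) k) K (MvPolynomial.X j))
    (G : Subgroup (K ≃ₐ[k] K))
    (t : (Fin n → kˣ) → (K ≃ₐ[k] K))
    (ht : ∀ d j, t d (x j) = algebraMap k K (d j : k) * x j) (htG : ∀ d, t d ∈ G)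
    (a : (K ≃ₐ[k] K) → K) (ha0 : ∀ τ ∈ G, a τ ≠ 0)
    (hacoc : ∀ τ ∈ G, ∀ υ ∈ G, a (τ * υ) = a τ * τ (a υ))
    (hat : ∀ d, a (t d) = 1)
    (τ : K ≃ₐ[k] K) (hτ : τ ∈ G) (θ : (Fin n → kˣ) → (Fin n → kˣ)) (hθ : ∀ d, θ (θ d) = d)
    (h : ∀ d, τ * t d = t (θ d) * τ) : ∃ c : k, a τ = algebraMap k K c := by
  obtain ⟨c, e, h1, h2⟩ := cr_invol_form k n x hx G t ht htG a ha0 hacoc (fun _ => 1)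
    (by intro d; rw [hat]; simp) τ hτ θ hθ h
  have he : ∀ i, e i = 0 := by
    intro i
    have := h2 (Pi.mulSingle i (Units.mk0 2 two_ne_zero))
    rw [Finset.prod_eq_single i] at this
    · apply cr_two_zpow k
      have := congrArg Units.val this
      simpa using this.symm
    · intro j _ hj; rw [Pi.mulSingle_eq_of_ne hj, one_zpow]
    · simp
  exact ⟨c, by rw [h1]; simp [he]⟩

/-- matrix of a transposition -/
def crSw (k : Type) [Field k] (N : ℕ) (p q : Fin N) : (Matrix (Fin N) (Fin N) k)ˣ where
  val := Matrix.of fun a b => if a = Equiv.swap p q b then 1 else 0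
  inv := Matrix.of fun a b => if a = Equiv.swap p q b then 1 else 0
  val_inv := by ext a b; simp [Matrix.mul_apply, Matrix.one_apply]
  inv_val := by ext a b; simp [Matrix.mul_apply, Matrix.one_apply]

/-- diagonal matrix -/
def crDg (k : Type) [Field k] (N : ℕ) (d : Fin N → kˣ) : (Matrix (Fin N) (Fin N) k)ˣ where
  val := Matrix.diagonal fun a => (d a : k)
  inv := Matrix.diagonal fun a => ((d a)⁻¹ : kˣ)
  val_inv := by rw [Matrix.diagonal_mul_diagonal]; simp
  inv_val := by rw [Matrix.diagonal_mul_diagonal]; simp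

theorem cr_tr_mul (k : Type) [Field k] (n : ℕ) (u v : Fin n → k) (h : u + v = 0) :
    (1 + Matrix.of fun a b : Fin (n + 1) => if a = Fin.last n then (Fin.snoc u 0 : Fin (n + 1) → k) b else 0) *
    (1 + Matrix.of fun a b : Fin (n + 1) => if a = Fin.last n then (Fin.snoc v 0 : Fin (n + 1) → k) b else 0) = 1 := by
  have h0 : (Matrix.of fun a b : Fin (n + 1) => if a = Fin.last n then (Fin.snoc u 0 : Fin (n + 1) → k) b else 0) *
    (Matrix.of fun a b : Fin (n + 1) => if a = Fin.last n then (Fin.snoc v 0 : Fin (n + 1) → k) b else 0) = 0 := by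
    ext a b
    simp [Matrix.mul_apply]
  have h1 : (Matrix.of fun a b : Fin (n + 1) => if a = Fin.last n then (Fin.snoc u 0 : Fin (n + 1) → k) b else 0) +
    (Matrix.of fun a b : Fin (n + 1) => if a = Fin.last n then (Fin.snoc v 0 : Fin (n + 1) → k) b else 0) = 0 := by
    ext a b
    refine Fin.lastCases ?_ (fun j => ?_) b
    · simp
    · have := congrFun h j
      simp at this
      simp only [Matrix.add_apply, Matrix.of_apply, Fin.snoc_castSucc, Matrix.zero_apply]
      split_ifs <;> simp [this]
  rw [add_mul, mul_add, mul_add, h0, add_zero, mul_one, one_mul, mul_one, add_assoc,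
    add_comm (Matrix.of _), h1, add_zero]

/-- matrix of a translation -/
def crTr (k : Type) [Field k] (n : ℕ) (u : Fin n → k) : (Matrix (Fin (n + 1)) (Fin (n + 1)) k)ˣ where
  val := 1 + Matrix.of fun a b => if a = Fin.last n then (Fin.snoc u 0 : Fin (n + 1) → k) b else 0
  inv := 1 + Matrix.of fun a b => if a = Fin.last n then (Fin.snoc (-u) 0 : Fin (n + 1) → k) b else 0
  val_inv := cr_tr_mul k n u (-u) (by simp)
  inv_val := cr_tr_mul k n (-u) u (by simp)

theorem cr_sw_conj (k : Type) [Field k] (N : ℕ) (p q i j : Fin N) (c : k) :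
    (crSw k N p q).val * Matrix.transvection (Equiv.swap p q i) (Equiv.swap p q j) c * (crSw k N p q).val =
      Matrix.transvection i j c := by
  ext a b
  have h : ∀ a, (Equiv.swap p q i = a ↔ i = Equiv.swap p q a) := by
    intro a; constructor
    · rintro rfl; simp
    · rintro rfl; simp
  have h2 : ∀ a c, (a = Equiv.swap p q c ↔ c = Equiv.swap p q a) := by
    intro a c; constructor
    · rintro rfl; simp
    · rintro rfl; simp
  simp only [crSw, Matrix.mul_apply, Matrix.of_apply, mul_ite, mul_one, mul_zero, Finset.sum_ite_eq',
    Finset.mem_univ, if_true, ite_mul, one_mul, zero_mul]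
  simp only [h2 a, Finset.sum_ite_eq', Finset.mem_univ, if_true]
  simp only [Matrix.transvection, Matrix.add_apply, Matrix.one_apply, Matrix.single_apply,
    EmbeddingLike.apply_eq_iff_eq]

theorem cr_tr_eq (k : Type) [Field k] (n : ℕ) (j : Fin n) (c : k) :
    (crTr k n (Pi.single j c)).val = Matrix.transvection (Fin.last n) j.castSucc c := by
  ext a b
  simp only [crTr, Matrix.transvection, Matrix.add_apply, Matrix.single_apply, Matrix.of_apply]
  congr 1
  refine Fin.lastCases ?_ (fun l => ?_) b
  · have : j.castSucc ≠ Fin.last n := (Fin.castSucc_lt_last j).ne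
    simp [this]
  · by_cases h : a = Fin.last n
    · subst h
      by_cases hl : l = j
      · subst hl; simp
      · simp [hl, Ne.symm hl]
    · simp [h, Ne.symm h]

theorem cr_rigid (k : Type) [Field k] [CharZero k] (n : ℕ)
    {K : Type} [Field K] [Algebra k K] [Algebra (MvPolynomial (Fin n) k) K]
    [IsScalarTower k (MvPolynomial (Fin n) k) K] [IsFractionRing (MvPolynomial (Fin n) k) K]
    (x : Fin n → K) (hx : ∀ j, x j = algebraMap (MvPolynomial (Fin n) k) K (MvPolynomial.X j))
    (ρ : (Matrix (Fin (n + 1)) (Fin (n + 1)) k)ˣ → (K ≃ₐ[k] K))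
    (hρ : ∀ A B, ρ (A * B) = ρ A * ρ B) (hρ1 : ρ 1 = 1)
    (T : (Fin n → k) → (K ≃ₐ[k] K)) (hTdef : ∀ u, T u = ρ (crTr k n u))
    (hT : ∀ u j, T u (x j) = x j + algebraMap k K (u j))
    (t : (Fin n → kˣ) → (K ≃ₐ[k] K))
    (htdef : ∀ d, ρ (crDg k (n + 1) d) = t (fun j => d j.castSucc * (d (Fin.last n))⁻¹))
    (ht : ∀ d j, t d (x j) = algebraMap k K (d j : k) * x j)
    (hw : ∀ i j, ρ (crSw k (n + 1) (Fin.castSucc i) (Fin.last n)) (x j) = (if j = i then 1 else x j) / x i)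
    (i : Fin n)
    (s : K ≃ₐ[k] K) (hs1 : s (x i) = (x i)⁻¹) (hs2 : ∀ j, j ≠ i → s (x j) = x j)
    (G : Subgroup (K ≃ₐ[k] K)) (hG : G = Subgroup.closure (Set.range ρ ∪ {s}))
    (htG : ∀ d, t d ∈ G)
    (b : (K ≃ₐ[k] K) → K) (hb0 : ∀ τ ∈ G, b τ ≠ 0)
    (hb : ∀ τ ∈ G, ∀ υ ∈ G, b (τ * υ) = b τ * τ (b υ))
    (hbT : ∀ u, b (T u) = 1) (hbt : ∀ d, b (t d) = 1) :
    ∀ τ ∈ G, b τ = 1 := by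
  have hρG : ∀ A, ρ A ∈ G := by
    intro A; rw [hG]; exact Subgroup.subset_closure (Or.inl ⟨A, rfl⟩)
  have hsG : s ∈ G := by
    rw [hG]; exact Subgroup.subset_closure (Or.inr rfl)
  have hTG : ∀ u, T u ∈ G := by intro u; rw [hTdef]; exact hρG _
  have hb1 : b 1 = 1 := by
    have h1 := hb 1 G.one_mem 1 G.one_mem
    rw [mul_one, AlgEquiv.one_apply] at h1
    exact (mul_eq_left₀ (hb0 1 G.one_mem)).mp h1.symm
  -- transvections
  have htrans : ∀ (p q : Fin (n + 1)) (hpq : p ≠ q) (c : k) (A : (Matrix (Fin (n + 1)) (Fin (n + 1)) k)ˣ),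
      A.val = Matrix.transvection p q c → b (ρ A) = 1 := by
    intro p q hpq c A hA
    have hlast : ∀ (q : Fin (n + 1)) (hq : q ≠ Fin.last n), ∃ B : (Matrix (Fin (n + 1)) (Fin (n + 1)) k)ˣ,
        B.val = Matrix.transvection (Fin.last n) q c ∧ b (ρ B) = 1 := by
      intro q hq
      obtain ⟨j, rfl⟩ := Fin.exists_castSucc_eq.mpr hq
      exact ⟨crTr k n (Pi.single j c), cr_tr_eq k n j c, by rw [← hTdef, hbT]⟩
    by_cases hp : p = Fin.last n
    · subst hp
      obtain ⟨B, hB, hB1⟩ := hlast q hpq.symm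
      have : A = B := Units.ext (hA.trans hB.symm)
      rw [this, hB1]
    · obtain ⟨l, rfl⟩ := Fin.exists_castSucc_eq.mpr hp
      obtain ⟨B, hB, hB1⟩ := hlast (Equiv.swap l.castSucc (Fin.last n) q) (by
        intro h
        apply hpq
        have := congrArg (Equiv.swap l.castSucc (Fin.last n)) h
        simpa using this.symm)
      have hAB : A = crSw k (n + 1) l.castSucc (Fin.last n) * B * crSw k (n + 1) l.castSucc (Fin.last n) := by
        apply Units.ext
        rw [Units.val_mul, Units.val_mul, hB, hA]
        have := cr_sw_conj k (n + 1) l.castSucc (Fin.last n) l.castSucc q c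
        rw [Equiv.swap_apply_left] at this
        exact this.symm
      have hPP : crSw k (n + 1) l.castSucc (Fin.last n) * crSw k (n + 1) l.castSucc (Fin.last n) = 1 :=
        Units.ext (crSw k (n + 1) l.castSucc (Fin.last n)).val_inv
      obtain ⟨β, hβ⟩ := cr_const_of_conj k n x hx G t ht htG b hb0 hb hbt
        (ρ (crSw k (n + 1) l.castSucc (Fin.last n))) (hρG _) (crThW l) (cr_thW_invol l)
        (cr_w_conj k n x hx t ht l _ (hw l))
      have e1 := hb _ (hρG (crSw k (n + 1) l.castSucc (Fin.last n))) _ (hρG (crSw k (n + 1) l.castSucc (Fin.last n)))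
      rw [← hρ, hPP, hρ1, hb1, hβ, AlgEquiv.commutes] at e1
      rw [hAB, hρ, hρ, hb _ (G.mul_mem (hρG _) (hρG _)) _ (hρG _), hb _ (hρG _) _ (hρG _), hB1, map_one,
        mul_one, hβ, AlgEquiv.commutes, e1]
  have hGL : ∀ M : Matrix (Fin (n + 1)) (Fin (n + 1)) k, M.det ≠ 0 →
      ∀ A : (Matrix (Fin (n + 1)) (Fin (n + 1)) k)ˣ, A.val = M → b (ρ A) = 1 := by
    intro M hM
    apply Matrix.diagonal_transvection_induction_of_det_ne_zero
      (fun M => ∀ A : (Matrix (Fin (n + 1)) (Fin (n + 1)) k)ˣ, A.val = M → b (ρ A) = 1) M hM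
    · intro D hD A hA
      rw [Matrix.det_diagonal, Finset.prod_ne_zero_iff] at hD
      have : A = crDg k (n + 1) (fun i => Units.mk0 (D i) (hD i (Finset.mem_univ _))) := by
        apply Units.ext
        rw [hA]
        rfl
      rw [this, htdef, hbt]
    · intro τ A hA
      exact htrans τ.i τ.j τ.hij τ.c A hA
    · intro M N hM hN h1 h2 A hA
      have hA' : A = Matrix.GeneralLinearGroup.mkOfDetNeZero M hM * Matrix.GeneralLinearGroup.mkOfDetNeZero N hN :=
        Units.ext hA
      have hh := hρ (Matrix.GeneralLinearGroup.mkOfDetNeZero M hM) (Matrix.GeneralLinearGroup.mkOfDetNeZero N hN)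
      rw [hA', hh, hb _ (hρG _) _ (hρG _), h1 _ rfl, h2 _ rfl, map_one, mul_one]
  have hbρ : ∀ A, b (ρ A) = 1 := by
    intro A
    refine hGL A.val ?_ A rfl
    exact ((Matrix.isUnit_iff_isUnit_det _).mp A.isUnit).ne_zero
  have hx0 := cr_x_ne k n x hx i
  -- the involution
  have hbs : b s = 1 := by
    obtain ⟨β, hβ⟩ := cr_const_of_conj k n x hx G t ht htG b hb0 hb hbt
        s hsG (crThS i) (cr_thS_invol i)
        (cr_s_conj k n x hx t ht i s hs1 hs2)
    have hss : s * s = 1 := by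
      apply cr_algEquiv_ext k n x hx
      intro j
      rw [AlgEquiv.mul_apply, AlgEquiv.one_apply]
      by_cases h : j = i
      · subst h; rw [hs1, map_inv₀, hs1, inv_inv]
      · rw [hs2 j h, hs2 j h]
    have e1 := hb _ hsG _ hsG
    rw [hss, hb1, hβ, AlgEquiv.commutes] at e1
    set h := T (Pi.single i (-1)) * t (Pi.mulSingle i (-1)) with hh
    have hhG : h ∈ G := G.mul_mem (hTG _) (htG _)
    have hbh : b h = 1 := by
      rw [hh, hb _ (hTG _) _ (htG _), hbT, hbt, map_one, mul_one]
    have hhi : h (x i) = 1 - x i := by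
      rw [hh, AlgEquiv.mul_apply, ht, map_mul, AlgEquiv.commutes, hT]
      simp
      ring
    have hhj : ∀ j, j ≠ i → h (x j) = x j := by
      intro j hj
      rw [hh, AlgEquiv.mul_apply, ht, map_mul, AlgEquiv.commutes, hT]
      simp [hj]
    have hri : (s * h) (x i) = 1 - (x i)⁻¹ := by
      rw [AlgEquiv.mul_apply, hhi, map_sub, map_one, hs1]
    have hrj : ∀ j, j ≠ i → (s * h) (x j) = x j := by
      intro j hj
      rw [AlgEquiv.mul_apply, hhj j hj, hs2 j hj]
    have hx1 : 1 - (x i)⁻¹ ≠ 0 := by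
      rw [← hri, Ne, map_eq_zero_iff _ (s * h).injective]; exact hx0
    have hx2 : x i - 1 ≠ 0 := by
      intro h0
      apply hx1
      have : x i = 1 := by linear_combination h0
      rw [this]; simp
    have hcube : (s * h) * ((s * h) * (s * h)) = 1 := by
      apply cr_algEquiv_ext k n x hx
      intro j
      change (s * h) ((s * h) ((s * h) (x j))) = x j
      by_cases hj : j = i
      · subst hj
        rw [hri, map_sub, map_inv₀, hri, map_one, map_sub, map_inv₀, map_sub, map_inv₀, hri, map_one]
        have e3 : 1 - (x j)⁻¹ = (x j - 1) / x j := by field_simp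
        rw [e3, inv_div]
        have e4 : 1 - x j / (x j - 1) = - (x j - 1)⁻¹ := by field_simp; ring
        rw [e4]; simp
      · rw [hrj j hj, hrj j hj, hrj j hj]
    have hrG : s * h ∈ G := G.mul_mem hsG hhG
    have hbr : b (s * h) = algebraMap k K β := by
      rw [hb _ hsG _ hhG, hbh, map_one, mul_one, hβ]
    have e2 := hb _ hrG _ (G.mul_mem hrG hrG)
    rw [hcube, hb1, hb _ hrG _ hrG, hbr, AlgEquiv.commutes, ← e1, map_one, mul_one] at e2
    rw [hβ, ← e2]
  intro τ hτ
  have hτ' := hτ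
  rw [hG] at hτ'
  have : τ ∈ G ∧ b τ = 1 := by
    induction hτ' using Subgroup.closure_induction with
    | mem y hy =>
      rcases hy with ⟨A, rfl⟩ | rfl
      · exact ⟨hρG A, hbρ A⟩
      · exact ⟨hsG, hbs⟩
    | one => exact ⟨G.one_mem, hb1⟩
    | mul y z hy hz h1 h2 =>
      obtain ⟨h1, h1'⟩ := h1 (by rw [hG]; exact hy)
      obtain ⟨h2, h2'⟩ := h2 (by rw [hG]; exact hz)
      exact ⟨G.mul_mem h1 h2, by rw [hb _ h1 _ h2, h1', h2', map_one, mul_one]⟩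
    | inv y hy h1 =>
      obtain ⟨h1, h1'⟩ := h1 (by rw [hG]; exact hy)
      refine ⟨G.inv_mem h1, ?_⟩
      have := hb _ h1 _ (G.inv_mem h1)
      rw [mul_inv_cancel, hb1, h1', one_mul] at this
      exact ((map_eq_one_iff _ y.injective).mp this.symm)
  exact this.2

theorem cr_main
    (k : Type) [Field k] [CharZero k] (n : ℕ) (hn : 1 ≤ n)
    (hdiv : Even n ∨ ∀ c : kˣ, ∃ b : kˣ, b ^ 2 = c)
    {K : Type} [Field K] [Algebra k K] [Algebra (MvPolynomial (Fin n) k) K]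
    [IsScalarTower k (MvPolynomial (Fin n) k) K] [IsFractionRing (MvPolynomial (Fin n) k) K]
    (x : Fin n → K)
    (hx : ∀ j, x j = algebraMap (MvPolynomial (Fin n) k) K (MvPolynomial.X j))
    (den : (Matrix (Fin (n + 1)) (Fin (n + 1)) k)ˣ → K)
    (hden : ∀ A, den A = (∑ i : Fin n,
        algebraMap k K (A.val i.castSucc (Fin.last n)) * x i)
      + algebraMap k K (A.val (Fin.last n) (Fin.last n)))
    (num : (Matrix (Fin (n + 1)) (Fin (n + 1)) k)ˣ → Fin n → K)
    (hnum : ∀ A j, num A j = (∑ i : Fin n,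
        algebraMap k K (A.val i.castSucc j.castSucc) * x i)
      + algebraMap k K (A.val (Fin.last n) j.castSucc))
    (ρ : (Matrix (Fin (n + 1)) (Fin (n + 1)) k)ˣ → (K ≃ₐ[k] K))
    (hρmul : ∀ A B y, ρ (A * B) y = ρ A (ρ B y))
    (hρval : ∀ A j, ρ A (x j) * den A = num A j)
    (s : K ≃ₐ[k] K)
    (hs1 : s (x ⟨0, hn⟩) = (x ⟨0, hn⟩)⁻¹)
    (hs2 : ∀ j : Fin n, (j : ℕ) ≠ 0 → s (x j) = x j)
    (pd : Fin n → Derivation k K K)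
    (hpd : ∀ i j, pd j (x i) = if i = j then 1 else 0)
    (jac : (K ≃ₐ[k] K) → K)
    (hjac : ∀ τ, jac τ = (Matrix.of fun i j : Fin n => pd j (τ (x i))).det)
    (G : Subgroup (K ≃ₐ[k] K))
    (hG : G = Subgroup.closure (Set.range ρ ∪ {s}))
    (a : (K ≃ₐ[k] K) → K)
    (ha0 : ∀ τ ∈ G, a τ ≠ 0)
    (hacoc : ∀ τ ∈ G, ∀ υ ∈ G, a (τ * υ) = a τ * τ (a υ)) :
    ∃ (m : ℤ) (g : K), g ≠ 0 ∧
      ∀ τ ∈ G, a τ * τ g = g * jac τ ^ m := by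
  have hext := cr_algEquiv_ext k n x hx
  have hx0 := cr_x_ne k n x hx
  have hρ : ∀ A B, ρ (A * B) = ρ A * ρ B := fun A B => AlgEquiv.ext (hρmul A B)
  have hρ1 : ρ 1 = 1 := by
    have := hρ 1 1
    rw [mul_one] at this
    exact left_eq_mul.mp this
  have hρG : ∀ A, ρ A ∈ G := by
    intro A; rw [hG]; exact Subgroup.subset_closure (Or.inl ⟨A, rfl⟩)
  have hsG : s ∈ G := by
    rw [hG]; exact Subgroup.subset_closure (Or.inr rfl)
  let X : Fin (n + 1) → K := Fin.snoc x 1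
  have hXc : ∀ j : Fin n, X j.castSucc = x j := fun j => by simp [X]
  have hXl : X (Fin.last n) = 1 := by simp [X]
  have hval : ∀ A j, ρ A (x j) * (∑ c, algebraMap k K (A.val c (Fin.last n)) * X c) =
      ∑ c, algebraMap k K (A.val c j.castSucc) * X c := by
    intro A j
    have := hρval A j
    rw [hden, hnum] at this
    rw [Fin.sum_univ_castSucc, Fin.sum_univ_castSucc]
    simp only [hXc, hXl, mul_one]
    exact this
  have hNsw : ∀ p q b, ∑ c, algebraMap k K ((crSw k (n + 1) p q).val c b) * X c = X (Equiv.swap p q b) := by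
    intro p q b
    simp [crSw, apply_ite (algebraMap k K)]
  have hNdg : ∀ d b, ∑ c, algebraMap k K ((crDg k (n + 1) d).val c b) * X c = algebraMap k K (d b : k) * X b := by
    intro d b
    simp [crDg, Matrix.diagonal_apply, apply_ite (algebraMap k K)]
  have hNtr : ∀ u b, ∑ c, algebraMap k K ((crTr k n u).val c b) * X c =
      X b + algebraMap k K ((Fin.snoc u 0 : Fin (n + 1) → k) b) := by
    intro u b
    simp [crTr, Matrix.one_apply, apply_ite (algebraMap k K), add_mul, Finset.sum_add_distrib, hXl]
  -- translations
  let T : (Fin n → k) → (K ≃ₐ[k] K) := fun u => ρ (crTr k n u)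
  have hT : ∀ u j, T u (x j) = x j + algebraMap k K (u j) := by
    intro u j
    have := hval (crTr k n u) j
    rw [hNtr, hNtr, hXl, hXc, Fin.snoc_last, Fin.snoc_castSucc, map_zero, add_zero, mul_one] at this
    exact this
  have hTG : ∀ u, T u ∈ G := fun u => hρG _
  -- diagonal maps
  have hdg : ∀ d j, ρ (crDg k (n + 1) d) (x j) =
      algebraMap k K ((d j.castSucc * (d (Fin.last n))⁻¹ : kˣ) : k) * x j := by
    intro d j
    have := hval (crDg k (n + 1) d) j
    rw [hNdg, hNdg, hXl, hXc, mul_one] at this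
    have h0 : algebraMap k K (d (Fin.last n) : k) ≠ 0 := by
      rw [Ne, map_eq_zero_iff _ (algebraMap k K).injective]; exact (d _).ne_zero
    rw [← eq_div_iff h0] at this
    rw [this, Units.val_mul, map_mul, Units.val_inv_eq_inv_val, map_inv₀]
    ring
  let t : (Fin n → kˣ) → (K ≃ₐ[k] K) := fun d => ρ (crDg k (n + 1) (Fin.snoc d 1 : Fin (n + 1) → kˣ))
  have ht : ∀ d j, t d (x j) = algebraMap k K (d j : k) * x j := by
    intro d j
    have := hdg (Fin.snoc d 1 : Fin (n + 1) → kˣ) j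
    rw [Fin.snoc_last, Fin.snoc_castSucc, inv_one, mul_one] at this
    exact this
  have htG : ∀ d, t d ∈ G := fun d => hρG _
  have htdef : ∀ d, ρ (crDg k (n + 1) d) = t (fun j => d j.castSucc * (d (Fin.last n))⁻¹) := by
    intro d
    apply hext
    intro j
    rw [hdg, ht]
  -- swaps
  let S : Fin n → Fin n → (K ≃ₐ[k] K) := fun i j => ρ (crSw k (n + 1) i.castSucc j.castSucc)
  have hS : ∀ i j l, S i j (x l) = x (Equiv.swap i j l) := by
    intro i j l
    have := hval (crSw k (n + 1) i.castSucc j.castSucc) l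
    rw [hNsw, hNsw, Equiv.swap_apply_of_ne_of_ne (Fin.castSucc_lt_last i).ne' (Fin.castSucc_lt_last j).ne',
      hXl, mul_one, (Fin.castSucc_injective n).swap_apply, hXc] at this
    exact this
  have hSG : ∀ i j, S i j ∈ G := fun i j => hρG _
  have hw : ∀ i j, ρ (crSw k (n + 1) (Fin.castSucc i) (Fin.last n)) (x j) = (if j = i then 1 else x j) / x i := by
    intro i j
    have := hval (crSw k (n + 1) (Fin.castSucc i) (Fin.last n)) j
    rw [hNsw, hNsw, Equiv.swap_apply_right, hXc] at this
    rw [eq_div_iff (hx0 i), this]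
    split_ifs with h
    · rw [h, Equiv.swap_apply_left, hXl]
    · rw [Equiv.swap_apply_of_ne_of_ne (fun h' => h (Fin.castSucc_injective n h')) (Fin.castSucc_lt_last j).ne, hXc]
  have hs2' : ∀ j : Fin n, j ≠ ⟨0, hn⟩ → s (x j) = x j := by
    intro j hj
    apply hs2
    intro h
    exact hj (Fin.ext h)
  -- first normalisation
  have hTadd : ∀ u v, T (u + v) = T u * T v := by
    intro u v
    apply hext
    intro j
    rw [AlgEquiv.mul_apply, hT, hT, map_add, AlgEquiv.commutes, hT, Pi.add_apply, map_add]
    ring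
  obtain ⟨g, hg0, hg⟩ := cr_trans_trivial k n x hx T hT (fun u => a (T u)) (fun u => ha0 _ (hTG u))
    (fun u v => by
      change a (T (u + v)) = _
      rw [hTadd, hacoc _ (hTG u) _ (hTG v)])
  have hτg : ∀ τ : K ≃ₐ[k] K, τ g ≠ 0 := by
    intro τ; rw [Ne, map_eq_zero_iff _ τ.injective]; exact hg0
  let a1 : (K ≃ₐ[k] K) → K := fun τ => a τ * τ g / g
  have ha1 : ∀ τ, a1 τ = a τ * τ g / g := fun τ => rfl
  have ha10 : ∀ τ ∈ G, a1 τ ≠ 0 := fun τ hτ => div_ne_zero (mul_ne_zero (ha0 τ hτ) (hτg τ)) hg0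
  have ha1coc : ∀ τ ∈ G, ∀ υ ∈ G, a1 (τ * υ) = a1 τ * τ (a1 υ) := by
    intro τ hτ υ hυ
    rw [ha1, ha1, ha1, hacoc τ hτ υ hυ, map_div₀, map_mul, AlgEquiv.mul_apply]
    have := hτg τ
    field_simp
  have ha1T : ∀ u, ∃ c : k, a1 (T u) = algebraMap k K c := by
    intro u
    obtain ⟨c, hc⟩ := hg u
    exact ⟨c, by rw [ha1, div_eq_iff hg0]; exact hc⟩
  obtain ⟨h1T, φ, hφ⟩ := cr_normalize k n hn x hx G T hT hTG t ht htG S hS hSG a1 ha10 ha1coc ha1T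
  obtain ⟨m, hm⟩ := cr_phi k n hdiv x hx G t ht htG ⟨0, hn⟩ _ (hw ⟨0, hn⟩) (hρG _) s hs1 hs2' hsG
    a1 ha10 ha1coc φ hφ
  -- the Jacobian
  have hjmul := cr_jac_mul k n x hx pd hpd jac hjac
  have hjT : ∀ u, jac (T u) = 1 := by
    intro u
    rw [hjac, ← Matrix.det_one (n := Fin n)]
    congr 1
    ext i j
    rw [Matrix.of_apply, hT, map_add, Derivation.map_algebraMap, add_zero, hpd, Matrix.one_apply]
  have hjt : ∀ d, jac (t d) = algebraMap k K (∏ j, (d j : k)) := by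
    intro d
    rw [hjac, map_prod, ← Matrix.det_diagonal]
    congr 1
    ext i j
    rw [Matrix.of_apply, ht, Derivation.leibniz, Derivation.map_algebraMap, hpd, Matrix.diagonal_apply]
    split_ifs <;> simp
  have hj1 : jac 1 = 1 := by
    rw [hjac, ← Matrix.det_one (n := Fin n)]
    congr 1
    ext i j
    rw [Matrix.of_apply, AlgEquiv.one_apply, hpd, Matrix.one_apply]
  have hj0 : ∀ τ, jac τ ≠ 0 := by
    intro τ h0
    have := hjmul τ τ⁻¹
    rw [mul_inv_cancel, hj1, h0, zero_mul] at this
    exact one_ne_zero this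
  have hfin := cr_rigid k n x hx ρ hρ hρ1 T (fun _ => rfl) hT t htdef ht hw ⟨0, hn⟩ s hs1 hs2' G hG htG
    (fun τ => a1 τ * jac τ ^ (-m)) (fun τ hτ => mul_ne_zero (ha10 τ hτ) (zpow_ne_zero _ (hj0 τ)))
    (by
      intro τ hτ υ hυ
      rw [ha1coc τ hτ υ hυ, hjmul, mul_zpow, map_mul, map_zpow₀]
      ring)
    (by
      intro u
      rw [h1T, hjT, one_zpow, mul_one])
    (by
      intro d
      rw [hφ, hjt, ← map_zpow₀, ← map_mul, ← Finset.prod_zpow]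
      simp only [hm]
      rw [Units.coe_prod, ← Finset.prod_mul_distrib, Finset.prod_eq_one, map_one]
      intro j _
      rw [Units.val_zpow_eq_zpow_val, ← zpow_add₀ (d j).ne_zero, add_neg_cancel, zpow_zero])
  refine ⟨m, g, hg0, fun τ hτ => ?_⟩
  have := hfin τ hτ

  rw [zpow_neg, mul_inv_eq_one₀ (zpow_ne_zero _ (hj0 τ)), ha1, div_eq_iff hg0] at this
  rw [this, mul_comm]



/-- **Degree-one semi-linear representations of the subgroup `G ⊂ Cr_n(k)` generated by
`PGL_{n+1}(k)` and the involution `σ : x₁ ↦ x₁⁻¹`.**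
Let `k` have characteristic zero, and assume `n` is even or `kˣ` is `2`-divisible.  With
`L = k(x₁,…,xₙ)`, the `PGL`-action encoded by `ρ` (with denominators `d_A`), `s` the
involution fixing `x₂,…,xₙ` and inverting `x₁`, and `j(τ) = det(∂ⱼ(τ xᵢ))` the Jacobian:
every `1`-cocycle `a : G → L^×` on the subgroup `G` generated by the projective
transformations and `s` is cohomologous to `τ ↦ j(τ)^m` for some integer `m`,
i.e. the class of `Ω^n_{L/k}` generates `H¹(G, L^×)`. -/
theorem cremona_subgroup_degree_one_cocycles
    (k : Type) [Field k] [CharZero k] (n : ℕ) (hn : 1 ≤ n)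
    (hdiv : Even n ∨ ∀ c : kˣ, ∃ b : kˣ, b ^ 2 = c)
    (x : Fin n → FractionRing (MvPolynomial (Fin n) k))
    (hx : ∀ j, x j = algebraMap (MvPolynomial (Fin n) k) (FractionRing (MvPolynomial (Fin n) k))
      (MvPolynomial.X j))
    (den : (Matrix (Fin (n + 1)) (Fin (n + 1)) k)ˣ → FractionRing (MvPolynomial (Fin n) k))
    (hden : ∀ A, den A = (∑ i : Fin n,
        algebraMap k (FractionRing (MvPolynomial (Fin n) k)) (A.val i.castSucc (Fin.last n)) * x i)
      + algebraMap k (FractionRing (MvPolynomial (Fin n) k)) (A.val (Fin.last n) (Fin.last n)))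
    (num : (Matrix (Fin (n + 1)) (Fin (n + 1)) k)ˣ → Fin n → FractionRing (MvPolynomial (Fin n) k))
    (hnum : ∀ A j, num A j = (∑ i : Fin n,
        algebraMap k (FractionRing (MvPolynomial (Fin n) k)) (A.val i.castSucc j.castSucc) * x i)
      + algebraMap k (FractionRing (MvPolynomial (Fin n) k)) (A.val (Fin.last n) j.castSucc))
    (ρ : (Matrix (Fin (n + 1)) (Fin (n + 1)) k)ˣ →
      (FractionRing (MvPolynomial (Fin n) k) ≃ₐ[k] FractionRing (MvPolynomial (Fin n) k)))
    (hρmul : ∀ A B y, ρ (A * B) y = ρ A (ρ B y))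
    (hρval : ∀ A j, ρ A (x j) * den A = num A j)
    -- the involution `s : x₁ ↦ x₁⁻¹`
    (s : FractionRing (MvPolynomial (Fin n) k) ≃ₐ[k] FractionRing (MvPolynomial (Fin n) k))
    (hs1 : s (x ⟨0, hn⟩) = (x ⟨0, hn⟩)⁻¹)
    (hs2 : ∀ j : Fin n, (j : ℕ) ≠ 0 → s (x j) = x j)
    -- the partial derivatives and the Jacobian
    (pd : Fin n → Derivation k (FractionRing (MvPolynomial (Fin n) k))
      (FractionRing (MvPolynomial (Fin n) k)))
    (hpd : ∀ i j, pd j (x i) = if i = j then 1 else 0)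
    (jac : (FractionRing (MvPolynomial (Fin n) k) ≃ₐ[k] FractionRing (MvPolynomial (Fin n) k))
      → FractionRing (MvPolynomial (Fin n) k))
    (hjac : ∀ τ, jac τ = (Matrix.of fun i j : Fin n => pd j (τ (x i))).det)
    -- the group `G` and the cocycle `a`
    (G : Subgroup ((FractionRing (MvPolynomial (Fin n) k)) ≃ₐ[k] (FractionRing (MvPolynomial (Fin n) k))))
    (hG : G = Subgroup.closure (Set.range ρ ∪ {s}))
    (a : ((FractionRing (MvPolynomial (Fin n) k)) ≃ₐ[k] (FractionRing (MvPolynomial (Fin n) k)))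
      → FractionRing (MvPolynomial (Fin n) k))
    (ha0 : ∀ τ ∈ G, a τ ≠ 0)
    (hacoc : ∀ τ ∈ G, ∀ υ ∈ G, a (τ * υ) = a τ * τ (a υ)) :
    ∃ (m : ℤ) (g : FractionRing (MvPolynomial (Fin n) k)), g ≠ 0 ∧
      ∀ τ ∈ G, a τ * τ g = g * jac τ ^ m := by
  exact cr_main k n hn hdiv x hx den hden num hnum ρ hρmul hρval s hs1 hs2 pd hpd jac hjac G hG a ha0 hacoc
end
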